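/- For large T > 0 one has ∫_T^{2T} Z²(t) ζ(1/2+it) dt = 2π ∑'_{T/(2π) ≤ k ≤ T/π} d₃(k) + O(T^{3/4} log² T). -/

import Mathlib

open Complex Filter Real MeasureTheory Finset

noncomputable def chi (s : ℂ) : ℂ :=
  2 ^ s * (π : ℂ) ^ (s - 1) * Complex.sin (π * s / 2) * Complex.Gamma (1 - s)

noncomputable def Z (t : ℝ) : ℂ :=
  chi (1 / 2 + I * t) ^ (-(1 / 2 : ℂ)) * riemannZeta (1 / 2 + I * t)

/-- number of positive divisors -/
noncomputable def d (k : ℕ) : ℕ := k.divisors.card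

/-- number of ordered triples of positive integers with product `n` -/
noncomputable def d3 (n : ℕ) : ℕ :=
  ((Finset.Icc 1 n ×ˢ Finset.Icc 1 n ×ˢ Finset.Icc 1 n).filter
    fun p : ℕ × ℕ × ℕ => p.1 * p.2.1 * p.2.2 = n).card

/-- sum over integers `a ≤ k ≤ b` where terms at integer endpoints are halved -/
noncomputable def psum (a b : ℝ) (f : ℕ → ℂ) : ℂ :=
  ∑ k ∈ Finset.Icc ⌈a⌉₊ ⌊b⌋₊,
    (if (k : ℝ) = a ∨ (k : ℝ) = b then (1 / 2 : ℂ) else 1) * f k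

open Complex.HadamardThreeLines in
lemma strip_interp {f : ℂ → ℂ} {l u : ℝ} (hlu : l < u)
    (hd : DiffContOnCl ℂ f (verticalStrip l u)) {c : ℝ}
    (hg : ∀ s : ℂ, l ≤ s.re → s.re ≤ u → ‖f s‖ ≤ Real.exp (c * (1 + |s.im|)))
    {A p q : ℝ} {r : ℕ} (hp : 0 ≤ p) (hq : 0 ≤ q) (hA : 0 < A)
    (hl : ∀ s : ℂ, s.re = l → ‖f s‖ ≤ A * (3 + |s.im|) ^ p * Real.log (3 + |s.im|) ^ r)
    (hu : ∀ s : ℂ, s.re = u → ‖f s‖ ≤ A * (3 + |s.im|) ^ q * Real.log (3 + |s.im|) ^ r) :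
    ∃ B > 0, ∀ s : ℂ, l ≤ s.re → s.re ≤ u →
      ‖f s‖ ≤ B * (3 + |s.im|) ^ (p * (1 - (s.re - l) / (u - l)) + q * ((s.re - l) / (u - l)))
        * Real.log (3 + |s.im|) ^ r := by
  set D := u - l with hD
  have hDpos : 0 < D := sub_pos.2 hlu
  refine ⟨A * Real.exp (D ^ 2 + (p + q + r) ^ 2), by positivity, fun s₀ h1 h2 => ?_⟩
  set T := s₀.im
  set K := A * Real.exp (D ^ 2 + (p + q + r) ^ 2) with hK
  have hW : 3 ≤ 3 + |T| := by linarith [abs_nonneg T]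
  have hL : 1 ≤ Real.log (3 + |T|) := by
    rw [Real.le_log_iff_exp_le (by linarith)]
    linarith [Real.exp_one_lt_d9]
  have hnorm : ∀ s : ℂ, ‖Complex.exp ((s - s₀) ^ 2)‖
      = Real.exp ((s.re - s₀.re) ^ 2 - (s.im - T) ^ 2) := by
    intro s
    rw [Complex.norm_exp]
    congr 1
    simp [sq, T]
  have key : ∀ s : ℂ, ∀ m : ℝ, 0 ≤ m → m ≤ p + q → |s.re - s₀.re| ≤ D →
      ‖f s‖ ≤ A * (3 + |s.im|) ^ m * Real.log (3 + |s.im|) ^ r →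
      ‖f s * Complex.exp ((s - s₀) ^ 2)‖ ≤ K * (3 + |T|) ^ m * Real.log (3 + |T|) ^ r := by
    intro s m hm hm' hre hf
    rw [norm_mul, hnorm]
    set v := |s.im - T| with hv
    have hv0 : 0 ≤ v := abs_nonneg _
    have e1 : 3 + |s.im| ≤ (3 + |T|) * Real.exp v := by
      have : |s.im| ≤ |T| + v := by
        have := abs_add_le T (s.im - T); simpa using this
      have h3 := Real.add_one_le_exp v
      nlinarith [abs_nonneg T, mul_le_mul_of_nonneg_left h3 (show 0 ≤ 3 + |T| by positivity),
        mul_nonneg (abs_nonneg T) hv0]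
    have hpos : 0 < 3 + |s.im| := by positivity
    have e2 : Real.log (3 + |s.im|) ≤ Real.log (3 + |T|) * Real.exp v := by
      have h := Real.log_le_log hpos e1
      rw [Real.log_mul (by positivity) (by positivity), Real.log_exp] at h
      have h3 := Real.add_one_le_exp v
      nlinarith
    have e2' : 0 ≤ Real.log (3 + |s.im|) := Real.log_nonneg (by linarith [abs_nonneg s.im])
    have e3 : (3 + |s.im|) ^ m ≤ (3 + |T|) ^ m * Real.exp (m * v) := by
      calc _ ≤ ((3 + |T|) * Real.exp v) ^ m := Real.rpow_le_rpow hpos.le e1 hm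
        _ = _ := by
          rw [Real.mul_rpow (by positivity) (by positivity), ← Real.exp_mul, mul_comm v]
    have e4 : Real.log (3 + |s.im|) ^ r ≤ Real.log (3 + |T|) ^ r * Real.exp (r * v) := by
      calc _ ≤ (Real.log (3 + |T|) * Real.exp v) ^ r := pow_le_pow_left₀ e2' e2 r
        _ = _ := by rw [mul_pow, Real.exp_nat_mul]
    have e5 : (s.re - s₀.re) ^ 2 ≤ D ^ 2 := sq_le_sq' (by linarith [abs_le.1 hre]) (abs_le.1 hre).2
    have e6 : (s.im - T) ^ 2 = v ^ 2 := (sq_abs _).symm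
    calc ‖f s‖ * Real.exp ((s.re - s₀.re) ^ 2 - (s.im - T) ^ 2)
        ≤ (A * ((3 + |T|) ^ m * Real.exp (m * v)) * (Real.log (3 + |T|) ^ r * Real.exp (r * v)))
          * Real.exp (D ^ 2 - v ^ 2) := by
          rw [e6]
          gcongr
          exact hf.trans (by gcongr)
      _ = A * (3 + |T|) ^ m * Real.log (3 + |T|) ^ r
            * (Real.exp (m * v) * Real.exp (r * v) * Real.exp (D ^ 2 - v ^ 2)) := by ring
      _ ≤ A * (3 + |T|) ^ m * Real.log (3 + |T|) ^ r * Real.exp (D ^ 2 + (p + q + r) ^ 2) := by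
          gcongr
          rw [← Real.exp_add, ← Real.exp_add]
          refine Real.exp_le_exp.2 ?_
          have hr : (0:ℝ) ≤ r := Nat.cast_nonneg r
          nlinarith [sq_nonneg (v - (p + q + r)), mul_le_mul_of_nonneg_right hm' hv0,
            sq_nonneg (p + q + r), sq_nonneg v]
      _ = _ := by rw [hK]; ring
  have hbd : BddAbove ((norm ∘ fun s => f s * Complex.exp ((s - s₀) ^ 2)) ''
      verticalClosedStrip l u) := by
    refine ⟨Real.exp (|c| * (1 + |T|) + D ^ 2 + c ^ 2), ?_⟩
    rintro _ ⟨s, hs, rfl⟩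
    simp only [verticalClosedStrip, Set.mem_preimage, Set.mem_Icc] at hs
    simp only [Function.comp, norm_mul, hnorm]
    calc _ ≤ Real.exp (c * (1 + |s.im|)) * Real.exp ((s.re - s₀.re) ^ 2 - (s.im - T) ^ 2) := by
            gcongr; exact hg s hs.1 hs.2
      _ ≤ _ := by
        rw [← Real.exp_add]
        refine Real.exp_le_exp.2 ?_
        have h3 : |s.im| ≤ |T| + |s.im - T| := by
          have := abs_add_le T (s.im - T); simpa using this
        have e5 : (s.re - s₀.re) ^ 2 ≤ D ^ 2 := sq_le_sq' (by linarith) (by linarith)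
        have e6 : (s.im - T) ^ 2 = |s.im - T| ^ 2 := (sq_abs _).symm
        have h4 : c * (1 + |s.im|) ≤ |c| * (1 + |s.im|) := by gcongr; exact le_abs_self c
        have h5 : |c| * |s.im| ≤ |c| * (|T| + |s.im - T|) := by gcongr
        have h6 : |c| ^ 2 = c ^ 2 := sq_abs c
        nlinarith [sq_nonneg (|c| - |s.im - T|), sq_nonneg |s.im - T|, sq_nonneg |c|]
  have hdg : DiffContOnCl ℂ (fun s => f s * Complex.exp ((s - s₀) ^ 2)) (verticalStrip l u) := by
    have : Differentiable ℂ fun s : ℂ => Complex.exp ((s - s₀) ^ 2) := by fun_prop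
    simpa [smul_eq_mul] using hd.smul this.diffContOnCl
  have main := norm_le_interp_of_mem_verticalClosedStrip' (z := s₀) hlu ⟨h1, h2⟩ hdg hbd
    (a := K * (3 + |T|) ^ p * Real.log (3 + |T|) ^ r)
    (b := K * (3 + |T|) ^ q * Real.log (3 + |T|) ^ r)
    (fun s hs => key s p hp (by linarith) (by
      rw [Set.mem_preimage, Set.mem_singleton_iff] at hs
      rw [hs, abs_le]; constructor <;> linarith) (hl s hs))
    (fun s hs => key s q hq (by linarith) (by
      rw [Set.mem_preimage, Set.mem_singleton_iff] at hs
      rw [hs, abs_le]; constructor <;> linarith) (hu s hs))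
  simp only [sub_self, ne_eq, OfNat.ofNat_ne_zero, not_false_eq_true, zero_pow, Complex.exp_zero,
    mul_one] at main
  refine main.trans (le_of_eq ?_)
  rw [← hD]
  set θ := (s₀.re - l) / D
  have hKpos : 0 < K := by positivity
  have hLr : 0 < Real.log (3 + |T|) ^ r := by positivity
  have hWpos : 0 < 3 + |T| := by positivity
  rw [Real.mul_rpow (by positivity) hLr.le, Real.mul_rpow hKpos.le (by positivity),
    Real.mul_rpow (by positivity) hLr.le, Real.mul_rpow hKpos.le (by positivity),
    ← Real.rpow_mul hWpos.le, ← Real.rpow_mul hWpos.le, Real.rpow_add hWpos]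
  have a1 : K ^ (1 - θ) * K ^ θ = K := by
    rw [← Real.rpow_add hKpos]; simp
  have a2 : (Real.log (3 + |T|) ^ r) ^ (1 - θ) * (Real.log (3 + |T|) ^ r) ^ θ
      = Real.log (3 + |T|) ^ r := by
    rw [← Real.rpow_add hLr]; simp
  calc _ = (K ^ (1 - θ) * K ^ θ) * ((3 + |T|) ^ (p * (1 - θ)) * (3 + |T|) ^ (q * θ)) *
      ((Real.log (3 + |T|) ^ r) ^ (1 - θ) * (Real.log (3 + |T|) ^ r) ^ θ) := by ring
    _ = _ := by rw [a1, a2]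

lemma norm_Gamma_one_add_le (t : ℝ) :
    ‖Complex.Gamma (1 + t * I)‖ ^ 2 ≤ (1 + 2 * π * |t|) * Real.exp (-π * |t|) := by
  rcases eq_or_ne t 0 with rfl | ht
  · simp
  have h0 : (t : ℂ) * I ≠ 0 := by simp [ht]
  have h1 : Complex.Gamma (1 + t * I) * Complex.Gamma (1 - t * I)
      = t * I * (π / Complex.sin (π * (t * I))) := by
    rw [← Complex.Gamma_mul_Gamma_one_sub, add_comm, Complex.Gamma_add_one _ h0]
    ring
  have h2 : Complex.Gamma (1 - t * I) = (starRingEnd ℂ) (Complex.Gamma (1 + t * I)) := by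
    rw [← Complex.Gamma_conj]
    simp [sub_eq_add_neg]
  have h3 : ‖Complex.Gamma (1 + t * I)‖ ^ 2 = |t| * (π / Real.sinh (π * |t|)) := by
    have := congrArg norm h1
    rw [h2, norm_mul, RCLike.norm_conj, ← sq] at this
    rw [this]
    have h4 : Complex.sin (π * (t * I)) = Real.sinh (π * t) * I := by
      rw [← mul_assoc, Complex.sin_mul_I]; push_cast; rfl
    rw [h4]
    simp only [norm_mul, norm_div, Complex.norm_real, Complex.norm_I, mul_one, Real.norm_eq_abs,
      Real.abs_sinh, abs_mul, abs_of_pos Real.pi_pos]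
  rw [h3]
  set x := π * |t| with hx
  have hxpos : 0 < x := by positivity
  have hs : 0 < Real.sinh x := Real.sinh_pos_iff.2 hxpos
  rw [← mul_div_assoc, div_le_iff₀ hs, Real.sinh_eq, show -π * |t| = -x by rw [hx]; ring,
    show |t| * π = x by rw [hx]; ring, show 2 * π * |t| = 2 * x by rw [hx]; ring]
  have h5 : Real.exp (-x) * Real.exp x = 1 := by rw [← Real.exp_add]; simp
  have h6 : Real.exp (-x) * Real.exp (-x) ≤ 1 / (1 + 2 * x) := by
    rw [← Real.exp_add, le_div_iff₀ (by positivity)]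
    have := Real.add_one_le_exp (2 * x)
    calc Real.exp (-x + -x) * (1 + 2 * x) ≤ Real.exp (-x + -x) * Real.exp (2 * x) := by
          gcongr; linarith
      _ = 1 := by rw [← Real.exp_add]; ring_nf; simp
  have h7 : (1 + 2 * x) * (Real.exp (-x) * Real.exp (-x)) ≤ 1 := by
    rw [le_div_iff₀ (by positivity)] at h6; linarith
  nlinarith

lemma exists_Gamma_re_le : ∃ M > 0, ∀ x : ℝ, 1 / 4 ≤ x → x ≤ 3 → Real.Gamma x ≤ M := by
  have hc : ContinuousOn Real.Gamma (Set.Icc (1 / 4) 3) := by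
    intro x hx
    refine (Real.differentiableAt_Gamma ?_).continuousAt.continuousWithinAt
    intro m hm
    have := hx.1
    have : (0:ℝ) ≤ m := Nat.cast_nonneg m
    linarith
  obtain ⟨M, hM⟩ := isCompact_Icc.bddAbove_image hc
  refine ⟨max M 1, by positivity, fun x h1 h2 => ?_⟩
  exact le_max_of_le_left (hM ⟨x, ⟨h1, h2⟩, rfl⟩)

lemma norm_Gamma_le_Gamma_re {s : ℂ} (hs : 0 < s.re) :
    ‖Complex.Gamma s‖ ≤ Real.Gamma s.re := by
  rw [Complex.Gamma_eq_integral hs, Real.Gamma_eq_integral hs, Complex.GammaIntegral]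
  refine (norm_integral_le_integral_norm _).trans (le_of_eq ?_)
  refine setIntegral_congr_fun measurableSet_Ioi fun x hx => ?_
  simp only [norm_mul, Complex.norm_real, Real.norm_eq_abs, Real.abs_exp]
  rw [Complex.norm_cpow_eq_rpow_re_of_pos hx]
  simp

lemma exists_norm_Gamma_mul_exp_le : ∃ C > 0, ∀ s : ℂ, 1 ≤ s.re → s.re ≤ 2 →
    ‖Complex.Gamma s‖ * Real.exp (π / 2 * s.im) ≤ C * (3 + |s.im|) ^ (s.re - 1 / 2) := by
  set f : ℂ → ℂ := fun s => Complex.Gamma s * Complex.exp (-(I * π / 2) * s) with hf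
  have hnorm : ∀ s, ‖f s‖ = ‖Complex.Gamma s‖ * Real.exp (π / 2 * s.im) := by
    intro s
    rw [hf]
    simp only [norm_mul, Complex.norm_exp]
    congr 2
    simp
  obtain ⟨M, hM0, hM⟩ := exists_Gamma_re_le
  have h1 : ∀ s : ℂ, s.re = 1 → ‖Complex.Gamma s‖ * Real.exp (π / 2 * s.im)
      ≤ 7 * (3 + |s.im|) ^ (1 / 2 : ℝ) := by
    intro s hs
    have e : s = 1 + s.im * I := by apply Complex.ext <;> simp [hs]
    have h := norm_Gamma_one_add_le s.im
    rw [← e] at h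
    refine le_of_sq_le_sq ?_ (by positivity)
    rw [mul_pow, mul_pow, ← Real.exp_nat_mul, ← Real.rpow_mul_natCast (by positivity)]
    norm_num
    calc _ ≤ ((1 + 2 * π * |s.im|) * Real.exp (-π * |s.im|)) * Real.exp (2 * (π / 2 * s.im)) := by
            gcongr
      _ = (1 + 2 * π * |s.im|) * Real.exp (-π * |s.im| + 2 * (π / 2 * s.im)) := by
            rw [mul_assoc, ← Real.exp_add]
      _ ≤ (1 + 2 * π * |s.im|) * 1 := by
            gcongr
            rw [Real.exp_le_one_iff]
            nlinarith [le_abs_self s.im, Real.pi_pos]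
      _ ≤ _ := by nlinarith [Real.pi_lt_four, abs_nonneg s.im]
  have hd : DiffContOnCl ℂ f (Complex.HadamardThreeLines.verticalStrip 1 2) := by
    apply DifferentiableOn.diffContOnCl
    rw [Complex.HadamardThreeLines.verticalStrip, Complex.closure_preimage_re,
      closure_Ioo (by norm_num)]
    intro s hs
    have hs1 : 1 ≤ s.re := hs.1
    refine (DifferentiableAt.mul (Complex.differentiableAt_Gamma s ?_)
      (by fun_prop)).differentiableWithinAt
    intro m hm
    have : s.re = -m := by rw [hm]; simp
    have : (0:ℝ) ≤ m := Nat.cast_nonneg m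
    linarith
  obtain ⟨B, hB0, hB⟩ := strip_interp (f := f) (l := 1) (u := 2) (by norm_num) hd
    (c := M + π) (A := 7) (p := 1 / 2) (q := 3 / 2) (r := 0)
    (by
      intro s h1 h2
      rw [hnorm]
      calc _ ≤ Real.exp M * Real.exp (π * |s.im|) := by
            refine mul_le_mul ?_ (Real.exp_le_exp.2 ?_) (by positivity) (by positivity)
            · calc _ ≤ Real.Gamma s.re := norm_Gamma_le_Gamma_re (by linarith)
                _ ≤ M := hM _ (by linarith) (by linarith)
                _ ≤ _ := by linarith [Real.add_one_le_exp M]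
            · nlinarith [le_abs_self s.im, abs_nonneg s.im, Real.pi_pos]
        _ ≤ _ := by
          rw [← Real.exp_add]
          refine Real.exp_le_exp.2 ?_
          nlinarith [abs_nonneg s.im, Real.pi_pos, mul_nonneg hM0.le (abs_nonneg s.im)])
    (by norm_num) (by norm_num) (by norm_num)
    (by
      intro s hs
      rw [hnorm, pow_zero, mul_one]
      exact h1 s hs)
    (by
      intro s hs
      rw [hnorm, pow_zero, mul_one]
      have e0 : s - 1 ≠ 0 := by
        intro h
        have := congrArg Complex.re h
        simp [hs] at this
        norm_num at this
      have e : Complex.Gamma s = (s - 1) * Complex.Gamma (s - 1) := by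
        rw [← Complex.Gamma_add_one _ e0]; simp
      have h := h1 (s - 1) (by simp [hs]; norm_num)
      have him : (s - 1).im = s.im := by simp
      rw [him] at h
      have hn : ‖s - 1‖ ≤ 3 + |s.im| := by
        refine (Complex.norm_le_abs_re_add_abs_im _).trans ?_
        rw [him]; simp [hs]; norm_num
      rw [e, norm_mul, show (3 / 2 : ℝ) = 1 + 1 / 2 by norm_num,
        Real.rpow_add (by positivity), Real.rpow_one]
      calc ‖s - 1‖ * ‖Complex.Gamma (s - 1)‖ * Real.exp (π / 2 * s.im)
          = ‖s - 1‖ * (‖Complex.Gamma (s - 1)‖ * Real.exp (π / 2 * s.im)) := by ring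
        _ ≤ (3 + |s.im|) * (7 * (3 + |s.im|) ^ (1 / 2 : ℝ)) := by gcongr
        _ = _ := by ring)
  refine ⟨B, hB0, fun s h1 h2 => ?_⟩
  have := hB s h1 h2
  rw [hnorm, pow_zero, mul_one] at this
  convert this using 3
  ring

/-- Upper bound of Stirling strength for `Γ` in a vertical strip. -/
lemma exists_norm_Gamma_le : ∃ C > 0, ∀ s : ℂ, 1 / 4 ≤ s.re → s.re ≤ 2 →
    ‖Complex.Gamma s‖ ≤ C * (3 + |s.im|) ^ (s.re - 1 / 2) * Real.exp (-(π / 2 * |s.im|)) := by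
  obtain ⟨C, hC0, hC⟩ := exists_norm_Gamma_mul_exp_le
  have h1 : ∀ s : ℂ, 1 ≤ s.re → s.re ≤ 2 →
      ‖Complex.Gamma s‖ ≤ C * (3 + |s.im|) ^ (s.re - 1 / 2) * Real.exp (-(π / 2 * |s.im|)) := by
    intro s hs hs'
    rw [Real.exp_neg, ← div_eq_mul_inv, le_div_iff₀ (Real.exp_pos _)]
    rcases abs_cases s.im with ⟨h, _⟩ | ⟨h, _⟩
    · rw [h, ← h]; simpa [h] using hC s hs hs'
    · have := hC ((starRingEnd ℂ) s) (by simpa using hs) (by simpa using hs')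
      rw [Complex.Gamma_conj, RCLike.norm_conj] at this
      simpa [h] using this
  refine ⟨13 * C, by positivity, fun s hs hs' => ?_⟩
  rcases le_total 1 s.re with h | h
  · refine (h1 s h hs').trans ?_
    gcongr
    linarith
  · have h2 := h1 (s + 1) (by simp; linarith) (by simp; linarith)
    have e0 : s ≠ 0 := by
      intro h; rw [h] at hs; norm_num at hs
    rw [Complex.Gamma_add_one _ e0, norm_mul] at h2
    simp only [add_im, one_im, add_zero, add_re, one_re] at h2
    have h3 : 3 + |s.im| ≤ 13 * ‖s‖ := by
      have a := Complex.abs_re_le_norm s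
      have b := Complex.abs_im_le_norm s
      have := le_abs_self s.re
      linarith
    have hW : 0 < 3 + |s.im| := by positivity
    rw [show s.re + 1 - 1 / 2 = 1 + (s.re - 1 / 2) by ring, Real.rpow_add hW, Real.rpow_one] at h2
    have hn : 0 < ‖s‖ := norm_pos_iff.2 e0
    refine le_of_mul_le_mul_left (h2.trans ?_) hn
    calc _ = (3 + |s.im|) * (C * (3 + |s.im|) ^ (s.re - 1 / 2) * Real.exp (-(π / 2 * |s.im|))) := by
          ring
      _ ≤ (13 * ‖s‖) * (C * (3 + |s.im|) ^ (s.re - 1 / 2) * Real.exp (-(π / 2 * |s.im|))) := by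
          gcongr
      _ = _ := by ring

lemma exists_norm_mellin_le {f : ℝ → ℂ} {l u : ℝ}
    (hl : MellinConvergent f l) (hu : MellinConvergent f u) :
    ∃ C : ℝ, ∀ s : ℂ, l ≤ s.re → s.re ≤ u → ‖mellin f s‖ ≤ C := by
  have hInt : IntegrableOn (fun t : ℝ => ‖(t : ℂ) ^ ((l : ℂ) - 1) • f t‖
      + ‖(t : ℂ) ^ ((u : ℂ) - 1) • f t‖) (Set.Ioi 0) := hl.norm.add hu.norm
  refine ⟨∫ t in Set.Ioi (0:ℝ), (‖(t : ℂ) ^ ((l : ℂ) - 1) • f t‖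
      + ‖(t : ℂ) ^ ((u : ℂ) - 1) • f t‖), fun s h1 h2 => ?_⟩
  rw [mellin]
  refine norm_integral_le_of_norm_le hInt ?_
  refine (ae_restrict_iff' measurableSet_Ioi).2 (ae_of_all _ fun t ht => ?_)
  have ht : 0 < t := ht
  simp only [norm_smul, Complex.norm_cpow_eq_rpow_re_of_pos ht, sub_re, ofReal_re, one_re]
  rw [← add_mul]
  refine mul_le_mul_of_nonneg_right ?_ (norm_nonneg _)
  rcases le_total 1 t with h | h
  · have := Real.rpow_le_rpow_of_exponent_le h (show s.re - 1 ≤ u - 1 by linarith)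
    have := Real.rpow_nonneg ht.le (l - 1)
    linarith
  · have := Real.rpow_le_rpow_of_exponent_ge ht h (show l - 1 ≤ s.re - 1 by linarith)
    have := Real.rpow_nonneg ht.le (u - 1)
    linarith

lemma exists_norm_completedRiemannZeta₀_le (l u : ℝ) :
    ∃ C : ℝ, ∀ s : ℂ, l ≤ s.re → s.re ≤ u → ‖completedRiemannZeta₀ s‖ ≤ C := by
  have h := fun s =>
    ((HurwitzZeta.hurwitzEvenFEPair 0).isStrongFEPair_toStrongFEPair.hasMellin s).1
  obtain ⟨C, hC⟩ := exists_norm_mellin_le (h ((l / 2 : ℝ) : ℂ)) (h ((u / 2 : ℝ) : ℂ))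
  refine ⟨C / 2, fun s h1 h2 => ?_⟩
  have := hC (s / 2) (by simp; linarith) (by simp; linarith)
  change ‖(mellin _ (s / 2)) / 2‖ ≤ C / 2
  rw [norm_div, Complex.norm_ofNat]
  exact div_le_div_of_nonneg_right this (by norm_num)

lemma norm_sin_le (z : ℂ) : ‖Complex.sin z‖ ≤ Real.exp |z.im| := by
  rw [Complex.sin]
  simp only [norm_div, norm_mul, Complex.norm_I, mul_one, Complex.norm_ofNat]
  rw [div_le_iff₀ (by norm_num)]
  refine (norm_sub_le _ _).trans ?_
  simp only [Complex.norm_exp]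
  have h1 : Real.exp (-z * I).re ≤ Real.exp |z.im| := by
    refine Real.exp_le_exp.2 ?_; simp; exact le_abs_self _
  have h2 : Real.exp (z * I).re ≤ Real.exp |z.im| := by
    refine Real.exp_le_exp.2 ?_; simp; exact neg_le_abs _
  linarith

lemma norm_cos_le (z : ℂ) : ‖Complex.cos z‖ ≤ Real.exp |z.im| := by
  rw [Complex.cos]
  simp only [norm_div, Complex.norm_ofNat]
  rw [div_le_iff₀ (by norm_num)]
  refine (norm_add_le _ _).trans ?_
  simp only [Complex.norm_exp]
  have h1 : Real.exp (-z * I).re ≤ Real.exp |z.im| := by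
    refine Real.exp_le_exp.2 ?_; simp; exact le_abs_self _
  have h2 : Real.exp (z * I).re ≤ Real.exp |z.im| := by
    refine Real.exp_le_exp.2 ?_; simp; exact neg_le_abs _
  linarith

/-- The entire function `s (s - 1) ζ(s)`, written without division. -/
noncomputable def xiZeta (s : ℂ) : ℂ :=
  (s * (s - 1) * completedRiemannZeta₀ s + 1) * π ^ (s / 2) *
    (Complex.Gamma (s / 2))⁻¹

lemma xiZeta_eq {s : ℂ} (h0 : s ≠ 0) (h1 : s ≠ 1) : xiZeta s = s * (s - 1) * riemannZeta s := by
  have h2 : 1 - s ≠ 0 := sub_ne_zero.2 h1.symm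
  have h3 : s - 1 ≠ 0 := sub_ne_zero.2 h1
  have hpi : (π : ℂ) ≠ 0 := by exact_mod_cast Real.pi_ne_zero
  rw [riemannZeta_eq_completedRiemannZeta₀ h0, xiZeta, neg_div, Complex.cpow_neg, mul_comm
    ((π : ℂ) ^ (s / 2))⁻¹, ← div_div, div_inv_eq_mul]
  have e : s * (s - 1) * (completedRiemannZeta₀ s - 1 / s - 1 / (1 - s))
      = s * (s - 1) * completedRiemannZeta₀ s + 1 := by
    field_simp
    ring
  rw [← e]
  ring

lemma differentiable_xiZeta : Differentiable ℂ xiZeta := by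
  have hpi : (π : ℂ) ≠ 0 := by exact_mod_cast Real.pi_ne_zero
  have h1 : Differentiable ℂ (fun s : ℂ => (Complex.Gamma (s / 2))⁻¹) :=
    Complex.differentiable_one_div_Gamma.comp (differentiable_id.div_const 2)
  have h2 : Differentiable ℂ (fun s : ℂ => (π : ℂ) ^ (s / 2)) := fun s =>
    (DifferentiableAt.const_cpow (by fun_prop) (Or.inl hpi))
  have h3 := differentiable_completedZeta₀
  unfold xiZeta
  fun_prop

lemma exists_norm_xiZeta_le : ∃ C : ℝ, ∀ s : ℂ, -1 / 2 ≤ s.re → s.re ≤ 3 / 2 →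
    ‖xiZeta s‖ ≤ Real.exp (C * (1 + |s.im|)) := by
  obtain ⟨C, hC⟩ := exists_norm_completedRiemannZeta₀_le (-1 / 2) (3 / 2)
  obtain ⟨M, hM0, hM⟩ := exists_Gamma_re_le
  have hC0 : 0 ≤ C := (norm_nonneg _).trans (hC 0 (by norm_num) (by norm_num))
  refine ⟨6 + C + M, fun s h1 h2 => ?_⟩
  have hpi : (π : ℂ) ≠ 0 := by exact_mod_cast Real.pi_ne_zero
  have hre : (1 - s / 2).re = 1 - s.re / 2 := by simp
  have e1 : (Complex.Gamma (s / 2))⁻¹ =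
      Complex.Gamma (1 - s / 2) * Complex.sin (π * (s / 2)) / π := by
    have h := Complex.Gamma_mul_Gamma_one_sub (s / 2)
    have h3 : Complex.Gamma (1 - s / 2) ≠ 0 :=
      Complex.Gamma_ne_zero_of_re_pos (by rw [hre]; linarith)
    rcases eq_or_ne (Complex.sin (π * (s / 2))) 0 with h4 | h4
    · rw [h4, div_zero] at h
      rw [h4, (mul_eq_zero.1 h).resolve_right h3]; simp
    · rw [eq_div_iff h4] at h
      have h5 : Complex.Gamma (s / 2) ≠ 0 := by
        rintro h5; rw [h5, zero_mul, zero_mul] at h; exact hpi h.symm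
      rw [inv_eq_iff_eq_inv, inv_div, eq_div_iff (mul_ne_zero h3 h4), ← mul_assoc, h]
  have n1 : ‖(Complex.Gamma (s / 2))⁻¹‖ ≤ Real.exp (M + 2 * |s.im|) := by
    rw [e1, norm_div, norm_mul, Complex.norm_real, Real.norm_eq_abs, abs_of_pos Real.pi_pos,
      div_le_iff₀ Real.pi_pos]
    have a1 : ‖Complex.Gamma (1 - s / 2)‖ ≤ Real.exp M := by
      calc _ ≤ Real.Gamma (1 - s / 2).re := norm_Gamma_le_Gamma_re (by rw [hre]; linarith)
        _ ≤ M := hM _ (by rw [hre]; linarith) (by rw [hre]; linarith)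
        _ ≤ _ := by linarith [Real.add_one_le_exp M]
    have a2 : ‖Complex.sin (π * (s / 2))‖ ≤ Real.exp (2 * |s.im|) := by
      refine (norm_sin_le _).trans (Real.exp_le_exp.2 ?_)
      have : (π * (s / 2) : ℂ).im = π / 2 * s.im := by
        simp; ring
      rw [this, abs_mul, abs_of_pos (by positivity)]
      gcongr
      linarith [Real.pi_lt_four]
    calc _ ≤ Real.exp M * Real.exp (2 * |s.im|) := by gcongr
      _ = Real.exp (M + 2 * |s.im|) * 1 := by rw [Real.exp_add, mul_one]
      _ ≤ _ := by gcongr; linarith [Real.pi_gt_three]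
  have n2 : ‖(π : ℂ) ^ (s / 2)‖ ≤ Real.exp 3 := by
    rw [Complex.norm_cpow_eq_rpow_re_of_pos Real.pi_pos]
    calc π ^ (s / 2).re ≤ π ^ (1 : ℝ) := by
          refine Real.rpow_le_rpow_of_exponent_le (by linarith [Real.pi_gt_three]) ?_
          simp; linarith
      _ ≤ _ := by
          rw [Real.rpow_one]
          linarith [Real.pi_lt_four, Real.add_one_le_exp (3:ℝ)]
  have n3 : ‖s * (s - 1) * completedRiemannZeta₀ s + 1‖ ≤ Real.exp (1 + 2 * |s.im| + C) := by
    have b1 : ‖s‖ ≤ Real.exp (1 / 2 + |s.im|) := by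
      have := Complex.norm_le_abs_re_add_abs_im s
      have h : |s.re| ≤ 3 / 2 := abs_le.2 ⟨by linarith, by linarith⟩
      linarith [Real.add_one_le_exp (1 / 2 + |s.im|)]
    have b2 : ‖s - 1‖ ≤ Real.exp (1 / 2 + |s.im|) := by
      have := Complex.norm_le_abs_re_add_abs_im (s - 1)
      have h : |s.re - 1| ≤ 3 / 2 := abs_le.2 ⟨by linarith, by linarith⟩
      simp only [sub_re, one_re, sub_im, one_im, sub_zero] at this
      linarith [Real.add_one_le_exp (1 / 2 + |s.im|)]
    have b3 : ‖s * (s - 1)‖ ≤ Real.exp (1 + 2 * |s.im|) := by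
      rw [norm_mul]
      calc _ ≤ Real.exp (1 / 2 + |s.im|) * Real.exp (1 / 2 + |s.im|) := by gcongr
        _ = _ := by rw [← Real.exp_add]; ring_nf
    have b4 : 1 ≤ Real.exp (1 + 2 * |s.im|) := Real.one_le_exp (by positivity)
    calc _ ≤ ‖s * (s - 1)‖ * ‖completedRiemannZeta₀ s‖ + 1 := by
          refine (norm_add_le _ _).trans ?_
          rw [norm_mul, norm_one]
      _ ≤ Real.exp (1 + 2 * |s.im|) * C + Real.exp (1 + 2 * |s.im|) := by
          gcongr
          exact hC s h1 h2
      _ = Real.exp (1 + 2 * |s.im|) * (C + 1) := by ring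
      _ ≤ Real.exp (1 + 2 * |s.im|) * Real.exp C := by gcongr; exact Real.add_one_le_exp C
      _ = _ := by rw [← Real.exp_add]
  rw [xiZeta, norm_mul, norm_mul]
  calc _ ≤ Real.exp (1 + 2 * |s.im| + C) * Real.exp 3 * Real.exp (M + 2 * |s.im|) := by gcongr
    _ = Real.exp (1 + 2 * |s.im| + C + 3 + (M + 2 * |s.im|)) := by
      rw [← Real.exp_add, ← Real.exp_add]
    _ ≤ _ := by
      refine Real.exp_le_exp.2 ?_
      nlinarith [abs_nonneg s.im, mul_nonneg hC0 (abs_nonneg s.im),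
        mul_nonneg hM0.le (abs_nonneg s.im)]

lemma norm_cpow_neg_sub_le {s : ℂ} {x u : ℝ} (hs : 1 ≤ s.re) (hx : 1 ≤ x) (hxu : x ≤ u)
    (hux : u ≤ x + 1) :
    ‖(x : ℂ) ^ (-s) - (u : ℂ) ^ (-s)‖ ≤ min (2 / x) (‖s‖ / x ^ 2) := by
  have hx0 : 0 < x := by linarith
  have hle : ∀ v : ℝ, x ≤ v → ‖(v : ℂ) ^ (-s)‖ ≤ 1 / x := fun v hv => by
    have hv0 : 0 < v := by linarith
    rw [Complex.norm_cpow_eq_rpow_re_of_pos hv0, neg_re]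
    calc v ^ (-s.re) ≤ v ^ (-1 : ℝ) :=
          Real.rpow_le_rpow_of_exponent_le (by linarith) (by linarith)
      _ ≤ 1 / x := by rw [Real.rpow_neg_one, ← one_div]; gcongr
  refine le_min ?_ ?_
  · refine (norm_sub_le _ _).trans ?_
    have := hle x le_rfl
    have := hle u hxu
    rw [show 2 / x = 1 / x + 1 / x by ring]
    linarith
  · have hder : ∀ v ∈ Set.Icc x u, HasDerivWithinAt (fun v : ℝ => (v : ℂ) ^ (-s))
        (-s * (v : ℂ) ^ (-s - 1)) (Set.Icc x u) v := by
      intro v hv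
      have hv0 : v ≠ 0 := by linarith [hv.1]
      have hs0 : -s ≠ 0 := by
        rintro h
        have := congrArg Complex.re h
        simp at this; linarith
      exact (hasDerivAt_ofReal_cpow_const hv0 hs0).hasDerivWithinAt
    have hb : ∀ v ∈ Set.Ico x u, ‖-s * (v : ℂ) ^ (-s - 1)‖ ≤ ‖s‖ / x ^ 2 := by
      intro v hv
      have hv0 : 0 < v := by linarith [hv.1]
      rw [norm_mul, norm_neg, Complex.norm_cpow_eq_rpow_re_of_pos hv0, div_eq_mul_inv]
      gcongr
      calc v ^ (-s - 1).re ≤ v ^ (-2 : ℝ) := by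
            refine Real.rpow_le_rpow_of_exponent_le (by linarith [hv.1]) ?_
            simp; linarith
        _ = (v ^ 2)⁻¹ := by rw [Real.rpow_neg hv0.le]; norm_num
        _ ≤ _ := by gcongr; exact hv.1
    have := norm_image_sub_le_of_norm_deriv_le_segment' hder hb u ⟨hxu, le_rfl⟩
    rw [norm_sub_rev]
    refine this.trans ?_
    exact mul_le_of_le_one_right (by positivity) (by linarith)

lemma norm_telescope_term_le {s : ℂ} {x : ℝ} (hs : 1 < s.re) (hx : 1 ≤ x) :
    ‖(s - 1) * (x : ℂ) ^ (-s) - ((x : ℂ) ^ (1 - s) - ((x + 1 : ℝ) : ℂ) ^ (1 - s))‖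
      ≤ ‖s - 1‖ * min (2 / x) (‖s‖ / x ^ 2) := by
  have hder : ∀ v ∈ Set.Icc x (x + 1), HasDerivWithinAt
      (fun v : ℝ => (s - 1) * (x : ℂ) ^ (-s) * v + (v : ℂ) ^ (1 - s))
        ((s - 1) * (x : ℂ) ^ (-s) * 1 + (1 - s) * (v : ℂ) ^ (1 - s - 1)) (Set.Icc x (x + 1)) v := by
    intro v hv
    have hv0 : v ≠ 0 := by linarith [hv.1]
    have hs0 : 1 - s ≠ 0 := by
      rintro h
      have := congrArg Complex.re h
      simp at this; linarith
    exact ((Complex.ofRealCLM.hasDerivAt.const_mul _).add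
      (hasDerivAt_ofReal_cpow_const hv0 hs0)).hasDerivWithinAt
  have hb : ∀ v ∈ Set.Ico x (x + 1), ‖(s - 1) * (x : ℂ) ^ (-s) * 1
      + (1 - s) * (v : ℂ) ^ (1 - s - 1)‖ ≤ ‖s - 1‖ * min (2 / x) (‖s‖ / x ^ 2) := by
    intro v hv
    rw [show (s - 1) * (x : ℂ) ^ (-s) * 1 + (1 - s) * (v : ℂ) ^ (1 - s - 1)
      = (s - 1) * ((x : ℂ) ^ (-s) - (v : ℂ) ^ (-s)) by
        rw [show 1 - s - 1 = -s by ring]; ring, norm_mul]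
    gcongr
    exact norm_cpow_neg_sub_le hs.le hx hv.1 hv.2.le
  have := norm_image_sub_le_of_norm_deriv_le_segment' hder hb (x + 1) ⟨by linarith, le_rfl⟩
  rw [show x + 1 - x = 1 by ring, mul_one] at this
  refine (le_of_eq (congrArg norm ?_)).trans this
  push_cast
  ring

lemma sum_min_le (S : ℝ) (hS : 0 ≤ S) {N : ℕ} (hN : 1 ≤ N) (hSN : S ≤ N) (K : ℕ) :
    ∑ n ∈ range K, min (2 / ((n : ℝ) + 1)) (S / ((n : ℝ) + 1) ^ 2) ≤ 3 + 2 * Real.log N := by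
  have hN0 : (0:ℝ) < N := by exact_mod_cast hN
  have hbase : ∑ n ∈ range N, min (2 / ((n : ℝ) + 1)) (S / ((n : ℝ) + 1) ^ 2)
      ≤ 2 + 2 * Real.log N := by
    have h := harmonic_le_one_add_log N
    rw [harmonic] at h
    push_cast at h
    calc _ ≤ ∑ n ∈ range N, 2 * ((n : ℝ) + 1)⁻¹ := by
          refine Finset.sum_le_sum fun n _ => (min_le_left _ _).trans (le_of_eq (by ring))
      _ = 2 * ∑ n ∈ range N, ((n : ℝ) + 1)⁻¹ := by rw [Finset.mul_sum]
      _ ≤ _ := by linarith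
  rcases le_total K N with h | h
  · calc _ ≤ ∑ n ∈ range N, min (2 / ((n : ℝ) + 1)) (S / ((n : ℝ) + 1) ^ 2) := by
          refine Finset.sum_le_sum_of_subset_of_nonneg (by simpa using h) fun n _ _ => ?_
          positivity
      _ ≤ _ := by linarith
  · have : ∑ n ∈ range K, min (2 / ((n : ℝ) + 1)) (S / ((n : ℝ) + 1) ^ 2)
        ≤ 2 + 2 * Real.log N + (S / N - S / K) := by
      induction K, h using Nat.le_induction with
      | base => simpa using hbase
      | succ k hk ih =>
        rw [Finset.sum_range_succ]
        have hk0 : (0:ℝ) < k := hN0.trans_le (by exact_mod_cast hk)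
        have h1 := min_le_right (2 / ((k : ℝ) + 1)) (S / ((k : ℝ) + 1) ^ 2)
        have h2 : S / ((k : ℝ) + 1) ^ 2 ≤ S / k - S / (k + 1) := by
          rw [show S / k - S / (k + 1) = S / (k * (k + 1)) by field_simp; ring]
          gcongr
          nlinarith
        push_cast
        linarith
    have h3 : S / N ≤ 1 := by rw [div_le_one hN0]; exact hSN
    have h4 : 0 ≤ S / K := by positivity
    linarith

lemma norm_sub_one_mul_zeta_le {s : ℂ} (hs : 1 < s.re) (hs2 : s.re ≤ 3 / 2) :
    ‖(s - 1) * riemannZeta s - 1‖ ≤ ‖s - 1‖ * (5 * Real.log (3 + |s.im|)) := by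
  set N : ℕ := ⌈‖s‖⌉₊ with hN
  have hs1 : 1 ≤ ‖s‖ := (by linarith [Complex.abs_re_le_norm s, le_abs_self s.re] : 1 ≤ ‖s‖)
  have hN1 : 1 ≤ N := Nat.one_le_ceil_iff.2 (by linarith)
  have hNle : (N : ℝ) ≤ (3 + |s.im|) := by
    have h1 := (Nat.ceil_lt_add_one (norm_nonneg s)).le
    have h2 := Complex.norm_le_abs_re_add_abs_im s
    rw [abs_of_pos (by linarith)] at h2
    linarith
  have hlog1 : 1 ≤ Real.log (3 + |s.im|) := by
    rw [Real.le_log_iff_exp_le (by positivity)]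
    linarith [Real.exp_one_lt_d9, abs_nonneg s.im]
  have hlogN : Real.log N ≤ Real.log (3 + |s.im|) :=
    Real.log_le_log (by exact_mod_cast hN1) hNle
  have hsum : Summable fun n : ℕ => 1 / ((n : ℂ) + 1) ^ s := by
    have := (summable_nat_add_iff 1).2 (Complex.summable_one_div_nat_cpow.2 hs)
    simpa using this
  have hlim1 : Tendsto (fun K => ∑ n ∈ range K, 1 / ((n : ℂ) + 1) ^ s) atTop
      (nhds (riemannZeta s)) := by
    rw [zeta_eq_tsum_one_div_nat_add_one_cpow hs]
    exact hsum.hasSum.tendsto_sum_nat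
  have hlim2 : Tendsto (fun K : ℕ => (((K : ℝ) + 1 : ℝ) : ℂ) ^ (1 - s)) atTop (nhds 0) := by
    rw [tendsto_zero_iff_norm_tendsto_zero]
    have h1 : Tendsto (fun K : ℕ => ((K : ℝ) + 1) ^ (-(s.re - 1))) atTop (nhds 0) :=
      (tendsto_rpow_neg_atTop (by linarith)).comp
        (tendsto_atTop_add_const_right _ _ tendsto_natCast_atTop_atTop)
    refine h1.congr fun K => ?_
    rw [Complex.norm_cpow_eq_rpow_re_of_pos (by positivity)]
    simp
  have hpart : ∀ K : ℕ, ∑ n ∈ range K, ((s - 1) * (((n : ℝ) + 1 : ℝ) : ℂ) ^ (-s)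
      - ((((n : ℝ) + 1 : ℝ) : ℂ) ^ (1 - s) - (((n : ℝ) + 1 + 1 : ℝ) : ℂ) ^ (1 - s)))
      = (s - 1) * ∑ n ∈ range K, 1 / ((n : ℂ) + 1) ^ s
        - (1 - (((K : ℝ) + 1 : ℝ) : ℂ) ^ (1 - s)) := by
    intro K
    induction K with
    | zero => simp
    | succ K ih =>
      rw [Finset.sum_range_succ, ih, Finset.sum_range_succ, Complex.cpow_neg]
      push_cast
      ring
  have hlim : Tendsto (fun K : ℕ => ‖∑ n ∈ range K, ((s - 1) * (((n : ℝ) + 1 : ℝ) : ℂ) ^ (-s)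
      - ((((n : ℝ) + 1 : ℝ) : ℂ) ^ (1 - s) - (((n : ℝ) + 1 + 1 : ℝ) : ℂ) ^ (1 - s)))‖) atTop
      (nhds ‖(s - 1) * riemannZeta s - 1‖) := by
    simp only [hpart]
    have := ((hlim1.const_mul (s - 1)).sub (hlim2.const_sub 1)).norm
    simpa using this
  refine le_of_tendsto hlim (Eventually.of_forall fun K => ?_)
  calc _ ≤ ∑ n ∈ range K, ‖s - 1‖ * min (2 / ((n : ℝ) + 1)) (‖s‖ / ((n : ℝ) + 1) ^ 2) := by
        refine norm_sum_le_of_le _ fun n _ => ?_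
        exact norm_telescope_term_le hs (by linarith [(Nat.cast_nonneg n : (0:ℝ) ≤ n)])
    _ ≤ ‖s - 1‖ * (3 + 2 * Real.log N) := by
        rw [← Finset.mul_sum]
        gcongr
        exact sum_min_le _ (norm_nonneg _) hN1 (Nat.le_ceil _) K
    _ ≤ _ := by gcongr; linarith

lemma norm_xiZeta_le {s : ℂ} (hs : 1 ≤ s.re) (hs2 : s.re < 3 / 2) :
    ‖xiZeta s‖ ≤ 6 * (3 + |s.im|) ^ 2 * Real.log (3 + |s.im|) := by
  have key : ∀ z : ℂ, 1 < z.re → z.re ≤ 3 / 2 →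
      ‖xiZeta z‖ ≤ 6 * (3 + |z.im|) ^ 2 * Real.log (3 + |z.im|) := by
    intro z hz hz2
    have h0 : z ≠ 0 := by rintro rfl; norm_num at hz
    have h1 : z ≠ 1 := by rintro rfl; norm_num at hz
    have hlog1 : 1 ≤ Real.log (3 + |z.im|) := by
      rw [Real.le_log_iff_exp_le (by positivity)]
      linarith [Real.exp_one_lt_d9, abs_nonneg z.im]
    have a1 : ‖z‖ ≤ 3 + |z.im| := by
      have h2 := Complex.norm_le_abs_re_add_abs_im z
      rw [abs_of_pos (by linarith)] at h2
      linarith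
    have a2 : ‖z - 1‖ ≤ 3 + |z.im| := by
      have h2 := Complex.norm_le_abs_re_add_abs_im (z - 1)
      simp only [sub_re, one_re, sub_im, one_im, sub_zero] at h2
      rw [abs_of_pos (by linarith)] at h2
      linarith
    have a3 : ‖(z - 1) * riemannZeta z‖ ≤ 6 * (3 + |z.im|) * Real.log (3 + |z.im|) := by
      calc _ = ‖((z - 1) * riemannZeta z - 1) + 1‖ := by ring_nf
        _ ≤ ‖z - 1‖ * (5 * Real.log (3 + |z.im|)) + 1 := by
          refine (norm_add_le _ _).trans ?_
          rw [norm_one]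
          gcongr
          exact norm_sub_one_mul_zeta_le hz hz2
        _ ≤ (3 + |z.im|) * (5 * Real.log (3 + |z.im|)) + 1 := by gcongr
        _ ≤ _ := by nlinarith [abs_nonneg z.im]
    rw [xiZeta_eq h0 h1, mul_assoc, norm_mul]
    calc _ ≤ (3 + |z.im|) * (6 * (3 + |z.im|) * Real.log (3 + |z.im|)) := by gcongr
      _ = _ := by ring
  have hcont : Tendsto (fun ε : ℝ => ‖xiZeta (s + ε)‖) (nhdsWithin 0 (Set.Ioi 0))
      (nhds ‖xiZeta s‖) := by
    have : Continuous fun ε : ℝ => ‖xiZeta (s + ε)‖ :=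
      (differentiable_xiZeta.continuous.comp (by fun_prop)).norm
    have h := this.tendsto 0
    simp only [ofReal_zero, add_zero] at h
    exact h.mono_left nhdsWithin_le_nhds
  refine le_of_tendsto hcont ?_
  filter_upwards [Ioo_mem_nhdsGT (show 0 < 3 / 2 - s.re by linarith)] with ε hε
  have := key (s + ε) (by simp; linarith [hε.1]) (by simp; linarith [hε.2])
  simpa using this

/-- The factor in the functional equation `ζ(1 - s) = feFactor s * ζ(s)`. -/
noncomputable def feFactor (s : ℂ) : ℂ :=
  2 * (2 * π) ^ (-s) * Complex.Gamma s * Complex.cos (π * s / 2)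

lemma exists_norm_feFactor_le : ∃ C > 0, ∀ s : ℂ, 1 / 4 ≤ s.re → s.re ≤ 2 →
    ‖feFactor s‖ ≤ C * (3 + |s.im|) ^ (s.re - 1 / 2) := by
  obtain ⟨C, hC0, hC⟩ := exists_norm_Gamma_le
  refine ⟨2 * C, by positivity, fun s h1 h2 => ?_⟩
  have n1 : ‖(2 * π : ℂ) ^ (-s)‖ ≤ 1 := by
    have : (2 * π : ℂ) = ((2 * π : ℝ) : ℂ) := by push_cast; rfl
    rw [this, Complex.norm_cpow_eq_rpow_re_of_pos (by positivity)]
    refine Real.rpow_le_one_of_one_le_of_nonpos (by linarith [Real.pi_gt_three]) ?_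
    simp; linarith
  have n2 : ‖Complex.cos (π * s / 2)‖ ≤ Real.exp (π / 2 * |s.im|) := by
    refine (norm_cos_le _).trans (Real.exp_le_exp.2 (le_of_eq ?_))
    have : (π * s / 2 : ℂ).im = π / 2 * s.im := by
      simp; ring
    rw [this, abs_mul, abs_of_pos (by positivity)]
  rw [feFactor, norm_mul, norm_mul, norm_mul, Complex.norm_ofNat]
  calc _ ≤ 2 * 1 * (C * (3 + |s.im|) ^ (s.re - 1 / 2) * Real.exp (-(π / 2 * |s.im|))) *
        Real.exp (π / 2 * |s.im|) := by gcongr; exact hC s h1 h2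
    _ = 2 * C * (3 + |s.im|) ^ (s.re - 1 / 2) *
        (Real.exp (-(π / 2 * |s.im|)) * Real.exp (π / 2 * |s.im|)) := by ring
    _ = _ := by rw [← Real.exp_add]; simp

lemma zeta_one_sub_eq {s : ℂ} (h0 : 0 < s.re) (h1 : s ≠ 1) :
    riemannZeta (1 - s) = feFactor s * riemannZeta s := by
  rw [riemannZeta_one_sub _ h1, feFactor]
  intro n hn
  rw [hn] at h0
  simp at h0
  linarith [(Nat.cast_nonneg n : (0:ℝ) ≤ n)]

lemma xiZeta_zero : xiZeta 0 = 0 := by simp [xiZeta]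

lemma exists_norm_xiZeta_one_sub_le : ∃ C > 0, ∀ s : ℂ, 1 ≤ s.re → s.re < 3 / 2 →
    ‖xiZeta (1 - s)‖ ≤ C * (3 + |s.im|) ^ (s.re + 3 / 2) * Real.log (3 + |s.im|) := by
  obtain ⟨C, hC0, hC⟩ := exists_norm_feFactor_le
  refine ⟨C * 6, by positivity, fun s h1 h2 => ?_⟩
  have hlog : 0 ≤ Real.log (3 + |s.im|) := Real.log_nonneg (by linarith [abs_nonneg s.im])
  rcases eq_or_ne s 1 with rfl | h
  · rw [sub_self, xiZeta_zero, norm_zero]; positivity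
  have h0 : s ≠ 0 := by rintro rfl; norm_num at h1
  have e : xiZeta (1 - s) = feFactor s * xiZeta s := by
    rw [xiZeta_eq (sub_ne_zero.2 h.symm) (by simpa using h0), xiZeta_eq h0 h,
      zeta_one_sub_eq (by linarith) h]
    ring
  rw [e, norm_mul]
  calc _ ≤ C * (3 + |s.im|) ^ (s.re - 1 / 2) * (6 * (3 + |s.im|) ^ 2 * Real.log (3 + |s.im|)) := by
        gcongr
        · exact hC s (by linarith) (by linarith)
        · exact norm_xiZeta_le h1 h2
    _ = C * 6 * ((3 + |s.im|) ^ (s.re - 1 / 2) * (3 + |s.im|) ^ (2:ℝ)) * Real.log (3 + |s.im|) := by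
        rw [Real.rpow_two]; ring
    _ = _ := by
        rw [← Real.rpow_add (by positivity)]
        ring_nf

/-- The integrand of the third moment problem on the critical line, continued to the plane. -/
noncomputable def zetaCube (s : ℂ) : ℂ := riemannZeta s ^ 2 * riemannZeta (1 - s)

lemma xiZeta_sq_mul {s : ℂ} (h0 : s ≠ 0) (h1 : s ≠ 1) :
    xiZeta s ^ 2 * xiZeta (1 - s) = (s * (s - 1)) ^ 3 * zetaCube s := by
  rw [xiZeta_eq h0 h1, xiZeta_eq (sub_ne_zero.2 h1.symm) (by simpa using h0), zetaCube]
  ring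

lemma exists_norm_xiZeta_sq_mul_growth : ∃ c : ℝ, ∀ s : ℂ, 0 ≤ s.re → s.re ≤ 5 / 4 →
    ‖xiZeta s ^ 2 * xiZeta (1 - s)‖ ≤ Real.exp (c * (1 + |s.im|)) := by
  obtain ⟨C, hC⟩ := exists_norm_xiZeta_le
  refine ⟨3 * C, fun s h1 h2 => ?_⟩
  have a := hC s (by linarith) (by linarith)
  have b := hC (1 - s) (by simp; linarith) (by simp; linarith)
  simp only [sub_im, one_im, zero_sub, abs_neg] at b
  rw [norm_mul, norm_pow]
  calc _ ≤ Real.exp (C * (1 + |s.im|)) ^ 2 * Real.exp (C * (1 + |s.im|)) := by gcongr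
    _ = _ := by rw [← Real.exp_nat_mul, ← Real.exp_add]; push_cast; ring_nf

lemma exists_norm_xiZeta_sq_mul_le_right : ∃ C > 0, ∀ s : ℂ, 1 ≤ s.re → s.re < 3 / 2 →
    ‖xiZeta s ^ 2 * xiZeta (1 - s)‖ ≤
      C * (3 + |s.im|) ^ (s.re + 11 / 2) * Real.log (3 + |s.im|) ^ 3 := by
  obtain ⟨C, hC0, hC⟩ := exists_norm_xiZeta_one_sub_le
  refine ⟨36 * C, by positivity, fun s h1 h2 => ?_⟩
  have hlog : 0 ≤ Real.log (3 + |s.im|) := Real.log_nonneg (by linarith [abs_nonneg s.im])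
  rw [norm_mul, norm_pow]
  calc _ ≤ (6 * (3 + |s.im|) ^ 2 * Real.log (3 + |s.im|)) ^ 2 *
        (C * (3 + |s.im|) ^ (s.re + 3 / 2) * Real.log (3 + |s.im|)) := by
        gcongr
        · exact norm_xiZeta_le h1 h2
        · exact hC s h1 h2
    _ = 36 * C * ((3 + |s.im|) ^ (s.re + 3 / 2) * (3 + |s.im|) ^ ((4 : ℕ) : ℝ)) *
          Real.log (3 + |s.im|) ^ 3 := by
        rw [Real.rpow_natCast]; ring
    _ = _ := by
        rw [← Real.rpow_add (by positivity)]
        norm_num; ring_nf; simp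

lemma exists_norm_xiZeta_sq_mul_le_left : ∃ C > 0, ∀ s : ℂ, s.re = 0 →
    ‖xiZeta s ^ 2 * xiZeta (1 - s)‖ ≤
      C * (3 + |s.im|) ^ (7 : ℝ) * Real.log (3 + |s.im|) ^ 3 := by
  obtain ⟨C, hC0, hC⟩ := exists_norm_xiZeta_one_sub_le
  refine ⟨6 * C ^ 2, by positivity, fun s h1 => ?_⟩
  have hlog : 0 ≤ Real.log (3 + |s.im|) := Real.log_nonneg (by linarith [abs_nonneg s.im])
  have a := norm_xiZeta_le (s := 1 - s) (by simp [h1]) (by simp [h1]; norm_num)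
  have b := hC (1 - s) (by simp [h1]) (by simp [h1]; norm_num)
  simp only [sub_im, one_im, zero_sub, abs_neg, sub_sub_cancel, sub_re, one_re, h1, sub_zero] at a b
  rw [norm_mul, norm_pow]
  calc _ ≤ (C * (3 + |s.im|) ^ (1 + 3 / 2 : ℝ) * Real.log (3 + |s.im|)) ^ 2 *
        (6 * (3 + |s.im|) ^ 2 * Real.log (3 + |s.im|)) := by
        gcongr
    _ = 6 * C ^ 2 * (((3 + |s.im|) ^ (1 + 3 / 2 : ℝ)) ^ 2 * (3 + |s.im|) ^ (2 : ℝ)) *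
          Real.log (3 + |s.im|) ^ 3 := by
        rw [Real.rpow_two]; ring
    _ = _ := by
        rw [← Real.rpow_mul_natCast (by positivity), ← Real.rpow_add (by positivity)]
        norm_num

lemma diffContOnCl_xiZeta_sq_mul (l u : ℝ) :
    DiffContOnCl ℂ (fun s => xiZeta s ^ 2 * xiZeta (1 - s))
      (Complex.HadamardThreeLines.verticalStrip l u) := by
  have := differentiable_xiZeta
  have h : Differentiable ℂ (fun s => xiZeta (1 - s)) := this.comp (by fun_prop)
  exact ((this.pow 2).mul h).diffContOnCl

lemma log_three_add_le {t : ℝ} (ht : 3 ≤ t) : Real.log (3 + t) ≤ 2 * Real.log t := by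
  rw [← Real.log_rpow (by linarith)]
  refine Real.log_le_log (by linarith) ?_
  rw [Real.rpow_two]; nlinarith

lemma norm_zetaCube_le_of {s : ℂ} {A p : ℝ} (hA : 0 ≤ A) (hp : 0 ≤ p) (hp8 : p ≤ 8)
    (ht : 3 ≤ s.im)
    (h : ‖xiZeta s ^ 2 * xiZeta (1 - s)‖ ≤ A * (3 + |s.im|) ^ p * Real.log (3 + |s.im|) ^ 3) :
    ‖zetaCube s‖ ≤ 2048 * A * s.im ^ (p - 6) * Real.log s.im ^ 3 := by
  have h0 : s ≠ 0 := by rintro rfl; norm_num at ht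
  have h1 : s ≠ 1 := by rintro rfl; norm_num at ht
  have ht0 : 0 < s.im := by linarith
  rw [xiZeta_sq_mul h0 h1, norm_mul, abs_of_pos ht0] at h
  have hl : 0 ≤ Real.log s.im := Real.log_nonneg (by linarith)
  have n1 : s.im ^ 6 ≤ ‖(s * (s - 1)) ^ 3‖ := by
    have a1 : s.im ≤ ‖s‖ := (le_abs_self _).trans (Complex.abs_im_le_norm s)
    have a2 : s.im ≤ ‖s - 1‖ := by
      have := (le_abs_self _).trans (Complex.abs_im_le_norm (s - 1))
      simpa using this
    rw [norm_pow, norm_mul]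
    calc s.im ^ 6 = (s.im * s.im) ^ 3 := by ring
      _ ≤ _ := by gcongr
  have n2 : A * (3 + s.im) ^ p * Real.log (3 + s.im) ^ 3 ≤
      A * (256 * s.im ^ p) * (2 * Real.log s.im) ^ 3 := by
    have b1 : (3 + s.im) ^ p ≤ 256 * s.im ^ p := by
      calc (3 + s.im) ^ p ≤ (2 * s.im) ^ p := by gcongr; linarith
        _ = 2 ^ p * s.im ^ p := Real.mul_rpow (by norm_num) ht0.le
        _ ≤ 2 ^ (8 : ℝ) * s.im ^ p := by
          gcongr
          norm_num
        _ = _ := by norm_num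
    have b2 := log_three_add_le ht
    have b3 : 0 ≤ Real.log (3 + s.im) := Real.log_nonneg (by linarith)
    gcongr
  have e : s.im ^ p = s.im ^ (p - 6) * s.im ^ 6 := by
    rw [← Real.rpow_natCast, ← Real.rpow_add ht0]; norm_num
  refine le_of_mul_le_mul_left ?_ (show 0 < s.im ^ 6 by positivity)
  calc _ ≤ ‖(s * (s - 1)) ^ 3‖ * ‖zetaCube s‖ := by gcongr
    _ ≤ _ := h.trans n2
    _ = _ := by rw [e]; ring

lemma exists_norm_zetaCube_le : ∃ C > 0, ∀ s : ℂ, 3 ≤ s.im →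
    (0 ≤ s.re → s.re ≤ 1 → ‖zetaCube s‖ ≤ C * s.im ^ (1 - s.re / 2) * Real.log s.im ^ 3) ∧
    (1 ≤ s.re → s.re ≤ 5 / 4 → ‖zetaCube s‖ ≤ C * s.im ^ (s.re - 1 / 2) * Real.log s.im ^ 3) := by
  obtain ⟨c, hc⟩ := exists_norm_xiZeta_sq_mul_growth
  obtain ⟨C, hC0, hC⟩ := exists_norm_xiZeta_sq_mul_le_right
  obtain ⟨D, hD0, hD⟩ := exists_norm_xiZeta_sq_mul_le_left
  obtain ⟨B, hB0, hB⟩ := strip_interp (l := 0) (u := 1) (by norm_num)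
    (diffContOnCl_xiZeta_sq_mul 0 1) (c := c) (fun s h1 h2 => hc s h1 (by linarith))
    (A := max C D) (p := 7) (q := 13 / 2) (r := 3) (by norm_num) (by norm_num)
    (lt_max_of_lt_left hC0)
    (by
      intro s hs
      have hlog : 0 ≤ Real.log (3 + |s.im|) := Real.log_nonneg (by linarith [abs_nonneg s.im])
      refine (hD s hs).trans ?_
      gcongr
      exact le_max_right _ _)
    (by
      intro s hs
      have hlog : 0 ≤ Real.log (3 + |s.im|) := Real.log_nonneg (by linarith [abs_nonneg s.im])
      refine (hC s hs.ge (by linarith)).trans ?_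
      rw [hs, show (1 + 11 / 2 : ℝ) = 13 / 2 by norm_num]
      gcongr
      exact le_max_left _ _)
  refine ⟨2048 * max B C, by positivity, fun s ht => ⟨fun h1 h2 => ?_, fun h1 h2 => ?_⟩⟩
  · have hl : 0 ≤ Real.log s.im := Real.log_nonneg (by linarith)
    have ht0 : 0 ≤ s.im := by linarith
    have h := hB s h1 h2
    rw [show (7 : ℝ) * (1 - (s.re - 0) / (1 - 0)) + 13 / 2 * ((s.re - 0) / (1 - 0))
      = 7 - s.re / 2 by ring] at h
    refine (norm_zetaCube_le_of hB0.le (by linarith) (by linarith) ht h).trans ?_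
    rw [show 7 - s.re / 2 - 6 = 1 - s.re / 2 by ring]
    gcongr
    exact le_max_left _ _
  · have hl : 0 ≤ Real.log s.im := Real.log_nonneg (by linarith)
    have ht0 : 0 ≤ s.im := by linarith
    refine (norm_zetaCube_le_of hC0.le (by linarith) (by linarith) ht (hC s h1 (by linarith))).trans ?_
    rw [show s.re + 11 / 2 - 6 = s.re - 1 / 2 by ring]
    gcongr
    exact le_max_right _ _

lemma differentiableAt_zetaCube {s : ℂ} (hs : 0 < s.im) : DifferentiableAt ℂ zetaCube s := by
  have h1 : s ≠ 1 := by rintro rfl; norm_num at hs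
  have h0 : s ≠ 0 := by rintro rfl; norm_num at hs
  have h2 : DifferentiableAt ℂ (fun s => riemannZeta (1 - s)) s :=
    DifferentiableAt.comp s (differentiableAt_riemannZeta (by simpa using h0)) (by fun_prop)
  exact ((differentiableAt_riemannZeta h1).pow 2).mul h2

lemma integral_rpow_exponent_le {T l u : ℝ} (c : ℝ) (hc : c ≠ 0) (d : ℝ) (hT : 1 < T) :
    ∫ x in l..u, T ^ (c * x + d) = (T ^ (c * u + d) - T ^ (c * l + d)) / (c * Real.log T) := by
  have hl : Real.log T ≠ 0 := (Real.log_pos hT).ne'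
  have hT0 : 0 < T := by linarith
  have : ∀ x ∈ Set.uIcc l u, HasDerivAt (fun x => T ^ (c * x + d) / (c * Real.log T))
      (T ^ (c * x + d)) x := by
    intro x _
    have h1 : HasDerivAt (fun x => c * x + d) c x := by
      simpa using ((hasDerivAt_id x).const_mul c).add_const d
    have := (h1.const_rpow hT0).div_const (c * Real.log T)
    refine this.congr_deriv ?_
    field_simp
  rw [intervalIntegral.integral_eq_sub_of_hasDerivAt this, sub_div]
  refine Continuous.intervalIntegrable ?_ _ _
  exact Continuous.rpow continuous_const (by fun_prop) (fun _ => Or.inl hT0.ne')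

lemma exists_norm_horizontal_le : ∃ C > 0, ∀ T : ℝ, 3 ≤ T →
    ‖∫ x in (1 / 2 : ℝ)..(5 / 4), zetaCube (x + T * I)‖ ≤ C * (T ^ (3 / 4 : ℝ) * Real.log T ^ 2) := by
  obtain ⟨C, hC0, hC⟩ := exists_norm_zetaCube_le
  refine ⟨3 * C, by positivity, fun T hT => ?_⟩
  have hT0 : 0 < T := by linarith
  have hl : 0 < Real.log T := Real.log_pos (by linarith)
  have hcont : Continuous fun x : ℝ => zetaCube (x + T * I) := by
    refine continuous_iff_continuousAt.2 fun x => ?_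
    have h := (differentiableAt_zetaCube (s := x + T * I) (by simpa using hT0)).continuousAt
    exact ContinuousAt.comp (f := fun x : ℝ => (x + T * I : ℂ)) h (by fun_prop)
  rw [← intervalIntegral.integral_add_adjacent_intervals (b := 1)
    (hcont.intervalIntegrable _ _) (hcont.intervalIntegrable _ _)]
  have hc1 : Continuous fun x : ℝ => C * T ^ (-(1 / 2) * x + 1) * Real.log T ^ 3 :=
    (continuous_const.mul (Continuous.rpow continuous_const (by fun_prop)
      (fun _ => Or.inl hT0.ne'))).mul continuous_const
  have hc2 : Continuous fun x : ℝ => C * T ^ (1 * x + -(1 / 2)) * Real.log T ^ 3 :=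
    (continuous_const.mul (Continuous.rpow continuous_const (by fun_prop)
      (fun _ => Or.inl hT0.ne'))).mul continuous_const
  have b1 : ‖∫ x in (1 / 2 : ℝ)..1, zetaCube (x + T * I)‖
      ≤ ∫ x in (1 / 2 : ℝ)..1, C * T ^ (-(1 / 2) * x + 1) * Real.log T ^ 3 := by
    refine intervalIntegral.norm_integral_le_of_norm_le (by norm_num)
      (ae_of_all _ fun x hx => ?_) (hc1.intervalIntegrable _ _)
    have := (hC (x + T * I) (by simpa using hT)).1 (by simp; linarith [hx.1]) (by simp; exact hx.2)
    simp only [add_im, ofReal_im, mul_im, ofReal_re, I_im, mul_one, I_re, mul_zero, add_zero,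
      zero_add, add_re, mul_re, sub_self] at this
    convert this using 4
    ring
  have b2 : ‖∫ x in (1 : ℝ)..(5 / 4), zetaCube (x + T * I)‖
      ≤ ∫ x in (1 : ℝ)..(5 / 4), C * T ^ (1 * x + -(1 / 2)) * Real.log T ^ 3 := by
    refine intervalIntegral.norm_integral_le_of_norm_le (by norm_num)
      (ae_of_all _ fun x hx => ?_) (hc2.intervalIntegrable _ _)
    have := (hC (x + T * I) (by simpa using hT)).2 (by simp; linarith [hx.1]) (by simp; exact hx.2)
    simp only [add_im, ofReal_im, mul_im, ofReal_re, I_im, mul_one, I_re, mul_zero, add_zero,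
      zero_add, add_re, mul_re, sub_self] at this
    convert this using 4
    ring
  rw [intervalIntegral.integral_mul_const, intervalIntegral.integral_const_mul,
    integral_rpow_exponent_le _ (by norm_num) _ (by linarith)] at b1 b2
  have e1 : (T ^ (-(1 / 2) * 1 + 1 : ℝ) - T ^ (-(1 / 2) * (1 / 2) + 1 : ℝ)) / (-(1 / 2) * Real.log T)
      ≤ 2 * T ^ (3 / 4 : ℝ) / Real.log T := by
    have := Real.rpow_nonneg hT0.le (1 / 2 : ℝ)
    rw [show (-(1 / 2) * 1 + 1 : ℝ) = 1 / 2 by norm_num,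
      show (-(1 / 2) * (1 / 2) + 1 : ℝ) = 3 / 4 by norm_num,
      show (T ^ (1 / 2 : ℝ) - T ^ (3 / 4 : ℝ)) / (-(1 / 2) * Real.log T)
        = 2 * (T ^ (3 / 4 : ℝ) - T ^ (1 / 2 : ℝ)) / Real.log T by field_simp; ring]
    gcongr
    linarith
  have e2 : (T ^ (1 * (5 / 4) + -(1 / 2) : ℝ) - T ^ (1 * 1 + -(1 / 2) : ℝ)) / (1 * Real.log T)
      ≤ T ^ (3 / 4 : ℝ) / Real.log T := by
    have := Real.rpow_nonneg hT0.le (1 / 2 : ℝ)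
    rw [show (1 * (5 / 4) + -(1 / 2) : ℝ) = 3 / 4 by norm_num,
      show (1 * 1 + -(1 / 2) : ℝ) = 1 / 2 by norm_num, one_mul]
    gcongr
    linarith
  calc _ ≤ _ := norm_add_le _ _
    _ ≤ C * (2 * T ^ (3 / 4 : ℝ) / Real.log T) * Real.log T ^ 3
        + C * (T ^ (3 / 4 : ℝ) / Real.log T) * Real.log T ^ 3 := by
        refine add_le_add (b1.trans ?_) (b2.trans ?_) <;> gcongr
    _ = _ := by field_simp; ring

/-- Moving the line of integration from `re s = 1/2` to `re s = 5/4`. -/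
lemma exists_norm_contour_shift_le : ∃ C > 0, ∀ T : ℝ, 3 ≤ T →
    ‖(∫ t in T..(2 * T), zetaCube (1 / 2 + I * t)) - ∫ t in T..(2 * T), zetaCube (5 / 4 + I * t)‖
      ≤ C * (T ^ (3 / 4 : ℝ) * Real.log T ^ 2) := by
  obtain ⟨C, hC0, hC⟩ := exists_norm_horizontal_le
  refine ⟨9 * C, by positivity, fun T hT => ?_⟩
  have hT0 : 0 < T := by linarith
  have hl : 0 < Real.log T := Real.log_pos (by linarith)
  have h := Complex.integral_boundary_rect_eq_zero_of_differentiableOn zetaCube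
    (⟨1 / 2, T⟩ : ℂ) (⟨5 / 4, 2 * T⟩ : ℂ) (by
      intro s hs
      refine (differentiableAt_zetaCube ?_).differentiableWithinAt
      have := hs.2
      rw [Set.mem_preimage, Set.uIcc_of_le (by simp; linarith)] at this
      exact hT0.trans_le this.1)
  simp only [smul_eq_mul] at h
  have e1 : ∀ t : ℝ, ((1 / 2 : ℝ) : ℂ) + t * I = 1 / 2 + I * t := fun t => by push_cast; ring
  have e2 : ∀ t : ℝ, ((5 / 4 : ℝ) : ℂ) + t * I = 5 / 4 + I * t := fun t => by push_cast; ring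
  simp only [e1, e2] at h
  have a1 := hC T hT
  have a2 := hC (2 * T) (by linarith)
  set A := ∫ x in (1 / 2 : ℝ)..(5 / 4), zetaCube (x + T * I)
  set B := ∫ x in (1 / 2 : ℝ)..(5 / 4), zetaCube (x + (2 * T : ℝ) * I)
  set P := ∫ t in T..(2 * T), zetaCube (1 / 2 + I * t)
  set Q := ∫ t in T..(2 * T), zetaCube (5 / 4 + I * t)
  have e : P - Q = -I * (A - B) := by
    have hI : (1 : ℂ) + I ^ 2 = 0 := by simp
    linear_combination I * h + (P - Q) * hI
  rw [e, norm_mul, norm_neg, Complex.norm_I, one_mul]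
  have a3 : (2 * T) ^ (3 / 4 : ℝ) * Real.log (2 * T) ^ 2
      ≤ 8 * (T ^ (3 / 4 : ℝ) * Real.log T ^ 2) := by
    have c1 : (2 * T) ^ (3 / 4 : ℝ) ≤ 2 * T ^ (3 / 4 : ℝ) := by
      rw [Real.mul_rpow (by norm_num) hT0.le]
      gcongr
      calc (2 : ℝ) ^ (3 / 4 : ℝ) ≤ 2 ^ (1 : ℝ) :=
            Real.rpow_le_rpow_of_exponent_le (by norm_num) (by norm_num)
        _ = 2 := Real.rpow_one _
    have c2 : Real.log (2 * T) ≤ 2 * Real.log T := by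
      rw [← Real.log_rpow hT0, Real.rpow_two]
      exact Real.log_le_log (by positivity) (by nlinarith)
    have c3 : 0 ≤ Real.log (2 * T) := Real.log_nonneg (by linarith)
    calc _ ≤ (2 * T ^ (3 / 4 : ℝ)) * (2 * Real.log T) ^ 2 := by gcongr
      _ = _ := by ring
  calc _ ≤ ‖A‖ + ‖B‖ := norm_sub_le _ _
    _ ≤ C * (T ^ (3 / 4 : ℝ) * Real.log T ^ 2) + C * (8 * (T ^ (3 / 4 : ℝ) * Real.log T ^ 2)) := by
      refine add_le_add a1 (a2.trans ?_)
      gcongr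
    _ = _ := by ring

/-- `Γ(s) z^{-s}` for `z = y e^{iθ}`. -/
noncomputable def gammaWave (y θ : ℝ) (s : ℂ) : ℂ :=
  Complex.Gamma s * Complex.exp (-(Real.log y + θ * I) * s)

lemma norm_gammaWave (y θ : ℝ) (hy : 0 < y) (s : ℂ) :
    ‖gammaWave y θ s‖ = ‖Complex.Gamma s‖ * (y ^ (-s.re) * Real.exp (θ * s.im)) := by
  rw [gammaWave, norm_mul, Complex.norm_exp, Real.rpow_def_of_pos hy, ← Real.exp_add]
  congr 2
  simp

lemma gammaWave_add_one {y : ℝ} (hy : 0 < y) (θ : ℝ) {s : ℂ} (hs : s ≠ 0) :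
    gammaWave y θ (s + 1) * (y * Complex.exp (θ * I)) = s * gammaWave y θ s := by
  have e : (y : ℂ) = Complex.exp (Real.log y) := by
    rw [← Complex.ofReal_exp, Real.exp_log hy]
  rw [gammaWave, gammaWave, Complex.Gamma_add_one s hs]
  have e2 : Complex.exp (-(Real.log y + θ * I) * (s + 1)) * (y * Complex.exp (θ * I))
      = Complex.exp (-(Real.log y + θ * I) * s) := by
    rw [e, ← Complex.exp_add, ← Complex.exp_add]
    congr 1
    ring
  rw [mul_assoc, e2, mul_assoc]

lemma differentiableAt_gammaWave (y θ : ℝ) {s : ℂ} (hs : 0 < s.re) :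
    DifferentiableAt ℂ (gammaWave y θ) s := by
  refine (Complex.differentiableAt_Gamma s ?_).mul (by fun_prop)
  intro m hm
  rw [hm] at hs
  simp at hs
  linarith [(Nat.cast_nonneg m : (0:ℝ) ≤ m)]

lemma continuous_gammaWave_vertical (y θ : ℝ) {σ : ℝ} (hσ : 0 < σ) :
    Continuous fun t : ℝ => gammaWave y θ (σ + t * I) := by
  refine continuous_iff_continuousAt.2 fun t => ?_
  exact ContinuousAt.comp (f := fun t : ℝ => (σ + t * I : ℂ))
    (differentiableAt_gammaWave y θ (by simpa using hσ)).continuousAt (by fun_prop)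

/-- Horizontal average of `gammaWave` over a unit interval. -/
noncomputable def gammaAvg (y θ t : ℝ) : ℂ :=
  ∫ σ in (1 / 4 : ℝ)..(5 / 4), gammaWave y θ (σ + t * I)

lemma hasDerivAt_gammaAvg (y θ t : ℝ) :
    HasDerivAt (gammaAvg y θ)
      (I * (gammaWave y θ ((5 / 4 : ℝ) + t * I) - gammaWave y θ ((1 / 4 : ℝ) + t * I))) t := by
  have c1 := continuous_gammaWave_vertical y θ (σ := 5 / 4) (by norm_num)
  have c2 := continuous_gammaWave_vertical y θ (σ := 1 / 4) (by norm_num)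
  have e : ∀ t, gammaAvg y θ t = gammaAvg y θ 0 + I * ∫ u in (0 : ℝ)..t,
      (gammaWave y θ ((5 / 4 : ℝ) + u * I) - gammaWave y θ ((1 / 4 : ℝ) + u * I)) := by
    intro t
    have h := Complex.integral_boundary_rect_eq_zero_of_differentiableOn (gammaWave y θ)
      (⟨1 / 4, 0⟩ : ℂ) (⟨5 / 4, t⟩ : ℂ) (by
        intro s hs
        refine (differentiableAt_gammaWave y θ ?_).differentiableWithinAt
        have := hs.1
        rw [Set.mem_preimage, Set.uIcc_of_le (by norm_num)] at this
        have := this.1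
        norm_num at this
        linarith)
    simp only [smul_eq_mul] at h
    rw [intervalIntegral.integral_sub (c1.intervalIntegrable _ _) (c2.intervalIntegrable _ _)]
    rw [gammaAvg, gammaAvg]
    linear_combination -h
  have : gammaAvg y θ = fun t => gammaAvg y θ 0 + I * ∫ u in (0 : ℝ)..t,
      (gammaWave y θ ((5 / 4 : ℝ) + u * I) - gammaWave y θ ((1 / 4 : ℝ) + u * I)) := funext e
  rw [this]
  have hc := c1.sub c2
  exact ((intervalIntegral.integral_hasDerivAt_right (hc.intervalIntegrable _ _)
    (hc.stronglyMeasurableAtFilter _ _) hc.continuousAt).const_mul I).const_add _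

lemma exists_norm_gammaWave_le : ∃ C > 0, ∀ y θ : ℝ, ∀ s : ℂ, 0 < y → 1 / 4 ≤ s.re → s.re ≤ 2 →
    ‖gammaWave y θ s‖ ≤ C * ((3 + |s.im|) ^ (s.re - 1 / 2) * y ^ (-s.re) *
      Real.exp (-(π / 2 * |s.im|) + θ * s.im)) := by
  obtain ⟨C, hC0, hC⟩ := exists_norm_Gamma_le
  refine ⟨C, hC0, fun y θ s hy h1 h2 => ?_⟩
  rw [norm_gammaWave y θ hy]
  calc _ ≤ C * (3 + |s.im|) ^ (s.re - 1 / 2) * Real.exp (-(π / 2 * |s.im|)) *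
        (y ^ (-s.re) * Real.exp (θ * s.im)) := by gcongr; exact hC s h1 h2
    _ = _ := by rw [Real.exp_add]; ring

lemma exists_norm_gammaAvg_le : ∃ C > 0, ∀ y θ t : ℝ, 0 < y →
    ‖gammaAvg y θ t‖ ≤ C * (y ^ (-(5 / 4) : ℝ) * (3 + |t|) ^ (-(1 / 4) : ℝ) * (3 + |t| + y) *
      Real.exp (-(π / 2 * |t|) + θ * t)) := by
  obtain ⟨C, hC0, hC⟩ := exists_norm_gammaWave_le
  refine ⟨C, hC0, fun y θ t hy => ?_⟩
  have hW : 0 < 3 + |t| := by positivity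
  have := intervalIntegral.norm_integral_le_of_norm_le_const (a := 1 / 4) (b := 5 / 4)
    (f := fun σ : ℝ => gammaWave y θ (σ + t * I))
    (C := C * (y ^ (-(5 / 4) : ℝ) * (3 + |t|) ^ (-(1 / 4) : ℝ) * (3 + |t| + y) *
      Real.exp (-(π / 2 * |t|) + θ * t))) (by
      intro σ hσ
      rw [Set.uIoc_of_le (by norm_num)] at hσ
      have h := hC y θ (σ + t * I) hy (by simp; linarith [hσ.1]) (by simp; linarith [hσ.2])
      simp only [add_re, ofReal_re, mul_re, I_re, mul_zero, ofReal_im, I_im, mul_one, sub_self,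
        add_zero, add_im, mul_im, zero_add] at h
      refine h.trans ?_
      have e : (3 + |t|) ^ (σ - 1 / 2) * y ^ (-σ) ≤
          y ^ (-(5 / 4) : ℝ) * (3 + |t|) ^ (-(1 / 4) : ℝ) * (3 + |t| + y) := by
        have e1 : (3 + |t|) ^ (σ - 1 / 2) * y ^ (-σ) =
            y ^ (-(5 / 4) : ℝ) * (3 + |t|) ^ (-(1 / 4) : ℝ) *
              ((3 + |t|) ^ (σ - 1 / 4) * y ^ (5 / 4 - σ)) := by
          rw [show σ - 1 / 2 = -(1 / 4) + (σ - 1 / 4) by ring, Real.rpow_add hW,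
            show -σ = -(5 / 4) + (5 / 4 - σ) by ring, Real.rpow_add hy]
          ring
        rw [e1]
        gcongr
        have hm : 0 ≤ max (3 + |t|) y := le_max_of_le_left hW.le
        calc _ ≤ (max (3 + |t|) y) ^ (σ - 1 / 4) * (max (3 + |t|) y) ^ (5 / 4 - σ) := by
              gcongr
              · linarith [hσ.1]
              · exact le_max_left _ _
              · linarith [hσ.2]
              · exact le_max_right _ _
          _ = max (3 + |t|) y := by
              rw [← Real.rpow_add (lt_max_of_lt_left hW)]
              ring_nf; simp
          _ ≤ _ := max_le (by linarith) (by linarith)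
      gcongr)
  rw [gammaAvg]
  refine this.trans (le_of_eq ?_)
  norm_num

/-- Integration by parts for `∫ Γ(s) z^{-s}` away from the stationary point. -/
lemma norm_integral_gammaWave_le {y θ α β : ℝ} (hy : 0 < y) (hαβ : α ≤ β)
    (hne : ∀ t ∈ Set.Icc α β, t ≠ y * Real.sin θ) :
    ‖∫ t in α..β, gammaWave y θ ((5 / 4 : ℝ) + t * I)‖ ≤
      ‖gammaAvg y θ α‖ * ((3 + |α|) / |α - y * Real.sin θ|)
      + ‖gammaAvg y θ β‖ * ((3 + |β|) / |β - y * Real.sin θ|)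
      + ∫ t in α..β, ‖gammaAvg y θ t‖ * (y / (t - y * Real.sin θ) ^ 2) := by
  set z : ℂ := y * Complex.exp (θ * I) with hz
  have hzim : z.im = y * Real.sin θ := by
    rw [hz, Complex.im_ofReal_mul, Complex.exp_ofReal_mul_I_im]
  have hznorm : ‖z‖ = y := by
    rw [hz, norm_mul, Complex.norm_exp_ofReal_mul_I, mul_one, Complex.norm_real, Real.norm_eq_abs,
      abs_of_pos hy]
  set p : ℝ → ℂ := fun t => (1 / 4 : ℝ) + t * I with hp
  have hpim : ∀ t, (p t - z).im = t - y * Real.sin θ := by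
    intro t; simp [hp, hzim]
  have hlow : ∀ t, |t - y * Real.sin θ| ≤ ‖p t - z‖ := by
    intro t; rw [← hpim]; exact Complex.abs_im_le_norm _
  have hpz : ∀ t ∈ Set.Icc α β, p t - z ≠ 0 := by
    intro t ht h
    have := hpim t
    rw [h] at this
    exact hne t ht (by simp at this; linarith)
  set w : ℝ → ℂ := fun t => p t / (p t - z) with hw
  have hp' : ∀ t, HasDerivAt p I t := by
    intro t
    have := ((Complex.ofRealCLM.hasDerivAt (x := t)).mul_const I).const_add ((1 / 4 : ℝ) : ℂ)
    simpa [hp] using this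
  have hw' : ∀ t ∈ Set.Icc α β, HasDerivAt w (-(I * z) / (p t - z) ^ 2) t := by
    intro t ht
    have := (hp' t).div ((hp' t).sub_const z) (hpz t ht)
    refine this.congr_deriv ?_
    ring
  have hH' := fun t => hasDerivAt_gammaAvg y θ t
  have key : ∀ t ∈ Set.Icc α β, gammaWave y θ ((5 / 4 : ℝ) + t * I)
      = -I * (w t * (I * (gammaWave y θ ((5 / 4 : ℝ) + t * I)
        - gammaWave y θ ((1 / 4 : ℝ) + t * I)))) := by
    intro t ht
    have h0 : p t ≠ 0 := by
      intro h
      have := congrArg Complex.re h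
      simp [hp] at this
    have h1 := gammaWave_add_one hy θ h0
    have e5 : p t + 1 = (5 / 4 : ℝ) + t * I := by
      simp only [hp]; push_cast; ring
    rw [e5, ← hz] at h1
    simp only [hw]
    change _ = -I * (p t / (p t - z) * (I * (gammaWave y θ ((5 / 4 : ℝ) + t * I)
        - gammaWave y θ (p t))))
    have h2 : gammaWave y θ ((5 / 4 : ℝ) + t * I) * (p t - z)
        = p t * (gammaWave y θ ((5 / 4 : ℝ) + t * I) - gammaWave y θ (p t)) := by
      linear_combination -h1
    have h3 := hpz t ht
    rw [show -I * (p t / (p t - z) * (I * (gammaWave y θ ((5 / 4 : ℝ) + t * I)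
        - gammaWave y θ (p t)))) = -(I * I) * (p t * (gammaWave y θ ((5 / 4 : ℝ) + t * I)
        - gammaWave y θ (p t)) / (p t - z)) by ring, ← h2, Complex.I_mul_I]
    field_simp
  have hcp : Continuous p := continuous_iff_continuousAt.2 fun t => (hp' t).continuousAt
  have hcH : Continuous (gammaAvg y θ) := continuous_iff_continuousAt.2 fun t => (hH' t).continuousAt
  have hcw' : ContinuousOn (fun t => -(I * z) / (p t - z) ^ 2) (Set.uIcc α β) := by
    rw [Set.uIcc_of_le hαβ]
    exact continuousOn_const.div ((hcp.sub continuous_const).pow 2).continuousOn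
      fun t ht => pow_ne_zero 2 (hpz t ht)
  have hcH' : Continuous fun t : ℝ => I * (gammaWave y θ ((5 / 4 : ℝ) + t * I)
      - gammaWave y θ ((1 / 4 : ℝ) + t * I)) :=
    continuous_const.mul ((continuous_gammaWave_vertical y θ (by norm_num)).sub
      (continuous_gammaWave_vertical y θ (by norm_num)))
  have hibp := intervalIntegral.integral_mul_deriv_eq_deriv_mul (a := α) (b := β)
    (u := w) (u' := fun t => -(I * z) / (p t - z) ^ 2) (v := gammaAvg y θ)
    (v' := fun t => I * (gammaWave y θ ((5 / 4 : ℝ) + t * I)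
        - gammaWave y θ ((1 / 4 : ℝ) + t * I)))
    (fun t ht => hw' t (by rwa [Set.uIcc_of_le hαβ] at ht)) (fun t _ => hH' t)
    hcw'.intervalIntegrable (hcH'.intervalIntegrable _ _)
  have e : ∫ t in α..β, gammaWave y θ ((5 / 4 : ℝ) + t * I) = -I * ∫ t in α..β,
      w t * (I * (gammaWave y θ ((5 / 4 : ℝ) + t * I) - gammaWave y θ ((1 / 4 : ℝ) + t * I))) := by
    rw [← intervalIntegral.integral_const_mul]
    refine intervalIntegral.integral_congr fun t ht => ?_
    exact key t (by rwa [Set.uIcc_of_le hαβ] at ht)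
  have hwle : ∀ t ∈ Set.Icc α β, ‖w t‖ ≤ (3 + |t|) / |t - y * Real.sin θ| := by
    intro t ht
    have h1 : 0 < |t - y * Real.sin θ| := abs_pos.2 (sub_ne_zero.2 (hne t ht))
    simp only [hw, norm_div]
    gcongr
    · refine (norm_add_le _ _).trans ?_
      simp only [Complex.norm_real, norm_mul, Complex.norm_I, Real.norm_eq_abs, mul_one]
      norm_num
    · exact hlow t
  rw [e, hibp, norm_mul, norm_neg, Complex.norm_I, one_mul]
  have hA : ‖w β * gammaAvg y θ β‖ ≤ ‖gammaAvg y θ β‖ * ((3 + |β|) / |β - y * Real.sin θ|) := by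
    rw [norm_mul, mul_comm]
    gcongr
    exact hwle β ⟨hαβ, le_rfl⟩
  have hB : ‖w α * gammaAvg y θ α‖ ≤ ‖gammaAvg y θ α‖ * ((3 + |α|) / |α - y * Real.sin θ|) := by
    rw [norm_mul, mul_comm]
    gcongr
    exact hwle α ⟨le_rfl, hαβ⟩
  have hC : ‖∫ t in α..β, -(I * z) / (p t - z) ^ 2 * gammaAvg y θ t‖ ≤
      ∫ t in α..β, ‖gammaAvg y θ t‖ * (y / (t - y * Real.sin θ) ^ 2) := by
    refine intervalIntegral.norm_integral_le_of_norm_le hαβ (ae_of_all _ fun t ht => ?_) ?_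
    · have ht' : t ∈ Set.Icc α β := ⟨ht.1.le, ht.2⟩
      have h1 : 0 < |t - y * Real.sin θ| := abs_pos.2 (sub_ne_zero.2 (hne t ht'))
      rw [norm_mul, norm_div, norm_neg, norm_mul, Complex.norm_I, one_mul, hznorm, norm_pow,
        mul_comm, ← sq_abs (t - _)]
      gcongr
      exact hlow t
    · refine ContinuousOn.intervalIntegrable ?_
      rw [Set.uIcc_of_le hαβ]
      refine hcH.norm.continuousOn.mul (continuousOn_const.div (by fun_prop) fun t ht => ?_)
      exact pow_ne_zero 2 (sub_ne_zero.2 (hne t ht))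
  calc _ ≤ ‖w β * gammaAvg y θ β‖ + ‖w α * gammaAvg y θ α‖
        + ‖∫ t in α..β, -(I * z) / (p t - z) ^ 2 * gammaAvg y θ t‖ := by
        refine (norm_sub_le _ _).trans ?_
        gcongr
        exact norm_sub_le _ _
    _ ≤ _ := by linarith

lemma integral_div_sub_sq {y p α β : ℝ} (hαβ : α ≤ β) (hne : ∀ t ∈ Set.Icc α β, t ≠ p) :
    ∫ t in α..β, y / (t - p) ^ 2 = y * (1 / (α - p) - 1 / (β - p)) := by
  have hd : ∀ t ∈ Set.uIcc α β, HasDerivAt (fun t => -(y / (t - p))) (y / (t - p) ^ 2) t := by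
    intro t ht
    rw [Set.uIcc_of_le hαβ] at ht
    have h0 : t - p ≠ 0 := sub_ne_zero.2 (hne t ht)
    have := (((hasDerivAt_id t).sub_const p).fun_inv h0).const_mul (-y)
    refine (this.congr_of_eventuallyEq ?_).congr_deriv ?_
    · exact Eventually.of_forall fun u => by simp [div_eq_mul_inv]
    · simp only [id]; field_simp
  rw [intervalIntegral.integral_eq_sub_of_hasDerivAt hd]
  · ring
  · refine ContinuousOn.intervalIntegrable ?_
    rw [Set.uIcc_of_le hαβ]
    exact continuousOn_const.div (by fun_prop) fun t ht => pow_ne_zero 2 (sub_ne_zero.2 (hne t ht))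

lemma continuous_gammaAvg (y θ : ℝ) : Continuous (gammaAvg y θ) :=
  continuous_iff_continuousAt.2 fun t => (hasDerivAt_gammaAvg y θ t).continuousAt

lemma norm_integral_gammaWave_le_of_le {y θ α β M : ℝ} (hy : 0 < y) (hαβ : α ≤ β)
    (hne : ∀ t ∈ Set.Icc α β, t ≠ y * Real.sin θ)
    (hM : ∀ t ∈ Set.Icc α β, ‖gammaAvg y θ t‖ ≤ M) :
    ‖∫ t in α..β, gammaWave y θ ((5 / 4 : ℝ) + t * I)‖ ≤
      M * ((3 + |α|) / |α - y * Real.sin θ| + (3 + |β|) / |β - y * Real.sin θ|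
        + y * (1 / (α - y * Real.sin θ) - 1 / (β - y * Real.sin θ))) := by
  refine (norm_integral_gammaWave_le hy hαβ hne).trans ?_
  rw [mul_add, mul_add, ← integral_div_sub_sq hαβ hne, ← intervalIntegral.integral_const_mul]
  have hc : ContinuousOn (fun t => y / (t - y * Real.sin θ) ^ 2) (Set.uIcc α β) := by
    rw [Set.uIcc_of_le hαβ]
    exact continuousOn_const.div (by fun_prop) fun t ht => pow_ne_zero 2 (sub_ne_zero.2 (hne t ht))
  refine add_le_add (add_le_add ?_ ?_) ?_
  · exact mul_le_mul_of_nonneg_right (hM α ⟨le_rfl, hαβ⟩) (by positivity)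
  · exact mul_le_mul_of_nonneg_right (hM β ⟨hαβ, le_rfl⟩) (by positivity)
  · refine intervalIntegral.integral_mono_on hαβ ?_ ?_ fun t ht => ?_
    · exact ((continuous_gammaAvg y θ).norm.continuousOn.mul hc).intervalIntegrable
    · exact (continuousOn_const.mul hc).intervalIntegrable
    · exact mul_le_mul_of_nonneg_right (hM t ht) (by positivity)

/-- A version of `exists_norm_gammaAvg_le` on the positive axis. -/
lemma exists_norm_gammaAvg_le_of_nonneg : ∃ C > 0, ∀ y θ t : ℝ, 0 < y → θ ≤ π / 2 → 0 ≤ t →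
    ‖gammaAvg y θ t‖ ≤ C * (y ^ (-(5 / 4) : ℝ) * (3 + t) ^ (-(1 / 4) : ℝ) * (3 + t + y)) := by
  obtain ⟨C, hC0, hC⟩ := exists_norm_gammaAvg_le
  refine ⟨C, hC0, fun y θ t hy hθ ht => ?_⟩
  have h := hC y θ t hy
  rw [abs_of_nonneg ht] at h
  refine h.trans ?_
  refine mul_le_mul_of_nonneg_left ?_ hC0.le
  refine mul_le_of_le_one_right (by positivity) (Real.exp_le_one_iff.2 ?_)
  nlinarith

lemma rpow_neg_quarter_mul_self {T : ℝ} (hT : 0 < T) :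
    T ^ (-(1 / 4) : ℝ) * T = T ^ (3 / 4 : ℝ) := by
  nth_rewrite 2 [← Real.rpow_one T]
  rw [← Real.rpow_add hT]; norm_num

/-- Stationary point to the left of the range of integration. -/
lemma exists_norm_integral_gammaWave_le_left : ∃ C > 0, ∀ y T : ℝ, 0 < y → 3 ≤ T → y < T →
    ‖∫ t in T..(2 * T), gammaWave y (π / 2) ((5 / 4 : ℝ) + t * I)‖ ≤
      C * (y ^ (-(5 / 4) : ℝ) * T ^ (3 / 4 : ℝ) * (T / (T - y))) := by
  obtain ⟨C, hC0, hC⟩ := exists_norm_gammaAvg_le_of_nonneg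
  refine ⟨24 * C, by positivity, fun y T hy hT hyT => ?_⟩
  have hT0 : 0 < T := by linarith
  have hd : 0 < T - y := by linarith
  have h := norm_integral_gammaWave_le_of_le (θ := π / 2) (α := T) (β := 2 * T)
    (M := C * (y ^ (-(5 / 4) : ℝ) * T ^ (-(1 / 4) : ℝ) * (4 * T))) hy (by linarith)
    (by
      intro t ht
      rw [Real.sin_pi_div_two]
      linarith [ht.1])
    (by
      intro t ht
      have ht1 := ht.1
      have ht2 := ht.2
      refine (hC y _ t hy le_rfl (by linarith)).trans ?_
      have : (3 + t) ^ (-(1 / 4) : ℝ) ≤ T ^ (-(1 / 4) : ℝ) :=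
        Real.rpow_le_rpow_of_nonpos hT0 (by linarith) (by norm_num)
      have h4 : 0 < 3 + t + y := by linarith
      refine mul_le_mul_of_nonneg_left ?_ hC0.le
      refine mul_le_mul (mul_le_mul_of_nonneg_left this (by positivity)) (by linarith) h4.le
        (by positivity))
  refine h.trans ?_
  rw [Real.sin_pi_div_two, mul_one, abs_of_pos hT0, abs_of_pos (by linarith : 0 < 2 * T),
    abs_of_pos hd, abs_of_pos (by linarith : 0 < 2 * T - y)]
  have e1 : (3 + T) / (T - y) ≤ 2 * (T / (T - y)) := by
    rw [← mul_div_assoc]; gcongr; linarith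
  have e2 : (3 + 2 * T) / (2 * T - y) ≤ 3 * (T / (T - y)) := by
    rw [← mul_div_assoc]; gcongr <;> linarith
  have e3 : y * (1 / (T - y) - 1 / (2 * T - y)) ≤ 1 * (T / (T - y)) := by
    have : 0 ≤ y * (1 / (2 * T - y)) := mul_nonneg hy.le (one_div_nonneg.2 (by linarith))
    have : y * (1 / (T - y)) ≤ T / (T - y) := by
      rw [mul_one_div]; gcongr
    linarith
  calc _ ≤ C * (y ^ (-(5 / 4) : ℝ) * T ^ (-(1 / 4) : ℝ) * (4 * T)) * (6 * (T / (T - y))) := by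
        refine mul_le_mul_of_nonneg_left ?_ (by positivity)
        linarith
    _ = 24 * C * (y ^ (-(5 / 4) : ℝ) * (T ^ (-(1 / 4) : ℝ) * T) * (T / (T - y))) := by ring
    _ = _ := by rw [rpow_neg_quarter_mul_self hT0]

/-- Stationary point to the right of the range of integration. -/
lemma exists_norm_integral_gammaWave_le_right : ∃ C > 0, ∀ y T : ℝ, 3 ≤ T → 2 * T < y →
    ‖∫ t in T..(2 * T), gammaWave y (π / 2) ((5 / 4 : ℝ) + t * I)‖ ≤
      C * (y ^ (-(5 / 4) : ℝ) * T ^ (3 / 4 : ℝ) * (y / (y - 2 * T))) := by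
  obtain ⟨C, hC0, hC⟩ := exists_norm_gammaAvg_le_of_nonneg
  refine ⟨21 * C, by positivity, fun y T hT hyT => ?_⟩
  have hT0 : 0 < T := by linarith
  have hy : 0 < y := by linarith
  have hd : 0 < y - 2 * T := by linarith
  have h := norm_integral_gammaWave_le_of_le (θ := π / 2) (α := T) (β := 2 * T)
    (M := C * (y ^ (-(5 / 4) : ℝ) * T ^ (-(1 / 4) : ℝ) * (3 * y))) hy (by linarith)
    (by
      intro t ht
      rw [Real.sin_pi_div_two]
      linarith [ht.2])
    (by
      intro t ht
      have ht1 := ht.1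
      have ht2 := ht.2
      refine (hC y _ t hy le_rfl (by linarith)).trans ?_
      have : (3 + t) ^ (-(1 / 4) : ℝ) ≤ T ^ (-(1 / 4) : ℝ) :=
        Real.rpow_le_rpow_of_nonpos hT0 (by linarith) (by norm_num)
      have h4 : 0 < 3 + t + y := by linarith
      refine mul_le_mul_of_nonneg_left ?_ hC0.le
      refine mul_le_mul (mul_le_mul_of_nonneg_left this (by positivity)) (by linarith) h4.le
        (by positivity))
  refine h.trans ?_
  rw [Real.sin_pi_div_two, mul_one, abs_of_pos hT0, abs_of_pos (by linarith : 0 < 2 * T),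
    abs_of_neg (by linarith : T - y < 0), abs_of_neg (by linarith : 2 * T - y < 0), neg_sub, neg_sub]
  have e1 : (3 + T) / (y - T) ≤ 2 * (T / (y - 2 * T)) := by
    rw [← mul_div_assoc]; gcongr <;> linarith
  have e2 : (3 + 2 * T) / (y - 2 * T) ≤ 3 * (T / (y - 2 * T)) := by
    rw [← mul_div_assoc]; gcongr; linarith
  have e3 : y * (1 / (T - y) - 1 / (2 * T - y)) ≤ 2 * (T / (y - 2 * T)) := by
    have hd2 : 0 < y - T := by linarith
    rw [show 1 / (T - y) - 1 / (2 * T - y) = T / ((y - T) * (y - 2 * T)) by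
      have h1 : T - y ≠ 0 := by linarith
      have h2 : 2 * T - y ≠ 0 := by linarith
      have h3 : y - T ≠ 0 := by linarith
      have h4 : y - 2 * T ≠ 0 := by linarith
      rw [div_sub_div _ _ h1 h2, div_eq_div_iff (mul_ne_zero h1 h2) (mul_ne_zero h3 h4)]
      ring]
    rw [← mul_div_assoc, ← mul_div_assoc, div_le_div_iff₀ (by positivity) hd]
    have : 0 ≤ (y - 2 * T) * T * (y - 2 * T) := by positivity
    nlinarith
  calc _ ≤ C * (y ^ (-(5 / 4) : ℝ) * T ^ (-(1 / 4) : ℝ) * (3 * y)) * (7 * (T / (y - 2 * T))) := by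
        refine mul_le_mul_of_nonneg_left ?_ (by positivity)
        linarith
    _ = 21 * C * (y ^ (-(5 / 4) : ℝ) * (T ^ (-(1 / 4) : ℝ) * T) * (y / (y - 2 * T))) := by ring
    _ = _ := by rw [rpow_neg_quarter_mul_self hT0]

/-- Trivial bound near the endpoints. -/
lemma exists_norm_integral_gammaWave_le_trivial : ∃ C > 0, ∀ y T : ℝ, 0 < y → 3 ≤ T →
    ‖∫ t in T..(2 * T), gammaWave y (π / 2) ((5 / 4 : ℝ) + t * I)‖ ≤
      C * (y ^ (-(5 / 4) : ℝ) * T ^ (3 / 4 : ℝ) * T) := by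
  obtain ⟨C, hC0, hC⟩ := exists_norm_gammaWave_le
  refine ⟨3 * C, by positivity, fun y T hy hT => ?_⟩
  have hT0 : 0 < T := by linarith
  have h := intervalIntegral.norm_integral_le_of_norm_le_const (a := T) (b := 2 * T)
    (f := fun t : ℝ => gammaWave y (π / 2) ((5 / 4 : ℝ) + t * I))
    (C := C * (3 * T ^ (3 / 4 : ℝ) * y ^ (-(5 / 4) : ℝ))) (by
      intro t ht
      rw [Set.uIoc_of_le (by linarith)] at ht
      have ht0 : 0 < t := by linarith [ht.1]
      have h := hC y (π / 2) ((5 / 4 : ℝ) + t * I) hy (by simp; norm_num) (by simp; norm_num)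
      simp only [add_re, ofReal_re, mul_re, I_re, mul_zero, ofReal_im, I_im, mul_one, sub_self,
        add_zero, add_im, mul_im, zero_add] at h
      rw [abs_of_pos ht0, neg_add_cancel, Real.exp_zero, mul_one] at h
      refine h.trans ?_
      gcongr
      calc (3 + t) ^ (5 / 4 - 1 / 2 : ℝ) ≤ (3 * T) ^ (5 / 4 - 1 / 2 : ℝ) := by
            gcongr; linarith [ht.2]
        _ = 3 ^ (3 / 4 : ℝ) * T ^ (3 / 4 : ℝ) := by
            rw [Real.mul_rpow (by norm_num) hT0.le]; norm_num
        _ ≤ 3 ^ (1 : ℝ) * T ^ (3 / 4 : ℝ) := by gcongr <;> norm_num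
        _ = _ := by rw [Real.rpow_one])
  refine h.trans (le_of_eq ?_)
  rw [show 2 * T - T = T by ring, abs_of_pos hT0]
  ring

/-- The non-oscillating half of the cosine. -/
lemma exists_norm_integral_gammaWave_neg_le : ∃ C > 0, ∀ y T : ℝ, 0 < y → 3 ≤ T →
    ‖∫ t in T..(2 * T), gammaWave y (-(π / 2)) ((5 / 4 : ℝ) + t * I)‖ ≤
      C * y ^ (-(5 / 4) : ℝ) := by
  obtain ⟨C, hC0, hC⟩ := exists_norm_gammaWave_le
  refine ⟨C, hC0, fun y T hy hT => ?_⟩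
  have hT0 : 0 < T := by linarith
  have h := intervalIntegral.norm_integral_le_of_norm_le_const (a := T) (b := 2 * T)
    (f := fun t : ℝ => gammaWave y (-(π / 2)) ((5 / 4 : ℝ) + t * I))
    (C := C * (T⁻¹ * y ^ (-(5 / 4) : ℝ))) (by
      intro t ht
      rw [Set.uIoc_of_le (by linarith)] at ht
      have ht0 : 0 < t := by linarith [ht.1]
      have h := hC y (-(π / 2)) ((5 / 4 : ℝ) + t * I) hy (by simp; norm_num) (by simp; norm_num)
      simp only [add_re, ofReal_re, mul_re, I_re, mul_zero, ofReal_im, I_im, mul_one, sub_self,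
        add_zero, add_im, mul_im, zero_add] at h
      rw [abs_of_pos ht0] at h
      refine h.trans ?_
      gcongr C * ?_
      have e1 : (3 + t) ^ (5 / 4 - 1 / 2 : ℝ) ≤ Real.exp (2 * t) := by
        calc (3 + t) ^ (5 / 4 - 1 / 2 : ℝ) ≤ (3 + t) ^ (1 : ℝ) :=
              Real.rpow_le_rpow_of_exponent_le (by linarith) (by norm_num)
          _ = 3 + t := Real.rpow_one _
          _ ≤ 2 * t + 1 := by linarith [ht.1]
          _ ≤ _ := Real.add_one_le_exp _
      calc _ ≤ Real.exp (2 * t) * y ^ (-(5 / 4) : ℝ) * Real.exp (-(π / 2 * t) + -(π / 2) * t) := by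
            gcongr
        _ = Real.exp (2 * t + (-(π / 2 * t) + -(π / 2) * t)) * y ^ (-(5 / 4) : ℝ) := by
            rw [Real.exp_add (2 * t)]; ring
        _ ≤ _ := by
            gcongr
            calc Real.exp (2 * t + (-(π / 2 * t) + -(π / 2) * t)) ≤ Real.exp (-T) := by
                  refine Real.exp_le_exp.2 ?_
                  nlinarith [Real.pi_gt_three, ht.1]
              _ = (Real.exp T)⁻¹ := Real.exp_neg _
              _ ≤ T⁻¹ := by gcongr; linarith [Real.add_one_le_exp T])
  refine h.trans (le_of_eq ?_)
  rw [show 2 * T - T = T by ring, abs_of_pos hT0]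
  field_simp

lemma integrable_gammaWave {y θ : ℝ} (hy : 0 < y) (hθ0 : 0 ≤ θ) (hθ : θ < π / 2) :
    Integrable fun t : ℝ => gammaWave y θ ((5 / 4 : ℝ) + t * I) := by
  obtain ⟨C, hC0, hC⟩ := exists_norm_gammaWave_le
  set δ := (π / 2 - θ) / 2 with hδ
  have hδ0 : 0 < δ := by rw [hδ]; linarith
  have hInt : Integrable fun t : ℝ => C * ((3 + δ⁻¹) * y ^ (-(5 / 4) : ℝ)) * Real.exp (-δ * |t|) := by
    refine Integrable.const_mul ?_ _
    have hE : IntegrableOn (fun t : ℝ => Real.exp (-δ * |t|)) (Set.Ioi 0) :=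
      (exp_neg_integrableOn_Ioi 0 hδ0).congr_fun (fun t ht => by
        simp only [abs_of_pos (Set.mem_Ioi.1 ht)]) measurableSet_Ioi
    rw [← integrableOn_univ, ← Set.Iic_union_Ioi (a := (0 : ℝ)), integrableOn_union]
    refine ⟨?_, hE⟩
    rw [integrableOn_Iic_iff_integrableOn_Iio]
    have := hE.comp_neg
    simpa using this
  refine hInt.mono' (continuous_gammaWave_vertical y θ (by norm_num)).aestronglyMeasurable
    (Eventually.of_forall fun t => ?_)
  have h := hC y θ ((5 / 4 : ℝ) + t * I) hy (by simp; norm_num) (by simp; norm_num)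
  simp only [add_re, ofReal_re, mul_re, I_re, mul_zero, ofReal_im, I_im, mul_one, sub_self,
    add_zero, add_im, mul_im, zero_add] at h
  refine h.trans ?_
  have e1 : (3 + |t|) ^ (5 / 4 - 1 / 2 : ℝ) ≤ (3 + δ⁻¹) * Real.exp (δ * |t|) := by
    have ht : 0 ≤ |t| := abs_nonneg t
    calc (3 + |t|) ^ (5 / 4 - 1 / 2 : ℝ) ≤ (3 + |t|) ^ (1 : ℝ) :=
          Real.rpow_le_rpow_of_exponent_le (by linarith) (by norm_num)
      _ = 3 * 1 + δ⁻¹ * (δ * |t|) := by rw [Real.rpow_one]; field_simp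
      _ ≤ 3 * Real.exp (δ * |t|) + δ⁻¹ * Real.exp (δ * |t|) := by
          have := Real.add_one_le_exp (δ * |t|)
          have h0 : 0 ≤ δ * |t| := by positivity
          refine add_le_add (by linarith) (mul_le_mul_of_nonneg_left (by linarith) (by positivity))
      _ = _ := by ring
  rw [mul_assoc C]
  refine mul_le_mul_of_nonneg_left ?_ hC0.le
  have e2 : Real.exp (-(π / 2 * |t|) + θ * t) ≤ Real.exp (-(2 * δ) * |t|) := by
    refine Real.exp_le_exp.2 ?_
    have := mul_le_mul_of_nonneg_left (le_abs_self t) hθ0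
    rw [hδ]; linarith
  calc _ ≤ (3 + δ⁻¹) * Real.exp (δ * |t|) * y ^ (-(5 / 4) : ℝ) * Real.exp (-(2 * δ) * |t|) := by
        gcongr
    _ = (3 + δ⁻¹) * y ^ (-(5 / 4) : ℝ) * (Real.exp (δ * |t|) * Real.exp (-(2 * δ) * |t|)) := by ring
    _ = _ := by rw [← Real.exp_add]; congr 2; ring

lemma integral_cpow_mul_exp_neg_mul_of_re_pos {s z : ℂ} (hs : 0 < s.re) (hz : 0 < z.re) :
    ∫ t : ℝ in Set.Ioi 0, (t : ℂ) ^ (s - 1) * Complex.exp (-(z * t)) =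
      Complex.Gamma s * Complex.exp (-(Complex.log z * s)) := by
  have hopen : IsOpen {w : ℂ | 0 < w.re} := isOpen_lt continuous_const Complex.continuous_re
  have hcpow : ContinuousOn (fun t : ℝ => (t : ℂ) ^ (s - 1)) (Set.Ioi 0) := fun t ht =>
    (Complex.continuous_ofReal.continuousAt.cpow continuousAt_const
      (Complex.ofReal_mem_slitPlane.2 ht)).continuousWithinAt
  have hInt : ∀ a : ℝ, -1 < a → ∀ b : ℝ, 0 < b →
      IntegrableOn (fun t : ℝ => t ^ a * Real.exp (-b * t)) (Set.Ioi 0) := fun a ha b hb => by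
    simpa using integrableOn_rpow_mul_exp_neg_mul_rpow ha one_pos hb
  have hmeas : ∀ w : ℂ, AEStronglyMeasurable
      (fun t : ℝ => (t : ℂ) ^ (s - 1) * Complex.exp (-(w * t))) (volume.restrict (Set.Ioi 0)) :=
    fun w => (hcpow.mul (by fun_prop)).aestronglyMeasurable measurableSet_Ioi
  have hF : DifferentiableOn ℂ
      (fun w : ℂ => ∫ t : ℝ in Set.Ioi 0, (t : ℂ) ^ (s - 1) * Complex.exp (-(w * t)))
      {w : ℂ | 0 < w.re} := by
    intro w hw
    have hw' : 0 < w.re := hw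
    refine ((hasDerivAt_integral_of_dominated_loc_of_deriv_le
      (μ := volume.restrict (Set.Ioi (0 : ℝ)))
      (F := fun (w : ℂ) (t : ℝ) => (t : ℂ) ^ (s - 1) * Complex.exp (-(w * t)))
      (F' := fun (w : ℂ) (t : ℝ) => (t : ℂ) ^ (s - 1) * (Complex.exp (-(w * t)) * (-t)))
      (bound := fun t : ℝ => t ^ s.re * Real.exp (-(w.re / 2) * t))
      (s := {u : ℂ | w.re / 2 < u.re}) ?_ (Eventually.of_forall hmeas) ?_ ?_ ?_ ?_
      ?_).2.differentiableAt).differentiableWithinAt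
    · exact (isOpen_lt continuous_const Complex.continuous_re).mem_nhds (by simpa using hw)
    · refine (hInt (s.re - 1) (by linarith) w.re hw).mono' (hmeas w) ?_
      filter_upwards [ae_restrict_mem measurableSet_Ioi] with t ht
      rw [norm_mul, Complex.norm_cpow_eq_rpow_re_of_pos ht, Complex.norm_exp]
      simp
    · exact (hcpow.mul (by fun_prop)).aestronglyMeasurable measurableSet_Ioi
    · filter_upwards [ae_restrict_mem measurableSet_Ioi] with t ht u hu
      have ht' : 0 < t := ht
      have hu' : w.re / 2 < u.re := hu
      rw [norm_mul, norm_mul, Complex.norm_cpow_eq_rpow_re_of_pos ht, Complex.norm_exp, norm_neg,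
        Complex.norm_real, Real.norm_of_nonneg ht'.le]
      calc t ^ (s - 1).re * (Real.exp (-(u * t)).re * t)
          = (t ^ (s.re - 1) * t) * Real.exp (-(u.re * t)) := by simp; ring
        _ = t ^ s.re * Real.exp (-(u.re * t)) := by
            rw [Real.rpow_sub_one ht'.ne', div_mul_cancel₀ _ ht'.ne']
        _ ≤ _ := by
            refine mul_le_mul_of_nonneg_left (Real.exp_le_exp.2 ?_) (by positivity)
            nlinarith
    · exact hInt s.re (by linarith) _ (by linarith)
    · filter_upwards with t u _
      have h1 : HasDerivAt (fun u : ℂ => -(u * t)) (-t) u := by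
        simpa using ((hasDerivAt_id u).mul_const (t : ℂ)).fun_neg
      exact (h1.cexp).const_mul _
  have hG : DifferentiableOn ℂ (fun w : ℂ => Complex.Gamma s * Complex.exp (-(Complex.log w * s)))
      {w : ℂ | 0 < w.re} := by
    intro w hw
    have hw' : w ∈ slitPlane := Or.inl hw
    exact (DifferentiableAt.const_mul
      (((Complex.differentiableAt_log hw').mul_const s).neg.cexp) _).differentiableWithinAt
  refine (hF.analyticOnNhd hopen).eqOn_of_preconnected_of_frequently_eq (hG.analyticOnNhd hopen)
    ?_ (z₀ := (1 : ℂ)) (by simp) ?_ hz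
  · exact (convex_halfSpace_re_gt 0).isPreconnected
  · have hreal : ∀ r : ℝ, 0 < r →
        ∫ t : ℝ in Set.Ioi 0, (t : ℂ) ^ (s - 1) * Complex.exp (-((r : ℂ) * t)) =
          Complex.Gamma s * Complex.exp (-(Complex.log r * s)) := by
      intro r hr
      rw [Complex.integral_cpow_mul_exp_neg_mul_Ioi hs hr, mul_comm,
        ← Complex.ofReal_one, ← Complex.ofReal_div,
        Complex.cpow_def_of_ne_zero (by simpa using hr.ne'),
        ← Complex.ofReal_log (by positivity), ← Complex.ofReal_log hr.le, one_div, Real.log_inv]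
      push_cast
      ring_nf
    have ht : Tendsto (fun n : ℕ => ((1 + 1 / ((n : ℝ) + 1) : ℝ) : ℂ)) atTop (nhdsWithin 1 {1}ᶜ) := by
      refine tendsto_nhdsWithin_iff.2 ⟨?_, Eventually.of_forall fun n => ?_⟩
      · have := (tendsto_one_div_add_atTop_nhds_zero_nat (𝕜 := ℝ)).const_add 1
        rw [add_zero] at this
        exact (Complex.continuous_ofReal.tendsto _).comp this
      · have : (1 : ℝ) / ((n : ℝ) + 1) ≠ 0 := by positivity
        simp only [Set.mem_compl_iff, Set.mem_singleton_iff]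
        intro h
        rw [← Complex.ofReal_one, Complex.ofReal_inj] at h
        exact this (by linarith)
    exact ht.frequently (Frequently.of_forall fun n => hreal _ (by positivity))

lemma mellin_exp_neg_mul {y θ : ℝ} (hy : 0 < y) (hθ0 : 0 ≤ θ) (hθ : θ < π / 2) {s : ℂ}
    (hs : 0 < s.re) :
    mellin (fun x : ℝ => Complex.exp (-(y * Complex.exp (θ * I) * x))) s = gammaWave y θ s := by
  have hre : 0 < (y * Complex.exp (θ * I)).re := by
    rw [Complex.re_ofReal_mul, Complex.exp_ofReal_mul_I_re]
    exact mul_pos hy (Real.cos_pos_of_mem_Ioo ⟨by linarith, hθ⟩)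
  have h := integral_cpow_mul_exp_neg_mul_of_re_pos hs hre
  have hz : y * Complex.exp (θ * I) = Complex.exp (Real.log y + θ * I) := by
    rw [Complex.exp_add, ← Complex.ofReal_exp, Real.exp_log hy]
  have hl : Complex.log (y * Complex.exp (θ * I)) = Real.log y + θ * I := by
    rw [hz, Complex.log_exp]
    · simp; linarith [Real.pi_pos]
    · simp; linarith [Real.pi_pos]
  simp only [mellin, smul_eq_mul]
  rw [h, gammaWave, hl, neg_mul]

lemma integral_gammaWave {y θ : ℝ} (hy : 0 < y) (hθ0 : 0 ≤ θ) (hθ : θ < π / 2) :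
    ∫ t : ℝ, gammaWave y θ ((5 / 4 : ℝ) + t * I) =
      2 * π * Complex.exp (-(y * Complex.exp (θ * I))) := by
  have hre : 0 < (y * Complex.exp (θ * I)).re := by
    rw [Complex.re_ofReal_mul, Complex.exp_ofReal_mul_I_re]
    exact mul_pos hy (Real.cos_pos_of_mem_Ioo ⟨by linarith, hθ⟩)
  have hm : ∀ t : ℝ, mellin (fun x : ℝ => Complex.exp (-(y * Complex.exp (θ * I) * x)))
      ((5 / 4 : ℝ) + t * I) = gammaWave y θ ((5 / 4 : ℝ) + t * I) := fun t =>
    mellin_exp_neg_mul hy hθ0 hθ (by simp)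
  have h := mellinInv_mellin_eq (5 / 4)
    (fun x : ℝ => Complex.exp (-(y * Complex.exp (θ * I) * x))) (x := 1) one_pos ?_ ?_ ?_
  · simp only [mellinInv, hm, ofReal_one, one_cpow, one_smul, mul_one] at h
    rw [← h, real_smul]
    push_cast
    rw [← mul_assoc, mul_one_div_cancel (by simp [Real.pi_ne_zero]), one_mul]
  · refine MeasureTheory.Integrable.of_integral_ne_zero ?_
    have := hm 0
    simp only [mellin, ofReal_zero, zero_mul, add_zero] at this
    rw [this, gammaWave]
    exact mul_ne_zero (Complex.Gamma_ne_zero_of_re_pos (by simp)) (Complex.exp_ne_zero _)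
  · unfold VerticalIntegrable
    simp only [hm]
    exact integrable_gammaWave hy hθ0 hθ
  · fun_prop

lemma norm_integral_gammaWave_le_of_antideriv {y θ α β : ℝ} {G G' : ℝ → ℝ} (hy : 0 < y)
    (hαβ : α ≤ β) (hne : ∀ t ∈ Set.Icc α β, t ≠ y * Real.sin θ)
    (hG : ∀ t ∈ Set.Icc α β, HasDerivAt G (G' t) t) (hG' : ContinuousOn G' (Set.Icc α β))
    (hle : ∀ t ∈ Set.Icc α β, ‖gammaAvg y θ t‖ * (y / (t - y * Real.sin θ) ^ 2) ≤ G' t) :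
    ‖∫ t in α..β, gammaWave y θ ((5 / 4 : ℝ) + t * I)‖ ≤
      ‖gammaAvg y θ α‖ * ((3 + |α|) / |α - y * Real.sin θ|)
      + ‖gammaAvg y θ β‖ * ((3 + |β|) / |β - y * Real.sin θ|) + (G β - G α) := by
  refine (norm_integral_gammaWave_le hy hαβ hne).trans ?_
  have hc : ContinuousOn (fun t => y / (t - y * Real.sin θ) ^ 2) (Set.uIcc α β) := by
    rw [Set.uIcc_of_le hαβ]
    exact continuousOn_const.div (by fun_prop) fun t ht => pow_ne_zero 2 (sub_ne_zero.2 (hne t ht))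
  have hi : IntervalIntegrable G' volume α β := by
    refine ContinuousOn.intervalIntegrable ?_
    rwa [Set.uIcc_of_le hαβ]
  rw [← intervalIntegral.integral_eq_sub_of_hasDerivAt (f := G) (f' := G') (by
    rwa [Set.uIcc_of_le hαβ]) hi]
  gcongr
  refine intervalIntegral.integral_mono_on hαβ ?_ hi hle
  exact ((continuous_gammaAvg y θ).norm.continuousOn.mul hc).intervalIntegrable

lemma exists_norm_integral_gammaWave_upper_half : ∃ C > 0, ∀ y T θ : ℝ, 6 ≤ T → T < y → y < 2 * T →
    θ ≤ π / 2 → (y + T) / 2 ≤ y * Real.sin θ →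
    ‖∫ t in (T / 2)..T, gammaWave y θ ((5 / 4 : ℝ) + t * I)‖ ≤
      C * (y ^ (-(5 / 4) : ℝ) * T ^ (3 / 4 : ℝ) * (T / (y - T))) := by
  obtain ⟨C, hC0, hC⟩ := exists_norm_gammaAvg_le_of_nonneg
  refine ⟨80 * C, by positivity, fun y T θ hT hTy hyT hθ hp => ?_⟩
  have hT0 : 0 < T := by linarith
  have hy : 0 < y := by linarith
  have hd : 0 < y - T := by linarith
  set p := y * Real.sin θ with hpdef
  have h := norm_integral_gammaWave_le_of_le (θ := θ) (α := T / 2) (β := T)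
    (M := C * (y ^ (-(5 / 4) : ℝ) * (2 * T ^ (-(1 / 4) : ℝ)) * (4 * T))) hy (by linarith)
    (by
      intro t ht
      have := ht.2
      rw [← hpdef]
      exact ne_of_lt (by linarith))
    (by
      intro t ht
      have ht1 := ht.1
      have ht2 := ht.2
      refine (hC y _ t hy hθ (by linarith)).trans ?_
      have : (3 + t) ^ (-(1 / 4) : ℝ) ≤ 2 * T ^ (-(1 / 4) : ℝ) := by
        calc (3 + t) ^ (-(1 / 4) : ℝ) ≤ (2⁻¹ * T) ^ (-(1 / 4) : ℝ) :=
              Real.rpow_le_rpow_of_nonpos (by positivity) (by linarith) (by norm_num)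
          _ = 2 ^ (1 / 4 : ℝ) * T ^ (-(1 / 4) : ℝ) := by
              rw [Real.mul_rpow (by norm_num) hT0.le, Real.inv_rpow (by norm_num),
                Real.rpow_neg (by norm_num), inv_inv]
          _ ≤ 2 ^ (1 : ℝ) * T ^ (-(1 / 4) : ℝ) := by gcongr <;> norm_num
          _ = _ := by rw [Real.rpow_one]
      have h4 : 0 < 3 + t + y := by linarith
      refine mul_le_mul_of_nonneg_left ?_ hC0.le
      refine mul_le_mul (mul_le_mul_of_nonneg_left this (by positivity)) (by linarith) h4.le
        (by positivity))
  refine h.trans ?_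
  rw [← hpdef, abs_of_pos hT0, abs_of_pos (by linarith : 0 < T / 2),
    abs_of_neg (by linarith : T / 2 - p < 0), abs_of_neg (by linarith : T - p < 0), neg_sub, neg_sub]
  have e1 : (3 + T / 2) / (p - T / 2) ≤ 2 * (T / (y - T)) := by
    rw [← mul_div_assoc]
    exact div_le_div₀ (by positivity) (by linarith) hd (by linarith)
  have e2 : (3 + T) / (p - T) ≤ 4 * (T / (y - T)) := by
    calc (3 + T) / (p - T) ≤ (2 * T) / ((y - T) / 2) := by gcongr <;> linarith
      _ = _ := by field_simp; norm_num
  have e3 : y * (1 / (T / 2 - p) - 1 / (T - p)) ≤ 4 * (T / (y - T)) := by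
    have a1 : 1 / (T / 2 - p) ≤ 0 := one_div_nonpos.2 (by linarith)
    have a2 : -(1 / (T - p)) = 1 / (p - T) := by rw [← neg_sub p T, one_div_neg_eq_neg_one_div, neg_neg]
    calc y * (1 / (T / 2 - p) - 1 / (T - p)) ≤ y * (1 / (p - T)) := by
          refine mul_le_mul_of_nonneg_left ?_ hy.le
          linarith
      _ ≤ (2 * T) * (1 / ((y - T) / 2)) := by
          have : 0 < p - T := by linarith
          have h2 : (y - T) / 2 ≤ p - T := by linarith
          gcongr
      _ = _ := by field_simp; norm_num
  calc _ ≤ C * (y ^ (-(5 / 4) : ℝ) * (2 * T ^ (-(1 / 4) : ℝ)) * (4 * T)) * (10 * (T / (y - T))) := by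
        refine mul_le_mul_of_nonneg_left ?_ (by positivity)
        linarith
    _ = 80 * C * (y ^ (-(5 / 4) : ℝ) * (T ^ (-(1 / 4) : ℝ) * T) * (T / (y - T))) := by ring
    _ = _ := by rw [rpow_neg_quarter_mul_self hT0]

lemma exists_norm_integral_gammaWave_lower_half : ∃ C > 0, ∀ y T θ : ℝ, 6 ≤ T → T < y → y < 2 * T →
    θ ≤ π / 2 → (y + T) / 2 ≤ y * Real.sin θ →
    ‖∫ t in (0 : ℝ)..(T / 2), gammaWave y θ ((5 / 4 : ℝ) + t * I)‖ ≤
      C * (y ^ (-(5 / 4) : ℝ) * T ^ (3 / 4 : ℝ)) := by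
  obtain ⟨C, hC0, hC⟩ := exists_norm_gammaAvg_le_of_nonneg
  refine ⟨100 * C, by positivity, fun y T θ hT hTy hyT hθ hp => ?_⟩
  have hT0 : 0 < T := by linarith
  have hy : 0 < y := by linarith
  set p := y * Real.sin θ with hpdef
  set Y := y ^ (-(5 / 4) : ℝ) with hY
  have hY0 : 0 < Y := by positivity
  have hH : ∀ t ∈ Set.Icc 0 (T / 2), ‖gammaAvg y θ t‖ ≤ 4 * C * Y * T * (3 + t) ^ (-(1 / 4) : ℝ) := by
    intro t ht
    have ht1 := ht.1
    have ht2 := ht.2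
    have h3 : 0 < 3 + t := by linarith
    refine (hC y _ t hy hθ ht.1).trans ?_
    calc _ ≤ C * (Y * (3 + t) ^ (-(1 / 4) : ℝ) * (4 * T)) := by
          refine mul_le_mul_of_nonneg_left ?_ hC0.le
          refine mul_le_mul_of_nonneg_left (by linarith) (by positivity)
      _ = _ := by ring
  have h := norm_integral_gammaWave_le_of_antideriv (θ := θ) (α := 0) (β := T / 2)
    (G := fun t => 32 * C * Y * ((4 / 3) * (3 + t) ^ (3 / 4 : ℝ)))
    (G' := fun t => 32 * C * Y * (3 + t) ^ (-(1 / 4) : ℝ)) hy (by linarith)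
    (by
      intro t ht
      have := ht.2
      rw [← hpdef]
      exact ne_of_lt (by linarith))
    (by
      intro t ht
      have h3 : 0 < 3 + t := by linarith [ht.1]
      refine HasDerivAt.const_mul _ ?_
      have := (((hasDerivAt_id t).const_add 3).rpow_const (p := (3 / 4 : ℝ))
        (Or.inl h3.ne')).const_mul (4 / 3)
      refine this.congr_deriv ?_
      simp only [id]
      norm_num
      ring)
    (by
      refine continuousOn_const.mul ?_
      refine ContinuousOn.rpow_const (by fun_prop) fun t ht => Or.inl ?_
      have := ht.1
      positivity)
    (by
      intro t ht
      have ht1 := ht.1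
      have ht2 := ht.2
      have h3 : 0 < 3 + t := by linarith
      have e : y / (t - p) ^ 2 ≤ 8 / T := by
        have : (T / 2) ^ 2 ≤ (t - p) ^ 2 := by
          refine sq_le_sq.2 ?_
          rw [abs_of_pos (by positivity), abs_of_neg (by linarith)]
          linarith
        calc y / (t - p) ^ 2 ≤ (2 * T) / (T / 2) ^ 2 := by gcongr
          _ = _ := by field_simp; norm_num
      calc _ ≤ 4 * C * Y * T * (3 + t) ^ (-(1 / 4) : ℝ) * (8 / T) :=
            mul_le_mul (hH t ht) e (by positivity) (by positivity)
        _ = _ := by field_simp; norm_num)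
  refine h.trans ?_
  rw [← hpdef, abs_zero, zero_sub, abs_neg, abs_of_pos (by linarith : 0 < p),
    abs_of_pos (by linarith : 0 < T / 2), abs_of_neg (by linarith : T / 2 - p < 0), neg_sub]
  have hT1 : 1 ≤ T ^ (3 / 4 : ℝ) := Real.one_le_rpow (by linarith) (by norm_num)
  have f1 : ‖gammaAvg y θ 0‖ * ((3 + 0) / p) ≤ 12 * C * Y * T ^ (3 / 4 : ℝ) := by
    have e1 : (3 + 0 : ℝ) ^ (-(1 / 4) : ℝ) ≤ 1 :=
      Real.rpow_le_one_of_one_le_of_nonpos (by norm_num) (by norm_num)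
    calc ‖gammaAvg y θ 0‖ * ((3 + 0) / p) ≤ (4 * C * Y * T * 1) * (3 / T) := by
          refine mul_le_mul ((hH 0 ⟨le_rfl, by linarith⟩).trans
            (mul_le_mul_of_nonneg_left e1 (by positivity))) ?_ (by
              have : 0 < p := by linarith
              positivity) (by positivity)
          rw [add_zero]
          gcongr; linarith
      _ = 12 * C * Y * 1 := by field_simp; norm_num
      _ ≤ _ := by gcongr
  have f2 : ‖gammaAvg y θ (T / 2)‖ * ((3 + T / 2) / (p - T / 2)) ≤ 16 * C * Y * T ^ (3 / 4 : ℝ) := by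
    have e1 : (3 + T / 2 : ℝ) ^ (-(1 / 4) : ℝ) ≤ 2 * T ^ (-(1 / 4) : ℝ) := by
      calc (3 + T / 2) ^ (-(1 / 4) : ℝ) ≤ (2⁻¹ * T) ^ (-(1 / 4) : ℝ) :=
            Real.rpow_le_rpow_of_nonpos (by positivity) (by linarith) (by norm_num)
        _ = 2 ^ (1 / 4 : ℝ) * T ^ (-(1 / 4) : ℝ) := by
            rw [Real.mul_rpow (by norm_num) hT0.le, Real.inv_rpow (by norm_num),
              Real.rpow_neg (by norm_num), inv_inv]
        _ ≤ 2 ^ (1 : ℝ) * T ^ (-(1 / 4) : ℝ) := by gcongr <;> norm_num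
        _ = _ := by rw [Real.rpow_one]
    have e2 : (3 + T / 2) / (p - T / 2) ≤ 2 := by
      rw [div_le_iff₀ (by linarith)]; linarith
    calc ‖gammaAvg y θ (T / 2)‖ * ((3 + T / 2) / (p - T / 2))
        ≤ (4 * C * Y * T * (2 * T ^ (-(1 / 4) : ℝ))) * 2 := by
          refine mul_le_mul ((hH _ ⟨by linarith, le_rfl⟩).trans
            (mul_le_mul_of_nonneg_left e1 (by positivity))) e2 (by
              have : 0 < p - T / 2 := by linarith
              positivity) (by positivity)
      _ = 16 * C * Y * (T ^ (-(1 / 4) : ℝ) * T) := by ring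
      _ = _ := by rw [rpow_neg_quarter_mul_self hT0]
  have f3 : (3 + T / 2) ^ (3 / 4 : ℝ) ≤ T ^ (3 / 4 : ℝ) := by gcongr; linarith
  have f4 : 0 ≤ 32 * C * Y * (4 / 3 * (3 + 0 : ℝ) ^ (3 / 4 : ℝ)) := by positivity
  have f5 : 32 * C * Y * (4 / 3 * (3 + T / 2) ^ (3 / 4 : ℝ)) ≤ 43 * C * Y * T ^ (3 / 4 : ℝ) := by
    have := mul_le_mul_of_nonneg_left f3 (by positivity : 0 ≤ C * Y)
    have : 0 ≤ C * Y * T ^ (3 / 4 : ℝ) := by positivity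
    nlinarith
  have : 0 ≤ C * Y * T ^ (3 / 4 : ℝ) := by positivity
  nlinarith

/-- The part of the integral above the stationary point; the last summand is a boundary term. -/
lemma exists_norm_integral_gammaWave_tail : ∃ C > 0, ∀ y T θ R : ℝ, 6 ≤ T → 0 < y → y < 2 * T →
    2 * T ≤ R → θ ≤ π / 2 →
    ‖∫ t in (2 * T)..R, gammaWave y θ ((5 / 4 : ℝ) + t * I)‖ ≤
      C * (y ^ (-(5 / 4) : ℝ) * T ^ (3 / 4 : ℝ) * (T / (2 * T - y)))
        + ‖gammaAvg y θ R‖ * ((3 + R) / (R - y)) := by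
  obtain ⟨C, hC0, hC⟩ := exists_norm_gammaAvg_le_of_nonneg
  refine ⟨66 * C, by positivity, fun y T θ R hT hy hyT hR hθ => ?_⟩
  have hT0 : 0 < T := by linarith
  have hR0 : 0 < R := by linarith
  have hp : y * Real.sin θ ≤ y := mul_le_of_le_one_right hy.le (Real.sin_le_one θ)
  set p := y * Real.sin θ with hpdef
  set Y := y ^ (-(5 / 4) : ℝ) with hY
  have hY0 : 0 < Y := by positivity
  have hH : ∀ t ∈ Set.Icc (2 * T) R, ‖gammaAvg y θ t‖ ≤ 3 * C * Y * t ^ (3 / 4 : ℝ) := by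
    intro t ht
    have ht1 := ht.1
    have ht2 := ht.2
    have h0 : 0 < t := by linarith
    have h3 : 0 < 3 + t := by linarith
    refine (hC y _ t hy hθ h0.le).trans ?_
    have e : (3 + t) ^ (-(1 / 4) : ℝ) ≤ t ^ (-(1 / 4) : ℝ) :=
      Real.rpow_le_rpow_of_nonpos h0 (by linarith) (by norm_num)
    calc _ ≤ C * (Y * t ^ (-(1 / 4) : ℝ) * (3 * t)) := by
          refine mul_le_mul_of_nonneg_left ?_ hC0.le
          exact mul_le_mul (mul_le_mul_of_nonneg_left e hY0.le) (by linarith) (by linarith)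
            (by positivity)
      _ = 3 * C * Y * (t ^ (-(1 / 4) : ℝ) * t) := by ring
      _ = _ := by rw [rpow_neg_quarter_mul_self h0]
  have h := norm_integral_gammaWave_le_of_antideriv (θ := θ) (α := 2 * T) (β := R)
    (G := fun t => -(24 * C * Y * T * (t ^ (3 / 4 : ℝ) / (t - y))))
    (G' := fun t => -(24 * C * Y * T *
      ((3 / 4 * t ^ (-(1 / 4) : ℝ) * (t - y) - t ^ (3 / 4 : ℝ)) / (t - y) ^ 2))) hy hR
    (by
      intro t ht
      have := ht.1
      rw [← hpdef]
      exact ne_of_gt (by linarith))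
    (by
      intro t ht
      have h0 : 0 < t := by linarith [ht.1]
      have h1 : t - y ≠ 0 := by linarith [ht.1]
      refine (HasDerivAt.const_mul _ ?_).fun_neg
      have := ((hasDerivAt_id t).rpow_const (p := (3 / 4 : ℝ)) (Or.inl h0.ne')).div
        ((hasDerivAt_id t).sub_const y) h1
      refine this.congr_deriv ?_
      simp only [id]
      norm_num)
    (by
      refine (continuousOn_const.mul (ContinuousOn.div ?_ (by fun_prop) fun t ht => ?_)).neg
      · have h0 : ∀ t ∈ Set.Icc (2 * T) R, t ≠ 0 := fun t ht => by
          have := ht.1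
          exact ne_of_gt (by linarith)
        exact (((continuousOn_const.mul (continuousOn_id.rpow_const fun t ht =>
          Or.inl (h0 t ht))).mul (by fun_prop)).sub (continuousOn_id.rpow_const fun t ht =>
          Or.inl (h0 t ht)))
      · exact pow_ne_zero 2 (by linarith [ht.1]))
    (by
      intro t ht
      have ht1 := ht.1
      have h0 : 0 < t := by linarith
      have h1 : 0 < t - y := by linarith
      have e : y / (t - p) ^ 2 ≤ 2 * T / (t - y) ^ 2 := by
        gcongr
      calc _ ≤ 3 * C * Y * t ^ (3 / 4 : ℝ) * (2 * T / (t - y) ^ 2) :=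
            mul_le_mul (hH t ht) e (by positivity) (by positivity)
        _ = 24 * C * Y * T * ((1 / 4 * t ^ (3 / 4 : ℝ)) / (t - y) ^ 2) := by ring
        _ ≤ 24 * C * Y * T *
            ((t ^ (3 / 4 : ℝ) - 3 / 4 * t ^ (-(1 / 4) : ℝ) * (t - y)) / (t - y) ^ 2) := by
            refine mul_le_mul_of_nonneg_left ?_ (by positivity)
            refine div_le_div_of_nonneg_right ?_ (by positivity)
            have := rpow_neg_quarter_mul_self h0
            have h5 : 0 ≤ t ^ (-(1 / 4) : ℝ) * y := by positivity
            nlinarith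
        _ = _ := by ring)
  refine h.trans ?_
  rw [← hpdef, abs_of_pos hR0, abs_of_pos (by linarith : 0 < 2 * T),
    abs_of_pos (by linarith : 0 < 2 * T - p), abs_of_pos (by linarith : 0 < R - p)]
  have hd : 0 < 2 * T - y := by linarith
  have e2 : (2 * T) ^ (3 / 4 : ℝ) ≤ 2 * T ^ (3 / 4 : ℝ) := by
    rw [Real.mul_rpow (by norm_num) hT0.le]
    gcongr
    calc (2 : ℝ) ^ (3 / 4 : ℝ) ≤ 2 ^ (1 : ℝ) := by gcongr <;> norm_num
      _ = 2 := Real.rpow_one _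
  have f1 : ‖gammaAvg y θ (2 * T)‖ * ((3 + 2 * T) / (2 * T - p)) ≤
      18 * C * (Y * T ^ (3 / 4 : ℝ) * (T / (2 * T - y))) := by
    calc _ ≤ 3 * C * Y * (2 * T ^ (3 / 4 : ℝ)) * (3 * T / (2 * T - y)) := by
          refine mul_le_mul ((hH _ ⟨le_rfl, hR⟩).trans
            (mul_le_mul_of_nonneg_left e2 (by positivity))) ?_ (by
              have : 0 < 2 * T - p := by linarith
              positivity) (by positivity)
          gcongr; linarith
      _ = _ := by ring
  have f2 : ‖gammaAvg y θ R‖ * ((3 + R) / (R - p)) ≤ ‖gammaAvg y θ R‖ * ((3 + R) / (R - y)) := by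
    have : 0 < R - y := by linarith
    gcongr
  have f3 : 0 ≤ 24 * C * Y * T * (R ^ (3 / 4 : ℝ) / (R - y)) := by
    have : 0 < R - y := by linarith
    positivity
  have f4 : 24 * C * Y * T * ((2 * T) ^ (3 / 4 : ℝ) / (2 * T - y)) ≤
      48 * C * (Y * T ^ (3 / 4 : ℝ) * (T / (2 * T - y))) := by
    calc _ ≤ 24 * C * Y * T * (2 * T ^ (3 / 4 : ℝ) / (2 * T - y)) := by gcongr
      _ = _ := by ring
  linarith

lemma exists_norm_integral_gammaWave_Iic : ∃ C > 0, ∀ y θ R : ℝ, 0 < y → 0 ≤ θ → 0 ≤ R →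
    ‖∫ t in (-R)..0, gammaWave y θ ((5 / 4 : ℝ) + t * I)‖ ≤ C * y ^ (-(5 / 4) : ℝ) := by
  obtain ⟨C, hC0, hC⟩ := exists_norm_gammaWave_le
  refine ⟨6 * C, by positivity, fun y θ R hy hθ hR => ?_⟩
  have hb : ∀ t ∈ Set.Ioc (-R) 0, ‖gammaWave y θ ((5 / 4 : ℝ) + t * I)‖ ≤
      6 * C * y ^ (-(5 / 4) : ℝ) * Real.exp t := by
    intro t ht
    have ht0 : t ≤ 0 := ht.2
    have h := hC y θ ((5 / 4 : ℝ) + t * I) hy (by simp; norm_num) (by simp; norm_num)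
    simp only [add_re, ofReal_re, mul_re, I_re, mul_zero, ofReal_im, I_im, mul_one, sub_self,
      add_zero, add_im, mul_im, zero_add] at h
    refine h.trans ?_
    rw [abs_of_nonpos ht0]
    have e1 : (3 + -t) ^ (5 / 4 - 1 / 2 : ℝ) ≤ 6 * Real.exp (-t / 2) := by
      calc (3 + -t) ^ (5 / 4 - 1 / 2 : ℝ) ≤ (3 + -t) ^ (1 : ℝ) :=
            Real.rpow_le_rpow_of_exponent_le (by linarith) (by norm_num)
        _ = 3 + -t := Real.rpow_one _
        _ ≤ 6 * (-t / 2 + 1) := by linarith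
        _ ≤ _ := by gcongr; exact Real.add_one_le_exp _
    have e2 : Real.exp (-(π / 2 * -t) + θ * t) ≤ Real.exp (3 / 2 * t) := by
      refine Real.exp_le_exp.2 ?_
      nlinarith [Real.pi_gt_three]
    calc _ ≤ C * (6 * Real.exp (-t / 2) * y ^ (-(5 / 4) : ℝ) * Real.exp (3 / 2 * t)) := by
          gcongr
      _ = 6 * C * y ^ (-(5 / 4) : ℝ) * (Real.exp (-t / 2) * Real.exp (3 / 2 * t)) := by ring
      _ = _ := by rw [← Real.exp_add]; congr 2; ring
  have h := intervalIntegral.norm_integral_le_of_norm_le (by linarith : -R ≤ 0)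
    (Eventually.of_forall hb : ∀ᵐ t ∂volume, _)
    (by exact (Continuous.intervalIntegrable (by fun_prop) _ _))
  refine h.trans ?_
  rw [intervalIntegral.integral_const_mul, integral_exp, Real.exp_zero]
  refine mul_le_of_le_one_right (by positivity) ?_
  linarith [Real.exp_pos (-R)]

lemma tendsto_norm_gammaAvg_mul {y θ : ℝ} (hy : 0 < y) (hθ : θ < π / 2) :
    Tendsto (fun R => ‖gammaAvg y θ R‖ * ((3 + R) / (R - y))) atTop (nhds 0) := by
  obtain ⟨C, hC0, hC⟩ := exists_norm_gammaAvg_le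
  set δ := π / 2 - θ with hδ
  have hδ0 : 0 < δ := by rw [hδ]; linarith
  have h1 := tendsto_rpow_mul_exp_neg_mul_atTop_nhds_zero 1 δ hδ0
  have h2 := h1.const_mul (4 * C * y ^ (-(5 / 4) : ℝ) * 3)
  rw [mul_zero] at h2
  refine squeeze_zero' ?_ ?_ h2
  · filter_upwards [eventually_gt_atTop y, eventually_gt_atTop 0] with R h3 h4
    have : 0 < R - y := by linarith
    positivity
  · filter_upwards [eventually_ge_atTop (2 * y + 3)] with R hR
    have hR0 : 0 < R := by linarith
    have e1 : (3 + R) / (R - y) ≤ 4 := by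
      rw [div_le_iff₀ (by linarith)]; linarith
    have e2 : (3 + R) ^ (-(1 / 4) : ℝ) ≤ 1 :=
      Real.rpow_le_one_of_one_le_of_nonpos (by linarith) (by norm_num)
    have h := hC y θ R hy
    rw [abs_of_pos hR0] at h
    calc _ ≤ C * (y ^ (-(5 / 4) : ℝ) * 1 * (3 * R) * Real.exp (-δ * R)) * 4 := by
          refine mul_le_mul (h.trans ?_) e1 ?_ (by positivity)
          · have e3 : -(π / 2 * R) + θ * R = -δ * R := by rw [hδ]; ring
            rw [e3]
            refine mul_le_mul_of_nonneg_left ?_ hC0.le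
            refine mul_le_mul_of_nonneg_right ?_ (Real.exp_pos _).le
            exact mul_le_mul (mul_le_mul_of_nonneg_left e2 (by positivity)) (by linarith)
              (by positivity) (by positivity)
          · have : 0 < R - y := by linarith
            positivity
      _ = _ := by rw [Real.rpow_one]; ring

lemma exists_norm_sub_integral_gammaWave_le : ∃ C > 0, ∀ y T θ : ℝ, 6 ≤ T → T < y → y < 2 * T →
    0 ≤ θ → θ < π / 2 → (y + T) / 2 ≤ y * Real.sin θ →
    ‖2 * π * Complex.exp (-(y * Complex.exp (θ * I)))
        - ∫ t in T..(2 * T), gammaWave y θ ((5 / 4 : ℝ) + t * I)‖ ≤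
      C * (y ^ (-(5 / 4) : ℝ) * T ^ (3 / 4 : ℝ) * (T / (y - T) + T / (2 * T - y))) := by
  obtain ⟨C1, hC1, h1⟩ := exists_norm_integral_gammaWave_upper_half
  obtain ⟨C2, hC2, h2⟩ := exists_norm_integral_gammaWave_lower_half
  obtain ⟨C3, hC3, h3⟩ := exists_norm_integral_gammaWave_tail
  obtain ⟨C4, hC4, h4⟩ := exists_norm_integral_gammaWave_Iic
  refine ⟨C1 + C2 + C3 + C4, by positivity, fun y T θ hT hTy hyT hθ0 hθ hp => ?_⟩
  have hT0 : 0 < T := by linarith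
  have hy : 0 < y := by linarith
  set f : ℝ → ℂ := fun t => gammaWave y θ ((5 / 4 : ℝ) + t * I) with hf
  have hfi : ∀ a b, IntervalIntegrable f volume a b := fun a b =>
    (continuous_gammaWave_vertical y θ (by norm_num)).intervalIntegrable _ _
  set B : ℝ := C4 * y ^ (-(5 / 4) : ℝ) + C2 * (y ^ (-(5 / 4) : ℝ) * T ^ (3 / 4 : ℝ))
    + C1 * (y ^ (-(5 / 4) : ℝ) * T ^ (3 / 4 : ℝ) * (T / (y - T)))
    + C3 * (y ^ (-(5 / 4) : ℝ) * T ^ (3 / 4 : ℝ) * (T / (2 * T - y))) with hB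
  have hlim := intervalIntegral_tendsto_integral (integrable_gammaWave hy hθ0 hθ)
    tendsto_neg_atTop_atBot tendsto_id
  rw [integral_gammaWave hy hθ0 hθ] at hlim
  have hlim2 := (hlim.sub_const (∫ t in T..(2 * T), f t)).norm
  have hmain : ‖2 * π * Complex.exp (-(y * Complex.exp (θ * I))) - ∫ t in T..(2 * T), f t‖ ≤ B + 0 := by
    refine le_of_tendsto_of_tendsto hlim2 ((tendsto_norm_gammaAvg_mul hy hθ).const_add B) ?_
    filter_upwards [eventually_ge_atTop (2 * T)] with R hR
    have e : (∫ t in (-R)..R, f t) - ∫ t in T..(2 * T), f t =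
        (∫ t in (-R)..0, f t) + (∫ t in (0 : ℝ)..(T / 2), f t) + (∫ t in (T / 2)..T, f t)
          + ∫ t in (2 * T)..R, f t := by
      rw [← intervalIntegral.integral_add_adjacent_intervals (hfi (-R) 0) (hfi 0 R),
        ← intervalIntegral.integral_add_adjacent_intervals (hfi 0 (T / 2)) (hfi (T / 2) R),
        ← intervalIntegral.integral_add_adjacent_intervals (hfi (T / 2) T) (hfi T R),
        ← intervalIntegral.integral_add_adjacent_intervals (hfi T (2 * T)) (hfi (2 * T) R)]
      ring
    show ‖(∫ t in (-R)..R, f t) - ∫ t in T..(2 * T), f t‖ ≤ _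
    rw [e]
    have g1 := h4 y θ R hy hθ0 (by linarith)
    have g2 := h2 y T θ hT hTy hyT hθ.le hp
    have g3 := h1 y T θ hT hTy hyT hθ.le hp
    have g4 := h3 y T θ R hT hy hyT hR hθ.le
    refine (norm_add_le _ _).trans ((add_le_add ((norm_add_le _ _).trans (add_le_add
      ((norm_add_le _ _).trans (add_le_add g1 g2)) g3)) g4).trans (le_of_eq ?_))
    rw [hB]; ring
  refine hmain.trans ?_
  have hd1 : 0 < y - T := by linarith
  have hd2 : 0 < 2 * T - y := by linarith
  have k1 : 1 ≤ T / (y - T) := by rw [le_div_iff₀ hd1]; linarith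
  have k2 : 0 ≤ T / (2 * T - y) := by positivity
  have k3 : 1 ≤ T ^ (3 / 4 : ℝ) := Real.one_le_rpow (by linarith) (by norm_num)
  set Y := y ^ (-(5 / 4) : ℝ) with hY
  have hY0 : 0 < Y := by positivity
  set S := T / (y - T) + T / (2 * T - y) with hS
  have b1 : Y * T ^ (3 / 4 : ℝ) * 1 ≤ Y * T ^ (3 / 4 : ℝ) * S :=
    mul_le_mul_of_nonneg_left (by linarith) (by positivity)
  have b2 : Y * 1 ≤ Y * T ^ (3 / 4 : ℝ) := mul_le_mul_of_nonneg_left k3 hY0.le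
  have b3 : Y * T ^ (3 / 4 : ℝ) * (T / (y - T)) ≤ Y * T ^ (3 / 4 : ℝ) * S :=
    mul_le_mul_of_nonneg_left (by linarith) (by positivity)
  have b4 : Y * T ^ (3 / 4 : ℝ) * (T / (2 * T - y)) ≤ Y * T ^ (3 / 4 : ℝ) * S :=
    mul_le_mul_of_nonneg_left (by linarith) (by positivity)
  have c1 := mul_le_mul_of_nonneg_left (b2.trans ((mul_one (Y * T ^ (3 / 4 : ℝ))).ge.trans b1)) hC4.le
  have c2 := mul_le_mul_of_nonneg_left ((mul_one (Y * T ^ (3 / 4 : ℝ))).ge.trans b1) hC2.le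
  have c3 := mul_le_mul_of_nonneg_left b3 hC1.le
  have c4 := mul_le_mul_of_nonneg_left b4 hC3.le
  rw [mul_one] at c1
  rw [hB]
  linarith

/-- Stationary point inside the range of integration, on the critical ray `θ = π / 2`. -/
lemma exists_norm_integral_gammaWave_le_inside : ∃ C > 0, ∀ y T : ℝ, 6 ≤ T → T < y → y < 2 * T →
    ‖2 * π * Complex.exp (-(y * I))
        - ∫ t in T..(2 * T), gammaWave y (π / 2) ((5 / 4 : ℝ) + t * I)‖ ≤
      C * (y ^ (-(5 / 4) : ℝ) * T ^ (3 / 4 : ℝ) * (T / (y - T) + T / (2 * T - y))) := by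
  obtain ⟨C, hC0, hC⟩ := exists_norm_sub_integral_gammaWave_le
  refine ⟨C, hC0, fun y T hT hTy hyT => ?_⟩
  have hcont : Continuous fun θ : ℝ => 2 * π * Complex.exp (-(y * Complex.exp (θ * I)))
        - ∫ t in T..(2 * T), gammaWave y θ ((5 / 4 : ℝ) + t * I) := by
    refine Continuous.sub (by fun_prop) ?_
    refine intervalIntegral.continuous_parametric_intervalIntegral_of_continuous' ?_ _ _
    unfold gammaWave
    refine Continuous.mul ?_ (by fun_prop)
    refine Continuous.comp (g := fun t : ℝ => Complex.Gamma ((5 / 4 : ℝ) + t * I)) ?_ continuous_snd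
    refine continuous_iff_continuousAt.2 fun t => ?_
    refine ContinuousAt.comp (f := fun t : ℝ => ((5 / 4 : ℝ) + t * I : ℂ)) (g := Complex.Gamma)
      (Complex.differentiableAt_Gamma _ fun m hm => ?_).continuousAt (by fun_prop)
    have := congrArg Complex.re hm
    simp at this
    linarith [(Nat.cast_nonneg m : (0 : ℝ) ≤ m)]
  have hlim := (hcont.norm.tendsto (π / 2)).mono_left (nhdsWithin_le_nhds (s := Set.Iio (π / 2)))
  have h := le_of_tendsto (b := C * (y ^ (-(5 / 4) : ℝ) * T ^ (3 / 4 : ℝ) *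
    (T / (y - T) + T / (2 * T - y)))) hlim (by
    have h1 : ∀ᶠ θ in nhdsWithin (π / 2) (Set.Iio (π / 2)), (0 : ℝ) < θ :=
      nhdsWithin_le_nhds (lt_mem_nhds (by positivity))
    have h2 : ∀ᶠ θ in nhdsWithin (π / 2) (Set.Iio (π / 2)), (y + T) / 2 < y * Real.sin θ := by
      refine nhdsWithin_le_nhds ?_
      have hc : ContinuousAt (fun θ => y * Real.sin θ) (π / 2) := by fun_prop
      refine hc.eventually (lt_mem_nhds ?_)
      simp only [Real.sin_pi_div_two]; linarith
    filter_upwards [h1, h2, self_mem_nhdsWithin] with θ a b c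
    exact hC y T θ hT hTy hyT a.le c b.le)
  have e : Complex.exp (((π / 2 : ℝ) : ℂ) * I) = I := by
    push_cast
    exact Complex.exp_pi_div_two_mul_I
  rwa [e] at h

lemma feFactor_mul_cpow_neg {k : ℕ} (hk : k ≠ 0) (s : ℂ) :
    feFactor s * (k : ℂ) ^ (-s) =
      gammaWave (2 * π * k) (π / 2) s + gammaWave (2 * π * k) (-(π / 2)) s := by
  have hk0 : (0 : ℝ) < k := by positivity
  have e1 : (2 * π : ℂ) ^ (-s) * (k : ℂ) ^ (-s) = Complex.exp (-(Real.log (2 * π * k) * s)) := by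
    rw [show (2 * π : ℂ) = ((2 * π : ℝ) : ℂ) by push_cast; rfl,
      show (k : ℂ) = ((k : ℝ) : ℂ) by push_cast; rfl,
      Complex.cpow_def_of_ne_zero (by simp [Real.pi_ne_zero]),
      Complex.cpow_def_of_ne_zero (by simpa using hk), ← Complex.exp_add,
      Real.log_mul (by positivity) hk0.ne', Complex.ofReal_add, Complex.ofReal_log (by positivity),
      Complex.ofReal_log hk0.le]
    congr 1; ring
  have e2 : 2 * Complex.cos (π * s / 2) =
      Complex.exp (-(((π / 2 : ℝ) : ℂ) * I * s)) + Complex.exp (-(((-(π / 2) : ℝ) : ℂ) * I * s)) := by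
    rw [Complex.two_cos, add_comm]
    congr 2 <;> push_cast <;> ring
  calc feFactor s * (k : ℂ) ^ (-s)
      = Complex.Gamma s * ((2 * π : ℂ) ^ (-s) * (k : ℂ) ^ (-s)) * (2 * Complex.cos (π * s / 2)) := by
        rw [feFactor]; ring
    _ = _ := by
        have e3 (θ : ℝ) : gammaWave (2 * π * k) θ s = Complex.Gamma s *
            (Complex.exp (-(Real.log (2 * π * k) * s)) * Complex.exp (-((θ : ℂ) * I * s))) := by
          rw [gammaWave, ← Complex.exp_add]; congr 2; ring
        rw [e1, e2, e3, e3]; ring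

lemma exp_neg_two_pi_mul_nat_mul_I (k : ℕ) : Complex.exp (-((2 * π * k : ℝ) * I)) = 1 := by
  rw [Complex.exp_eq_one_iff]
  exact ⟨-k, by push_cast; ring⟩

/-- Asymptotics of the integral of a single Dirichlet term against `feFactor`. -/
lemma exists_norm_integral_term_sub_le : ∃ C > 0, ∀ (T : ℝ) (k : ℕ) (c : ℂ), 30 ≤ T → k ≠ 0 →
    ‖c‖ ≤ 1 → (k < T / (2 * π) → c = 0) → (T / (2 * π) < k → k < T / π → c = 1) →
    (T / π < k → c = 0) →
    ‖(∫ t in T..(2 * T), feFactor ((5 / 4 : ℝ) + t * I) * (k : ℂ) ^ (-((5 / 4 : ℝ) + t * I : ℂ)))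
        - 2 * π * c‖ ≤
      C * ((k : ℝ) ^ (-(5 / 4) : ℝ) * T ^ (3 / 4 : ℝ) *
        (1 + T / (1 + |k - T / (2 * π)|) + T / (1 + |k - T / π|))) := by
  obtain ⟨C1, hC1, h1⟩ := exists_norm_integral_gammaWave_le_left
  obtain ⟨C2, hC2, h2⟩ := exists_norm_integral_gammaWave_le_right
  obtain ⟨C3, hC3, h3⟩ := exists_norm_integral_gammaWave_le_trivial
  obtain ⟨C4, hC4, h4⟩ := exists_norm_integral_gammaWave_neg_le
  obtain ⟨C5, hC5, h5⟩ := exists_norm_integral_gammaWave_le_inside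
  refine ⟨2 * C1 + 2 * C2 + 2 * C3 + C4 + 2 * C5 + 4 * π, by positivity,
    fun T k c hT hk hc hcl hcm hcr => ?_⟩
  have hπ := Real.pi_gt_three
  have hπ4 := Real.pi_lt_four
  have hT0 : 0 < T := by linarith
  have hk1 : (1 : ℝ) ≤ k := by exact_mod_cast Nat.one_le_iff_ne_zero.2 hk
  set y : ℝ := 2 * π * k with hy
  have hy0 : 0 < y := by positivity
  set Y := y ^ (-(5 / 4) : ℝ) with hYdef
  set K := (k : ℝ) ^ (-(5 / 4) : ℝ) with hKdef
  have hK0 : 0 < K := by positivity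
  have hY0 : 0 < Y := by positivity
  have hYK : Y ≤ K := Real.rpow_le_rpow_of_nonpos (by positivity) (by rw [hy]; nlinarith) (by norm_num)
  set P := T ^ (3 / 4 : ℝ) with hP
  have hP1 : 1 ≤ P := Real.one_le_rpow (by linarith) (by norm_num)
  obtain ⟨u, hu⟩ : ∃ u, u = T / (2 * π) := ⟨_, rfl⟩
  have hTu : T = 2 * π * u := by rw [hu]; field_simp
  have hu2 : T / π = 2 * u := by rw [hu]; field_simp
  have hu0 : 0 < u := by rw [hu]; positivity
  rw [hu2] at hcm hcr ⊢
  rw [← hu] at hcl hcm ⊢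
  set A := T / (1 + |k - u|) with hA
  set B := T / (1 + |k - 2 * u|) with hB
  have hA0 : 0 ≤ A := by positivity
  have hB0 : 0 ≤ B := by positivity
  have i1 : IntervalIntegrable (fun t : ℝ => gammaWave y (π / 2) ((5 / 4 : ℝ) + t * I)) volume T (2 * T) :=
    (continuous_gammaWave_vertical y _ (by norm_num)).intervalIntegrable _ _
  have i2 : IntervalIntegrable (fun t : ℝ => gammaWave y (-(π / 2)) ((5 / 4 : ℝ) + t * I)) volume T (2 * T) :=
    (continuous_gammaWave_vertical y _ (by norm_num)).intervalIntegrable _ _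
  simp_rw [feFactor_mul_cpow_neg hk]
  rw [intervalIntegral.integral_add i1 i2]
  have hneg := h4 y T hy0 (by linarith)
  have hmain : ‖(∫ t in T..(2 * T), gammaWave y (π / 2) ((5 / 4 : ℝ) + t * I)) - 2 * π * c‖ ≤
      (2 * C1 + 2 * C2 + 2 * C3 + 2 * C5 + 4 * π) * (K * P * (1 + A + B)) := by
    have hX0 : 0 ≤ K * P * (1 + A + B) := by positivity
    have key : ∀ C, 0 ≤ C → C ≤ 2 * C1 + 2 * C2 + 2 * C3 + 2 * C5 + 4 * π → ∀ D, D ≤ 1 + A + B →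
        C * (Y * P * D) ≤ (2 * C1 + 2 * C2 + 2 * C3 + 2 * C5 + 4 * π) * (K * P * (1 + A + B)) := by
      intro C hC hCle D hD
      calc C * (Y * P * D) ≤ C * (K * P * (1 + A + B)) := by
            refine mul_le_mul_of_nonneg_left ?_ hC
            calc Y * P * D ≤ Y * P * (1 + A + B) := mul_le_mul_of_nonneg_left hD (by positivity)
              _ ≤ _ := by gcongr
        _ ≤ _ := mul_le_mul_of_nonneg_right hCle hX0
    have near : (k : ℝ) ≤ T → T / 2 ≤ A ∨ T / 2 ≤ B →
        ‖(∫ t in T..(2 * T), gammaWave y (π / 2) ((5 / 4 : ℝ) + t * I)) - 2 * π * c‖ ≤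
        (2 * C1 + 2 * C2 + 2 * C3 + 2 * C5 + 4 * π) * (K * P * (1 + A + B)) := by
      intro hkT h
      have hD : T / 2 ≤ 1 + A + B := by rcases h with h | h <;> linarith
      have hKP : 1 / T ^ (1 / 2 : ℝ) ≤ K * P := by
        calc 1 / T ^ (1 / 2 : ℝ) = T ^ (-(5 / 4) : ℝ) * P := by
              rw [hP, ← Real.rpow_add hT0, one_div, ← Real.rpow_neg hT0.le]; norm_num
          _ ≤ K * P := mul_le_mul_of_nonneg_right
              (Real.rpow_le_rpow_of_nonpos (by linarith) hkT (by norm_num)) (by linarith)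
      have hT2 : T ^ (1 / 2 : ℝ) ≤ T := by
        calc T ^ (1 / 2 : ℝ) ≤ T ^ (1 : ℝ) := Real.rpow_le_rpow_of_exponent_le (by linarith) (by norm_num)
          _ = T := Real.rpow_one T
      have hT3 : 0 < T ^ (1 / 2 : ℝ) := by positivity
      have h12 : 1 / 2 ≤ K * P * (1 + A + B) := by
        calc (1 / 2 : ℝ) ≤ 1 / T ^ (1 / 2 : ℝ) * (T / 2) := by
              rw [div_mul_div_comm, div_le_div_iff₀ (by norm_num) (by positivity)]; linarith
          _ ≤ _ := mul_le_mul hKP hD (by positivity) (by positivity)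
      have hb1 : ‖∫ t in T..(2 * T), gammaWave y (π / 2) ((5 / 4 : ℝ) + t * I)‖ ≤
          (2 * C3) * (K * P * (1 + A + B)) := by
        refine (h3 y T hy0 (by linarith)).trans ?_
        calc C3 * (Y * P * T) ≤ C3 * (K * P * (2 * (1 + A + B))) := by
              refine mul_le_mul_of_nonneg_left ?_ hC3.le
              exact mul_le_mul (mul_le_mul_of_nonneg_right hYK (by linarith)) (by linarith) hT0.le
                (by positivity)
          _ = _ := by ring
      have hb2 : ‖2 * π * c‖ ≤ 4 * π * (K * P * (1 + A + B)) := by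
        rw [norm_mul, norm_mul, Complex.norm_ofNat, Complex.norm_real, Real.norm_of_nonneg Real.pi_pos.le]
        calc 2 * π * ‖c‖ ≤ 2 * π * 1 := mul_le_mul_of_nonneg_left hc (by positivity)
          _ = 4 * π * (1 / 2) := by ring
          _ ≤ _ := mul_le_mul_of_nonneg_left h12 (by positivity)
      refine (norm_sub_le _ _).trans ((add_le_add hb1 hb2).trans ?_)
      rw [← add_mul]
      exact mul_le_mul_of_nonneg_right (by linarith) hX0
    have hu3 : 2 * u + 1 ≤ T := by rw [hTu]; nlinarith
    by_cases hn1 : |k - u| ≤ 1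
    · refine near (by linarith [(abs_le.1 hn1).2]) (Or.inl ?_)
      exact div_le_div_of_nonneg_left hT0.le (by positivity) (by linarith)
    by_cases hn2 : |k - 2 * u| ≤ 1
    · refine near (by linarith [(abs_le.1 hn2).2]) (Or.inr ?_)
      exact div_le_div_of_nonneg_left hT0.le (by positivity) (by linarith)
    push Not at hn1 hn2
    have hdist : ∀ x : ℝ, 1 < x → u / x ≤ 1 / 3 * (T / (1 + x)) := by
      intro x hx
      rw [← mul_div_assoc, div_le_div_iff₀ (by linarith) (by linarith)]
      have : 6 * u ≤ T := by rw [hTu]; nlinarith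
      nlinarith [mul_le_mul_of_nonneg_right this (by linarith : 0 ≤ x),
        mul_le_mul_of_nonneg_left hx.le hu0.le]
    have hA2 : u / |k - u| ≤ 1 / 3 * A := hdist _ hn1
    have hB2 : u / |k - 2 * u| ≤ 1 / 3 * B := hdist _ hn2
    rcases lt_or_ge (k : ℝ) u with hlt | hge
    · rw [hcl hlt, mul_zero, sub_zero]
      have hyT : y < T := by rw [hy, hTu]; gcongr
      refine (h1 y T hy0 (by linarith) hyT).trans (key C1 hC1.le (by linarith) _ ?_)
      rw [abs_of_neg (by linarith)] at hA2
      have e : T / (T - y) = u / -(k - u) := by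
        rw [hy, hTu, ← mul_sub, mul_div_mul_left _ _ (by positivity), neg_sub]
      rw [e]; linarith
    have hgt : u < k := lt_of_le_of_ne hge (by rintro rfl; simp at hn1; linarith)
    rcases lt_or_ge (k : ℝ) (2 * u) with hlt2 | hge2
    · rw [hcm hgt hlt2, mul_one]
      have hyT : T < y := by rw [hy, hTu]; gcongr
      have hyT2 : y < 2 * T := by
        rw [hy, hTu, show 2 * (2 * π * u) = 2 * π * (2 * u) by ring]; gcongr
      have h := h5 y T (by linarith) hyT hyT2
      rw [exp_neg_two_pi_mul_nat_mul_I, mul_one, norm_sub_rev] at h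
      refine h.trans (key C5 hC5.le (by linarith) _ ?_)
      rw [abs_of_pos (by linarith)] at hA2
      rw [abs_of_neg (by linarith)] at hB2
      have e : T / (y - T) = u / (k - u) := by
        rw [hy, hTu, ← mul_sub, mul_div_mul_left _ _ (by positivity)]
      have e2 : T / (2 * T - y) = u / -(k - 2 * u) := by
        rw [hy, hTu, show 2 * (2 * π * u) - 2 * π * k = 2 * π * (-(k - 2 * u)) by ring,
          mul_div_mul_left _ _ (by positivity)]
      rw [e, e2]; linarith
    have hgt2 : 2 * u < k := lt_of_le_of_ne hge2 (by intro h; rw [← h] at hn2; simp at hn2; linarith)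
    · rw [hcr hgt2, mul_zero, sub_zero]
      have hyT2 : 2 * T < y := by
        rw [hy, hTu, show 2 * (2 * π * u) = 2 * π * (2 * u) by ring]; gcongr
      refine (h2 y T (by linarith) hyT2).trans (key C2 hC2.le (by linarith) _ ?_)
      rw [abs_of_pos (by linarith)] at hB2
      have hd : 0 < k - 2 * u := by linarith
      have e : y / (y - 2 * T) = 1 + 2 * (u / (k - 2 * u)) := by
        rw [hy, hTu, show 2 * π * k - 2 * (2 * π * u) = 2 * π * (k - 2 * u) by ring,
          mul_div_mul_left _ _ (by positivity)]
        field_simp; ring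
      rw [e]; linarith
  have hneg2 : ‖∫ t in T..(2 * T), gammaWave y (-(π / 2)) ((5 / 4 : ℝ) + t * I)‖ ≤
      C4 * (K * P * (1 + A + B)) := by
    refine hneg.trans (mul_le_mul_of_nonneg_left ?_ hC4.le)
    calc Y = Y * 1 * 1 := by ring
      _ ≤ _ := by gcongr; linarith
  calc _ = ‖((∫ t in T..(2 * T), gammaWave y (π / 2) ((5 / 4 : ℝ) + t * I)) - 2 * π * c)
          + ∫ t in T..(2 * T), gammaWave y (-(π / 2)) ((5 / 4 : ℝ) + t * I)‖ := by congr 1; ring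
    _ ≤ _ := (norm_add_le _ _).trans (add_le_add hmain hneg2)
    _ = _ := by ring

lemma chi_eq_feFactor (s : ℂ) : chi s = feFactor (1 - s) := by
  have h2 : (2 : ℂ) * (2 * π) ^ (s - 1) = 2 ^ s * (π : ℂ) ^ (s - 1) := by
    rw [show (2 : ℂ) * π = ((2 : ℝ) : ℂ) * (π : ℝ) by push_cast; rfl,
      Complex.mul_cpow_ofReal_nonneg (by norm_num) Real.pi_pos.le, Complex.ofReal_ofNat, ← mul_assoc,
      Complex.cpow_sub _ _ two_ne_zero, Complex.cpow_one]
    field_simp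
  have h3 : Complex.cos (π * (1 - s) / 2) = Complex.sin (π * s / 2) := by
    rw [← Complex.cos_pi_div_two_sub]; congr 1; ring
  rw [chi, feFactor, h3, neg_sub, h2]
  ring

lemma chi_ne_zero_of_re_eq_half {s : ℂ} (hs : s.re = 1 / 2) : chi s ≠ 0 := by
  have h1 : Complex.sin (π * s / 2) ≠ 0 := by
    intro h
    obtain ⟨n, hn⟩ := Complex.sin_eq_zero_iff.1 h
    have h2 := congrArg Complex.re hn
    have e : ((π : ℂ) * s / 2) = ((π / 2 : ℝ) : ℂ) * s := by push_cast; ring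
    rw [e, Complex.re_ofReal_mul, hs] at h2
    simp only [mul_re, intCast_re, ofReal_re, intCast_im, ofReal_im, mul_zero, sub_zero] at h2
    have h3 : (1 : ℝ) = 4 * n := by
      have := Real.pi_pos
      field_simp at h2
      linarith
    have h4 : (1 : ℤ) = 4 * n := by exact_mod_cast h3
    omega
  have h2 : Complex.Gamma (1 - s) ≠ 0 :=
    Complex.Gamma_ne_zero_of_re_pos (by rw [sub_re, one_re, hs]; norm_num)
  have h3 : (π : ℂ) ≠ 0 := by exact_mod_cast Real.pi_ne_zero
  rw [chi]
  exact mul_ne_zero (mul_ne_zero (mul_ne_zero (by simp [Complex.cpow_eq_zero_iff])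
    (by simp [Complex.cpow_eq_zero_iff, h3])) h1) h2

lemma Z_sq_mul_zeta {t : ℝ} :
    Z t ^ 2 * riemannZeta (1 / 2 + I * t) = zetaCube (1 / 2 + I * t) := by
  set s : ℂ := 1 / 2 + I * t with hs
  have hre : s.re = 1 / 2 := by simp [hs]
  have hc := chi_ne_zero_of_re_eq_half hre
  have h1 : riemannZeta s = chi s * riemannZeta (1 - s) := by
    have h := zeta_one_sub_eq (s := 1 - s) (by rw [sub_re, one_re, hre]; norm_num) (by
      intro h; have := congrArg Complex.re h; rw [sub_re, one_re, hre] at this; norm_num at this)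
    rwa [sub_sub_cancel, ← chi_eq_feFactor] at h
  have h2 : (chi s ^ (-(1 / 2 : ℂ))) ^ 2 = (chi s)⁻¹ := by
    rw [pow_two, ← Complex.cpow_add _ _ hc, ← Complex.cpow_neg_one]
    norm_num
  calc Z t ^ 2 * riemannZeta s
      = (chi s)⁻¹ * riemannZeta s ^ 2 * (chi s * riemannZeta (1 - s)) := by
        rw [Z, mul_pow, h2, ← h1]
    _ = riemannZeta s ^ 2 * riemannZeta (1 - s) * ((chi s)⁻¹ * chi s) := by ring
    _ = zetaCube s := by rw [inv_mul_cancel₀ hc, mul_one, zetaCube]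

lemma d3_eq_sum_card_divisors (n : ℕ) : d3 n = ∑ m ∈ n.divisors, m.divisors.card := by
  rcases eq_or_ne n 0 with rfl | hn
  · simp [d3]
  rw [d3, Finset.card_eq_sum_card_fiberwise (f := fun p : ℕ × ℕ × ℕ => p.1 * p.2.1) (t := n.divisors)]
  · refine Finset.sum_congr rfl fun m hm => ?_
    obtain ⟨hmn, -⟩ := Nat.mem_divisors.1 hm
    have hm0 : 0 < m := Nat.pos_of_mem_divisors hm
    refine Finset.card_bij (fun p _ => p.1) ?_ ?_ ?_
    · rintro ⟨a, b, c⟩ h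
      simp only [Finset.mem_filter] at h
      exact Nat.mem_divisors.2 ⟨⟨b, h.2.symm⟩, hm0.ne'⟩
    · rintro ⟨a, b, c⟩ h ⟨a', b', c'⟩ h' (rfl : a = a')
      simp only [Finset.mem_filter, Finset.mem_product, Finset.mem_Icc] at h h'
      obtain ⟨⟨⟨⟨ha, -⟩, -⟩, h1⟩, h2⟩ := h
      obtain ⟨⟨-, h1'⟩, h2'⟩ := h'
      have hb : b = b' := Nat.eq_of_mul_eq_mul_left ha (h2.trans h2'.symm)
      have hc : c = c' := by
        rw [h2] at h1; rw [h2'] at h1'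
        exact Nat.eq_of_mul_eq_mul_left hm0 (h1.trans h1'.symm)
      rw [hb, hc]
    · intro a ha
      obtain ⟨b, hb⟩ := (Nat.mem_divisors.1 ha).1
      obtain ⟨c, hc⟩ := hmn
      have hn0 : 0 < n := Nat.pos_of_ne_zero hn
      have habc : a * b * c = n := by rw [← hb, hc]
      have h0 : a ≠ 0 ∧ b ≠ 0 ∧ c ≠ 0 := by
        refine ⟨?_, ?_, ?_⟩ <;> rintro rfl <;> simp at habc <;> omega
      refine ⟨(a, b, c), ?_, rfl⟩
      simp only [Finset.mem_filter, Finset.mem_product, Finset.mem_Icc]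
      refine ⟨⟨⟨⟨by omega, Nat.le_of_dvd hn0 ⟨b * c, by rw [← habc]; ring⟩⟩,
        ⟨by omega, Nat.le_of_dvd hn0 ⟨a * c, by rw [← habc]; ring⟩⟩,
        ⟨by omega, Nat.le_of_dvd hn0 ⟨a * b, by rw [← habc]; ring⟩⟩⟩, habc⟩, hb.symm⟩
  · rintro ⟨a, b, c⟩ h
    simp only [Finset.coe_filter, Set.mem_ofPred_eq] at h
    exact Nat.mem_divisors.2 ⟨⟨c, h.2.symm⟩, hn⟩

lemma add_one_le_mul_two_rpow (a : ℕ) : (a + 1 : ℝ) ≤ 16 * (2 : ℝ) ^ ((a : ℝ) / 8) := by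
  have h1 : (a : ℝ) / 16 + 1 ≤ (2 : ℝ) ^ ((a : ℝ) / 8) := by
    rw [Real.rpow_def_of_pos two_pos]
    refine le_trans ?_ (Real.add_one_le_exp _)
    have := Real.log_two_gt_d9
    nlinarith [Nat.cast_nonneg (α := ℝ) a]
  linarith [Nat.cast_nonneg (α := ℝ) a]

lemma add_one_le_rpow_div_eight {p : ℕ} (hp : 256 ≤ p) (a : ℕ) :
    (a + 1 : ℝ) ≤ (p : ℝ) ^ ((a : ℝ) / 8) := by
  have hp' : (256 : ℝ) ≤ p := by exact_mod_cast hp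
  calc (a + 1 : ℝ) ≤ (2 : ℝ) ^ a := by
        exact_mod_cast Nat.lt_two_pow_self (n := a)
    _ = (256 : ℝ) ^ ((a : ℝ) / 8) := by
        rw [show (256 : ℝ) = (2 : ℝ) ^ (8 : ℝ) by norm_num, ← Real.rpow_mul (by norm_num),
          ← Real.rpow_natCast]
        congr 1; ring
    _ ≤ _ := Real.rpow_le_rpow (by norm_num) hp' (by positivity)

lemma card_divisors_le_rpow {n : ℕ} (hn : n ≠ 0) :
    (n.divisors.card : ℝ) ≤ 16 ^ 256 * (n : ℝ) ^ (1 / 8 : ℝ) := by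
  have hpow : (n : ℝ) ^ (1 / 8 : ℝ) =
      ∏ p ∈ n.primeFactors, (p : ℝ) ^ ((n.factorization p : ℝ) / 8) := by
    conv_lhs => rw [← Nat.prod_factorization_pow_eq_self hn]
    rw [Finsupp.prod, Nat.support_factorization, Nat.cast_prod,
      ← Real.finsetProd_rpow _ _ (fun p _ => by positivity)]
    refine Finset.prod_congr rfl fun p _ => ?_
    rw [Nat.cast_pow, ← Real.rpow_natCast, ← Real.rpow_mul (by positivity)]
    congr 1; ring
  have hconst : ∏ p ∈ n.primeFactors, (if p < 256 then (16 : ℝ) else 1) ≤ 16 ^ 256 := by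
    rw [Finset.prod_ite, Finset.prod_const, Finset.prod_const_one, mul_one]
    refine pow_le_pow_right₀ (by norm_num) ?_
    calc _ ≤ (Finset.range 256).card := Finset.card_le_card fun p hp => by
          simp only [Finset.mem_filter] at hp; exact Finset.mem_range.2 hp.2
      _ = 256 := Finset.card_range _
  rw [Nat.card_divisors hn, hpow]
  push_cast
  calc ∏ p ∈ n.primeFactors, ((n.factorization p : ℝ) + 1)
      ≤ ∏ p ∈ n.primeFactors, ((if p < 256 then (16 : ℝ) else 1) *
          (p : ℝ) ^ ((n.factorization p : ℝ) / 8)) := by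
        refine Finset.prod_le_prod (fun p _ => by positivity) fun p hp => ?_
        split_ifs with h
        · refine (add_one_le_mul_two_rpow _).trans (mul_le_mul_of_nonneg_left ?_ (by norm_num))
          refine Real.rpow_le_rpow (by norm_num) ?_ (by positivity)
          exact_mod_cast (Nat.prime_of_mem_primeFactors hp).two_le
        · rw [one_mul]; exact add_one_le_rpow_div_eight (not_lt.1 h) _
    _ = _ := Finset.prod_mul_distrib
    _ ≤ _ := mul_le_mul_of_nonneg_right hconst (Finset.prod_nonneg fun p _ => by positivity)

lemma exists_d3_le : ∃ C > 0, ∀ n : ℕ, n ≠ 0 → (d3 n : ℝ) ≤ C * (n : ℝ) ^ (1 / 4 : ℝ) := by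
  refine ⟨(16 ^ 256) ^ 2, by positivity, fun n hn => ?_⟩
  have h1 : d3 n ≤ n.divisors.card * n.divisors.card := by
    rw [d3_eq_sum_card_divisors, ← smul_eq_mul]
    exact Finset.sum_le_card_nsmul _ _ _ fun m hm =>
      Finset.card_le_card (Nat.divisors_subset_of_dvd hn (Nat.dvd_of_mem_divisors hm))
  have h2 := card_divisors_le_rpow hn
  calc (d3 n : ℝ) ≤ n.divisors.card * n.divisors.card := by exact_mod_cast h1
    _ ≤ (16 ^ 256 * (n : ℝ) ^ (1 / 8 : ℝ)) * (16 ^ 256 * (n : ℝ) ^ (1 / 8 : ℝ)) :=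
        mul_le_mul h2 h2 (by positivity) (by positivity)
    _ = (16 ^ 256) ^ 2 * ((n : ℝ) ^ (1 / 8 : ℝ) * (n : ℝ) ^ (1 / 8 : ℝ)) := by
        generalize (16 : ℝ) ^ 256 = M; ring
    _ = _ := by
        rw [← Real.rpow_add (by positivity)]; congr 2; norm_num

open ArithmeticFunction in
lemma d3_LSeriesHasSum {s : ℂ} (hs : 1 < s.re) :
    LSeriesHasSum (fun n => (d3 n : ℂ)) s (riemannZeta s ^ 3) := by
  have h1 : LSeriesHasSum (fun n => ((ArithmeticFunction.zeta : ArithmeticFunction ℂ) n)) s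
      (riemannZeta s) := by
    have := LSeriesHasSum_zeta hs
    simpa using this
  have h2 := LSeriesHasSum_mul (LSeriesHasSum_mul h1 h1) h1
  rw [show riemannZeta s * riemannZeta s * riemannZeta s = riemannZeta s ^ 3 by ring] at h2
  convert h2 using 2 with n
  have : (d3 n : ℂ) = ((((ArithmeticFunction.zeta * ArithmeticFunction.zeta) *
      ArithmeticFunction.zeta : ArithmeticFunction ℕ) n : ℕ) : ℂ) := by
    congr 1
    rw [d3_eq_sum_card_divisors, mul_zeta_apply]
    refine Finset.sum_congr rfl fun m _ => ?_
    rw [mul_zeta_apply, Finset.card_eq_sum_ones]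
    refine Finset.sum_congr rfl fun a ha => ?_
    rw [zeta_apply_ne (Nat.pos_of_mem_divisors ha).ne']
  rw [this, ← natCoe_apply, natCoe_mul, natCoe_mul]

lemma summable_d3_mul_rpow : Summable fun k : ℕ => (d3 k : ℝ) * (k : ℝ) ^ (-(5 / 4) : ℝ) := by
  have h := (d3_LSeriesHasSum (s := ((5 / 4 : ℝ) : ℂ)) (by rw [ofReal_re]; norm_num)).LSeriesSummable
  refine h.norm.congr fun k => ?_
  rcases eq_or_ne k 0 with rfl | hk
  · simp [d3]
  rw [LSeries.norm_term_eq, if_neg hk, ofReal_re, Complex.norm_natCast, Real.rpow_neg (by positivity),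
    div_eq_mul_inv]

lemma sum_range_one_div_add_one_le {m M : ℕ} (h : m ≤ M) (hM : 1 ≤ M) :
    ∑ i ∈ Finset.range m, 1 / ((i : ℝ) + 1) ≤ 1 + Real.log M := by
  rcases Nat.eq_zero_or_pos m with rfl | hm
  · simpa using add_nonneg zero_le_one (Real.log_nonneg (by exact_mod_cast hM))
  have h1 := harmonic_le_one_add_log m
  have h2 : Real.log m ≤ Real.log M := Real.log_le_log (by exact_mod_cast hm) (by exact_mod_cast h)
  simp only [harmonic, Rat.cast_sum, Rat.cast_inv, Rat.cast_add, Rat.cast_natCast, Rat.cast_one,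
    Nat.cast_add, Nat.cast_one] at h1
  simp only [one_div]
  linarith

lemma sum_range_one_div_one_add_abs_le {v : ℝ} (hv : 0 ≤ v) {M : ℕ} (hM : v < M) :
    ∑ k ∈ Finset.range M, 1 / (1 + |(k : ℝ) - v|) ≤ 2 * (1 + Real.log M) := by
  have hfl := Nat.floor_le hv
  have hfl2 := Nat.lt_floor_add_one v
  set n := ⌊v⌋₊ with hn
  have hnM : n + 1 ≤ M := by
    have : (n : ℝ) < M := lt_of_le_of_lt hfl hM
    exact_mod_cast this
  obtain ⟨m, rfl⟩ := Nat.exists_eq_add_of_le hnM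
  rw [Finset.sum_range_add, two_mul]
  refine add_le_add ?_ ?_
  · rw [← Finset.sum_range_reflect]
    refine le_trans (Finset.sum_le_sum fun j hj => ?_)
      (sum_range_one_div_add_one_le (m := n + 1) (by omega) (by omega))
    have hj' := Finset.mem_range.1 hj
    rw [show n + 1 - 1 - j = n - j by omega, Nat.cast_sub (by omega)]
    refine one_div_le_one_div_of_le (by positivity) ?_
    rw [abs_sub_comm]
    linarith [le_abs_self (v - ((n : ℝ) - j))]
  · refine le_trans (Finset.sum_le_sum fun j hj => ?_)
      (sum_range_one_div_add_one_le (m := m) (by omega) (by omega))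
    refine one_div_le_one_div_of_le (by positivity) ?_
    push_cast
    linarith [le_abs_self ((n : ℝ) + 1 + j - v)]

lemma exists_tsum_d3_near_le : ∃ C > 0, ∀ v : ℝ, 2 ≤ v →
    Summable (fun k : ℕ => (d3 k : ℝ) * (k : ℝ) ^ (-(5 / 4) : ℝ) * (v / (1 + |k - v|))) ∧
    ∑' k : ℕ, (d3 k : ℝ) * (k : ℝ) ^ (-(5 / 4) : ℝ) * (v / (1 + |k - v|)) ≤
      C * (1 + Real.log v) := by
  obtain ⟨D, hD, hd⟩ := exists_d3_le
  set W := ∑' k : ℕ, (d3 k : ℝ) * (k : ℝ) ^ (-(5 / 4) : ℝ) with hW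
  have hW0 : 0 ≤ W := tsum_nonneg fun k => by positivity
  refine ⟨W + 9 * D, by positivity, fun v hv => ?_⟩
  have hlv : 0 ≤ Real.log v := Real.log_nonneg (by linarith)
  obtain ⟨M, hM⟩ : ∃ M, M = ⌈2 * v⌉₊ := ⟨_, rfl⟩
  have hM1 : 2 * v ≤ M := hM ▸ Nat.le_ceil _
  have hM2 : (M : ℝ) ≤ 3 * v := by
    have := Nat.ceil_lt_add_one (show 0 ≤ 2 * v by linarith)
    rw [← hM] at this; linarith
  have hMpos : (0 : ℝ) < M := by linarith
  have hM0 : 1 ≤ M := by exact_mod_cast hMpos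
  have hlogM : Real.log M ≤ 2 + Real.log v := by
    calc Real.log M ≤ Real.log (3 * v) := Real.log_le_log hMpos hM2
      _ = Real.log 3 + Real.log v := Real.log_mul (by norm_num) (by linarith)
      _ ≤ _ := by linarith [Real.log_le_sub_one_of_pos (show (0 : ℝ) < 3 by norm_num)]
  set g : ℕ → ℝ := fun k => if k ∈ Finset.range M then
    D * (1 / (1 + |(k : ℝ) - v|) + 1 / (k : ℝ)) else 0 with hg
  have hgs : HasSum g (∑ k ∈ Finset.range M, D * (1 / (1 + |(k : ℝ) - v|) + 1 / (k : ℝ))) := by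
    have : ∑ k ∈ Finset.range M, D * (1 / (1 + |(k : ℝ) - v|) + 1 / (k : ℝ)) =
        ∑ k ∈ Finset.range M, g k := Finset.sum_congr rfl fun k hk => by rw [hg]; simp only [if_pos hk]
    rw [this]
    exact hasSum_sum_of_ne_finset_zero fun k hk => by rw [hg]; simp only [if_neg hk]
  have hsum := (summable_d3_mul_rpow.hasSum).add hgs
  have hle : ∀ k : ℕ, (d3 k : ℝ) * (k : ℝ) ^ (-(5 / 4) : ℝ) * (v / (1 + |k - v|)) ≤
      (d3 k : ℝ) * (k : ℝ) ^ (-(5 / 4) : ℝ) + g k := by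
    intro k
    rcases eq_or_ne k 0 with rfl | hk
    · have : 0 ≤ g 0 := by
        rw [hg]; simp only; split_ifs <;> positivity
      simpa [d3] using this
    have hk0 : (0 : ℝ) < k := by exact_mod_cast Nat.pos_of_ne_zero hk
    by_cases hkM : k ∈ Finset.range M
    · have e1 : (d3 k : ℝ) * (k : ℝ) ^ (-(5 / 4) : ℝ) ≤ D * (1 / k) := by
        calc (d3 k : ℝ) * (k : ℝ) ^ (-(5 / 4) : ℝ)
            ≤ D * (k : ℝ) ^ (1 / 4 : ℝ) * (k : ℝ) ^ (-(5 / 4) : ℝ) :=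
              mul_le_mul_of_nonneg_right (hd k hk) (by positivity)
          _ = D * (1 / k) := by
              rw [mul_assoc, ← Real.rpow_add hk0, show (1 / 4 + -(5 / 4) : ℝ) = -1 by norm_num,
                Real.rpow_neg_one, one_div]
      have e2 : 1 / (k : ℝ) * (v / (1 + |k - v|)) ≤ 1 / (1 + |(k : ℝ) - v|) + 1 / (k : ℝ) := by
        have hp : 0 ≤ |(k : ℝ) - v| := abs_nonneg _
        have hv' : v ≤ k + |(k : ℝ) - v| := by linarith [neg_abs_le ((k : ℝ) - v)]
        rw [div_mul_div_comm, div_add_div _ _ (by positivity) (by positivity), mul_comm (k : ℝ)]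
        exact div_le_div_of_nonneg_right (by linarith) (by positivity)
      have e3 : g k = D * (1 / (1 + |(k : ℝ) - v|) + 1 / (k : ℝ)) := by
        rw [hg]; simp only [if_pos hkM]
      calc _ ≤ D * (1 / k) * (v / (1 + |(k : ℝ) - v|)) :=
            mul_le_mul_of_nonneg_right e1 (by positivity)
        _ = D * (1 / k * (v / (1 + |(k : ℝ) - v|))) := by ring
        _ ≤ g k := by rw [e3]; exact mul_le_mul_of_nonneg_left e2 hD.le
        _ ≤ _ := le_add_of_nonneg_left (by positivity)
    · have e3 : g k = 0 := by rw [hg]; simp only [if_neg hkM]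
      have hkM' : (M : ℝ) ≤ k := by exact_mod_cast not_lt.1 (fun h => hkM (Finset.mem_range.2 h))
      rw [e3, add_zero]
      refine mul_le_of_le_one_right (by positivity) ?_
      rw [div_le_one (by positivity)]
      linarith [le_abs_self ((k : ℝ) - v)]
  have hS : Summable (fun k : ℕ => (d3 k : ℝ) * (k : ℝ) ^ (-(5 / 4) : ℝ) * (v / (1 + |k - v|))) :=
    Summable.of_nonneg_of_le (fun k => by positivity) hle hsum.summable
  refine ⟨hS, (hS.tsum_le_tsum hle hsum.summable).trans ?_⟩
  rw [hsum.tsum_eq, ← hW, ← Finset.mul_sum, Finset.sum_add_distrib]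
  have s1 := sum_range_one_div_one_add_abs_le (show 0 ≤ v by linarith) (show v < M by linarith)
  have s2 : ∑ k ∈ Finset.range M, 1 / (k : ℝ) ≤ 1 + Real.log M := by
    obtain ⟨m, rfl⟩ : ∃ m, M = m + 1 := ⟨M - 1, by omega⟩
    rw [Finset.sum_range_succ']
    have := sum_range_one_div_add_one_le (m := m) (M := m + 1) (by omega) hM0
    simpa using this
  have s3 : ∑ k ∈ Finset.range M, 1 / (1 + |(k : ℝ) - v|) + ∑ k ∈ Finset.range M, 1 / (k : ℝ) ≤
      9 * (1 + Real.log v) := by linarith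
  calc _ ≤ W + D * (9 * (1 + Real.log v)) := by
        have := mul_le_mul_of_nonneg_left s3 hD.le
        linarith
    _ ≤ _ := by nlinarith

lemma exists_tsum_d3_weight_le : ∃ C > 0, ∀ T : ℝ, 30 ≤ T →
    Summable (fun k : ℕ => (d3 k : ℝ) * ((k : ℝ) ^ (-(5 / 4) : ℝ) * T ^ (3 / 4 : ℝ) *
        (1 + T / (1 + |k - T / (2 * π)|) + T / (1 + |k - T / π|)))) ∧
    ∑' k : ℕ, (d3 k : ℝ) * ((k : ℝ) ^ (-(5 / 4) : ℝ) * T ^ (3 / 4 : ℝ) *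
        (1 + T / (1 + |k - T / (2 * π)|) + T / (1 + |k - T / π|))) ≤
      C * (T ^ (3 / 4 : ℝ) * Real.log T ^ 2) := by
  obtain ⟨C, hC, h⟩ := exists_tsum_d3_near_le
  set W := ∑' k : ℕ, (d3 k : ℝ) * (k : ℝ) ^ (-(5 / 4) : ℝ) with hW
  have hW0 : 0 ≤ W := tsum_nonneg fun k => by positivity
  have hπ := Real.pi_gt_three
  have hπ4 := Real.pi_lt_four
  refine ⟨W + 6 * π * C, by positivity, fun T hT => ?_⟩
  have hu : 2 ≤ T / (2 * π) := by rw [le_div_iff₀ (by positivity)]; linarith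
  have hu' : 2 ≤ T / π := by rw [le_div_iff₀ (by positivity)]; linarith
  obtain ⟨a1, a2⟩ := h _ hu
  obtain ⟨b1, b2⟩ := h _ hu'
  have hlog : 1 ≤ Real.log T := by
    rw [Real.le_log_iff_exp_le (by linarith)]
    linarith [Real.exp_one_lt_d9]
  have l1 : Real.log (T / (2 * π)) ≤ Real.log T :=
    Real.log_le_log (by linarith) (div_le_self (by linarith) (by linarith))
  have l2 : Real.log (T / π) ≤ Real.log T :=
    Real.log_le_log (by linarith) (div_le_self (by linarith) (by linarith))
  have hs := ((summable_d3_mul_rpow.hasSum.add (a1.hasSum.mul_left (2 * π))).add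
    (b1.hasSum.mul_left π)).mul_left (T ^ (3 / 4 : ℝ))
  have he : (fun k : ℕ => (d3 k : ℝ) * ((k : ℝ) ^ (-(5 / 4) : ℝ) * T ^ (3 / 4 : ℝ) *
        (1 + T / (1 + |k - T / (2 * π)|) + T / (1 + |k - T / π|)))) = fun k : ℕ =>
      T ^ (3 / 4 : ℝ) * ((d3 k : ℝ) * (k : ℝ) ^ (-(5 / 4) : ℝ) +
        2 * π * ((d3 k : ℝ) * (k : ℝ) ^ (-(5 / 4) : ℝ) * (T / (2 * π) / (1 + |k - T / (2 * π)|))) +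
        π * ((d3 k : ℝ) * (k : ℝ) ^ (-(5 / 4) : ℝ) * (T / π / (1 + |k - T / π|)))) := by
    funext k
    have e1 : T / (1 + |k - T / (2 * π)|) = 2 * π * (T / (2 * π) / (1 + |k - T / (2 * π)|)) := by
      rw [← mul_div_assoc, mul_div_cancel₀ _ (by positivity)]
    have e2 : T / (1 + |k - T / π|) = π * (T / π / (1 + |k - T / π|)) := by
      rw [← mul_div_assoc, mul_div_cancel₀ _ (by positivity)]
    rw [e1, e2]; ring
  rw [he]
  refine ⟨hs.summable, ?_⟩
  rw [hs.tsum_eq, mul_left_comm]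
  refine mul_le_mul_of_nonneg_left ?_ (by positivity)
  have hsq : Real.log T ≤ Real.log T ^ 2 := by nlinarith
  have hC1 : C * (1 + Real.log (T / (2 * π))) ≤ C * (2 * Real.log T ^ 2) :=
    mul_le_mul_of_nonneg_left (by linarith) hC.le
  have hC2 : C * (1 + Real.log (T / π)) ≤ C * (2 * Real.log T ^ 2) :=
    mul_le_mul_of_nonneg_left (by linarith) hC.le
  have c1 := mul_le_mul_of_nonneg_left (a2.trans hC1) (by positivity : 0 ≤ 2 * π)
  have c2 := mul_le_mul_of_nonneg_left (b2.trans hC2) Real.pi_pos.le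
  have c3 : W ≤ W * Real.log T ^ 2 := le_mul_of_one_le_right hW0 (by linarith)
  linarith

lemma continuous_feFactor_vertical {σ : ℝ} (hσ : 0 < σ) :
    Continuous fun t : ℝ => feFactor (σ + t * I) := by
  have h : (fun t : ℝ => feFactor (σ + t * I)) = fun t : ℝ =>
      gammaWave (2 * π * (1 : ℕ)) (π / 2) (σ + t * I) +
        gammaWave (2 * π * (1 : ℕ)) (-(π / 2)) (σ + t * I) := by
    funext t
    rw [← feFactor_mul_cpow_neg one_ne_zero]
    simp
  rw [h]
  exact (continuous_gammaWave_vertical _ _ hσ).add (continuous_gammaWave_vertical _ _ hσ)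

lemma hasSum_zetaCube {s : ℂ} (hs : 1 < s.re) :
    HasSum (fun k : ℕ => (d3 k : ℂ) * (feFactor s * (k : ℂ) ^ (-s))) (zetaCube s) := by
  have h := (d3_LSeriesHasSum hs).mul_left (feFactor s)
  have e : feFactor s * riemannZeta s ^ 3 = zetaCube s := by
    rw [zetaCube, zeta_one_sub_eq (by linarith) (by rintro rfl; simp at hs)]; ring
  rw [e] at h
  refine (funext fun k => ?_ : (fun k : ℕ => (d3 k : ℂ) * (feFactor s * (k : ℂ) ^ (-s))) = _) ▸ h
  rw [LSeries.term_def₀ (by simp [d3])]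
  ring

lemma hasSum_integral_zetaCube (a b : ℝ) :
    HasSum (fun k : ℕ => (d3 k : ℂ) * ∫ t in a..b, feFactor ((5 / 4 : ℝ) + t * I) *
      (k : ℂ) ^ (-((5 / 4 : ℝ) + t * I : ℂ))) (∫ t in a..b, zetaCube ((5 / 4 : ℝ) + t * I)) := by
  have hc := continuous_feFactor_vertical (σ := 5 / 4) (by norm_num)
  simp_rw [← intervalIntegral.integral_const_mul]
  refine intervalIntegral.hasSum_integral_of_dominated_convergence
    (fun k t => ‖feFactor ((5 / 4 : ℝ) + t * I)‖ * ((d3 k : ℝ) * (k : ℝ) ^ (-(5 / 4) : ℝ)))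
    (fun k => ?_) (fun k => ?_) ?_ ?_ ?_
  · rcases eq_or_ne k 0 with rfl | hk
    · simpa [d3] using aestronglyMeasurable_const
    · refine Continuous.aestronglyMeasurable (continuous_const.mul (hc.mul ?_))
      exact Continuous.const_cpow (by fun_prop) (Or.inl (by exact_mod_cast hk))
  · refine Eventually.of_forall fun t _ => ?_
    rcases eq_or_ne k 0 with rfl | hk
    · simp [d3]
    · rw [norm_mul, norm_mul, Complex.norm_natCast,
        Complex.norm_natCast_cpow_of_pos (Nat.pos_of_ne_zero hk)]
      refine le_of_eq ?_
      simp only [neg_re, add_re, ofReal_re, mul_re, I_re, mul_zero, ofReal_im, I_im, mul_one,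
        sub_self, add_zero]
      ring
  · exact Eventually.of_forall fun t _ => summable_d3_mul_rpow.mul_left _
  · simp_rw [tsum_mul_left]
    exact (hc.norm.mul continuous_const).intervalIntegrable _ _
  · exact Eventually.of_forall fun t _ => hasSum_zetaCube (by simp; norm_num)

lemma hasSum_psum {a b : ℝ} (hb : 0 ≤ b) (f : ℕ → ℂ) :
    HasSum (fun k : ℕ => (if a ≤ k ∧ (k : ℝ) ≤ b then
      (if (k : ℝ) = a ∨ (k : ℝ) = b then (1 / 2 : ℂ) else 1) else 0) * f k) (psum a b f) := by
  have h : psum a b f = ∑ k ∈ Finset.Icc ⌈a⌉₊ ⌊b⌋₊, (if a ≤ k ∧ (k : ℝ) ≤ b then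
      (if (k : ℝ) = a ∨ (k : ℝ) = b then (1 / 2 : ℂ) else 1) else 0) * f k := by
    refine Finset.sum_congr rfl fun k hk => ?_
    rw [Finset.mem_Icc, Nat.ceil_le, Nat.le_floor_iff hb] at hk
    rw [if_pos hk]
  rw [h]
  refine hasSum_sum_of_ne_finset_zero fun k hk => ?_
  rw [Finset.mem_Icc, Nat.ceil_le, Nat.le_floor_iff hb] at hk
  rw [if_neg hk, zero_mul]

lemma exists_norm_integral_zetaCube_right_sub_le : ∃ C > 0, ∀ T : ℝ, 30 ≤ T →
    ‖(∫ t in T..(2 * T), zetaCube ((5 / 4 : ℝ) + t * I)) -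
      2 * π * psum (T / (2 * π)) (T / π) (fun k => (d3 k : ℂ))‖ ≤
      C * (T ^ (3 / 4 : ℝ) * Real.log T ^ 2) := by
  obtain ⟨C1, hC1, h1⟩ := exists_norm_integral_term_sub_le
  obtain ⟨C2, hC2, h2⟩ := exists_tsum_d3_weight_le
  refine ⟨C1 * C2, by positivity, fun T hT => ?_⟩
  obtain ⟨hs, hle⟩ := h2 T hT
  have hx : 0 ≤ T / π := div_nonneg (by linarith) Real.pi_pos.le
  have hlt : T / (2 * π) < T / π :=
    div_lt_div_of_pos_left (by linarith) Real.pi_pos (by linarith [Real.pi_pos])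
  have hsum := (hasSum_integral_zetaCube T (2 * T)).sub
    ((hasSum_psum (a := T / (2 * π)) hx (fun k => (d3 k : ℂ))).mul_left (2 * π : ℂ))
  rw [← hsum.tsum_eq, mul_assoc]
  refine (tsum_of_norm_bounded (hs.hasSum.mul_left C1) fun k => ?_).trans
    (mul_le_mul_of_nonneg_left hle hC1.le)
  rcases eq_or_ne k 0 with rfl | hk
  · simp [d3]
  set c : ℂ := if T / (2 * π) ≤ k ∧ (k : ℝ) ≤ T / π then
      (if (k : ℝ) = T / (2 * π) ∨ (k : ℝ) = T / π then (1 / 2 : ℂ) else 1) else 0 with hc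
  have h := h1 T k c hT hk (by rw [hc]; split_ifs <;> norm_num)
    (fun h => if_neg (fun h' => absurd h'.1 (not_le.2 h)))
    (fun h h' => by rw [hc, if_pos ⟨h.le, h'.le⟩, if_neg (by rintro (h'' | h'') <;> linarith)])
    (fun h => if_neg (fun h' => absurd h'.2 (not_le.2 h)))
  rw [show ∀ J : ℂ, (d3 k : ℂ) * J - 2 * π * (c * d3 k) = (d3 k : ℂ) * (J - 2 * π * c) by
    intro J; ring, norm_mul, Complex.norm_natCast, mul_left_comm C1]
  exact mul_le_mul_of_nonneg_left h (by positivity)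

theorem stmt14 :
    (fun T : ℝ =>
        (∫ t in T..(2 * T), (Z t) ^ 2 * riemannZeta (1 / 2 + I * t)) -
          2 * π * psum (T / (2 * π)) (T / π) (fun k => (d3 k : ℂ)))
      =O[atTop] fun T : ℝ => T ^ ((3:ℝ)/4) * (Real.log T) ^ 2 := by
  obtain ⟨C1, hC1, h1⟩ := exists_norm_contour_shift_le
  obtain ⟨C2, hC2, h2⟩ := exists_norm_integral_zetaCube_right_sub_le
  refine Asymptotics.IsBigO.of_bound (C1 + C2) ?_
  filter_upwards [eventually_ge_atTop 30] with T hT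
  have a1 := h1 T (by linarith)
  have a2 := h2 T hT
  have e : ∀ t : ℝ, ((5 / 4 : ℝ) : ℂ) + t * I = 5 / 4 + I * t := fun t => by push_cast; ring
  simp_rw [e] at a2
  simp_rw [Z_sq_mul_zeta]
  rw [Real.norm_of_nonneg (by positivity), add_mul]
  exact (norm_sub_le_norm_sub_add_norm_sub _ _ _).trans (add_le_add a1 a2)
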